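/- Fix a real number N ≥ 4 and set γ = N/(N−2), and define G(v) = (1/γ)(1 − (1+v)^{−γ}) for v > −1, G_I(v) = G'(v) − 1, and G_II(v) = (N/2)(v·G'(v) − G(v)). Let Φ(X) = ∑_{k=0}^∞ (−1)^k X^k/(k! Γ(N/2 + k)), let λ > 0 satisfy Φ(λ) = 0, let θ₀ ∈ ℝ, and set y₁(t,z) = sin(√λ·t + θ₀)·Φ(λz). Then for every T > 0 there exist ε₁ > 0 and C > 0 such that for every ε with |ε| ≤ ε₁ there exists y ∈ C^∞([0,T]×[0,1]) with: y(t,1) = 0 for all t ∈ [0,T]; sup_{[0,T]×[0,1]} |∂_z y| < 1; y satisfies ∂_t²y(t,z) − Δy(t,z) = G_I(−∂_z y(t,z))·Δy(t,z) + G_II(−∂_z y(t,z)) for all (t,z) ∈ [0,T]×(0,1); and sup_{[0,T]×[0,1]} |y(t,z) − ε·y₁(t,z)| ≤ C·ε². -/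

import Mathlib

open MeasureTheory Real Set

noncomputable section

/-- The degenerate operator `Δy(z) = z y''(z) + (N/2) y'(z)`. -/
def Del (N : ℝ) (f : ℝ → ℝ) : ℝ → ℝ :=
  fun z => z * deriv (deriv f) z + (N / 2) * deriv f z

/-- Iterates `Δ^m`. -/
def DelIter (N : ℝ) : ℕ → (ℝ → ℝ) → ℝ → ℝ
  | 0 => fun f => f
  | m + 1 => fun f => Del N (DelIter N m f)

/-- `Ḋ = √z d/dz`. -/
def Ddot (f : ℝ → ℝ) : ℝ → ℝ := fun z => Real.sqrt z * deriv f z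

/-- The weighted L² norm on (0,1). -/
def Xnorm (N : ℝ) (f : ℝ → ℝ) : ℝ :=
  Real.sqrt (∫ z in (0:ℝ)..1, (f z) ^ 2 * z ^ (N / 2 - 1))

/-- Graded seminorms `(y)_ℓ`. -/
def gnorm (N : ℝ) (ℓ : ℕ) (f : ℝ → ℝ) : ℝ :=
  if ℓ % 2 = 0 then Xnorm N (DelIter N (ℓ / 2) f)
  else Xnorm N (Ddot (DelIter N (ℓ / 2) f))

/-- Graded norm `‖y‖_n`. -/
def normN (N : ℝ) (n : ℕ) (f : ℝ → ℝ) : ℝ :=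
  Real.sqrt (∑ ℓ ∈ Finset.range (n + 1), (gnorm N ℓ f) ^ 2)

/-- Sup norm on [0,1]. -/
def supN (f : ℝ → ℝ) : ℝ := ⨆ z : Icc (0:ℝ) 1, |f z.1|

/-- `|y|_n = ∑_{ℓ≤n} ‖Ḋ^ℓ y‖_{L^∞(0,1)}`. -/
def supLow (n : ℕ) (f : ℝ → ℝ) : ℝ := ∑ ℓ ∈ Finset.range (n + 1), supN (Ddot^[ℓ] f)

/-- Time derivative of a function of (t,z). -/
def dt (y : ℝ → ℝ → ℝ) : ℝ → ℝ → ℝ := fun t z => deriv (fun s => y s z) t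

/-- Sup norm on [0,T]×[0,1]. -/
def supT (T : ℝ) (y : ℝ → ℝ → ℝ) : ℝ :=
  ⨆ (t : Icc (0:ℝ) T) (z : Icc (0:ℝ) 1), |y t.1 z.1|

/-- `|y|_n^T = sup_{j+k≤n} ‖∂_t^j Ḋ^k y‖_{L^∞([0,T]×[0,1])}`. -/
def supNT (T : ℝ) (n : ℕ) (y : ℝ → ℝ → ℝ) : ℝ :=
  ⨆ p : {p : ℕ × ℕ // p.1 + p.2 ≤ n}, supT T (fun t => Ddot^[p.1.2] (dt^[p.1.1] y t))

/-- `‖y‖_n^T`. -/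
def normT (N T : ℝ) (n : ℕ) (y : ℝ → ℝ → ℝ) : ℝ :=
  Real.sqrt (∑ j ∈ Finset.range (n + 1), ∑ k ∈ Finset.range (n + 1 - j),
    ∫ t in (0:ℝ)..T, (normN N k (dt^[j] y t)) ^ 2)

/-- `Z_n(H)(t) = ∑_{j+k=n} ‖∂_t^j H(t,·)‖_k`. -/
def ZZ (N : ℝ) (n : ℕ) (H : ℝ → ℝ → ℝ) (t : ℝ) : ℝ :=
  ∑ j ∈ Finset.range (n + 1), normN N (n - j) (dt^[j] H t)

/-- The operator `𝒜h = -b₂ Δh + b₁ Ďh + b₀ h` with time-dependent coefficients. -/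
def opA (N : ℝ) (b₂ b₁ b₀ : ℝ → ℝ → ℝ) (H : ℝ → ℝ → ℝ) : ℝ → ℝ → ℝ :=
  fun t z => -(b₂ t z) * Del N (H t) z + b₁ t z * (z * deriv (H t) z) + b₀ t z * H t z

end

noncomputable section

/-- `G(v) = (1/γ)(1-(1+v)^{-γ})` with `γ = N/(N-2)`. -/
def Gfun (N : ℝ) (v : ℝ) : ℝ :=
  (1 / (N / (N - 2))) * (1 - (1 + v) ^ (-(N / (N - 2))))

/-- `G_I(v) = G'(v) - 1`. -/
def GI (N : ℝ) (v : ℝ) : ℝ := deriv (Gfun N) v - 1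

/-- `G_II(v) = (N/2)(v G'(v) - G(v))`. -/
def GII (N : ℝ) (v : ℝ) : ℝ := (N / 2) * (v * deriv (Gfun N) v - Gfun N v)

/-- `Φ(X) = ∑_{k≥0} (-1)^k X^k / (k! Γ(N/2+k))`. -/
def Phi (N : ℝ) (X : ℝ) : ℝ :=
  ∑' k : ℕ, (-1 : ℝ) ^ k * X ^ k / ((k.factorial : ℝ) * Real.Gamma (N / 2 + k))

end


open MeasureTheory Real Set
open scoped ContDiff

/-! # Part 1: the data of the problem and the mass-spring chain -/

namespace EulerNM

/-- Fixed data: exponent `b = N/2`, final time, time cutoff, linear strain, nonlinearity. -/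
structure Dat where
  b : ℝ
  hb : 2 ≤ b
  T : ℝ
  hT : 0 < T
  chi : ℝ → ℝ
  chi_s : ContDiff ℝ ∞ chi
  chi0 : ∀ t, 0 ≤ chi t
  chi1 : ∀ t, chi t ≤ 1
  chi_z : ∀ t, t ≤ -(1/2) → chi t = 0
  p : ℝ → ℝ → ℝ
  p_s : ContDiff ℝ ∞ (fun q : ℝ × ℝ => p q.1 q.2)
  g : ℝ → ℝ
  g_s : ContDiff ℝ ∞ g
  g_c : HasCompactSupport g
  g_d : ∀ x, |deriv g x| ≤ 1/2
  g0 : g 0 = 0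
  g0d : deriv g 0 = 0

/-- The open time interval. -/
def Dat.I (D : Dat) : Set ℝ := Ioo (-(3/2)) (D.T + 3/2)
/-- The closed time interval where bounds are proved. -/
def Dat.J (D : Dat) : Set ℝ := Icc (-1) (D.T + 1)

/-- The nonlinear part of the flux. -/
noncomputable def Dat.Q (D : Dat) (ε t z V : ℝ) : ℝ :=
  D.chi t * ((ε ^ 2)⁻¹ * D.g (ε * (D.p t z + ε * V)))

/-- The flux. -/
noncomputable def Dat.Pf (D : Dat) (ε t z V : ℝ) : ℝ := V + D.Q ε t z V

/-- The weights. -/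
noncomputable def Dat.kap (D : Dat) (n i : ℕ) : ℝ := ((i : ℝ) / n) ^ D.b

/-- The discrete strain. -/
noncomputable def VV (n : ℕ) (w : ℕ → ℝ → ℝ) (i : ℕ) (t : ℝ) : ℝ := n * (w i t - w (i + 1) t)

/-- The weighted flux. -/
noncomputable def Dat.S (D : Dat) (ε : ℝ) (n : ℕ) (w : ℕ → ℝ → ℝ) (i : ℕ) (t : ℝ) : ℝ :=
  D.kap n i * D.Pf ε t ((i : ℝ) / n) (VV n w (i - 1) t)

/-- A solution of the mass-spring chain. -/
structure Chain (D : Dat) (ε : ℝ) (n : ℕ) where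
  w : ℕ → ℝ → ℝ
  w_out : ∀ i, n ≤ i → ∀ t, w i t = 0
  smooth : ∀ i, ContDiff ℝ ∞ (w i)
  eqn : ∀ i, i < n → ∀ t ∈ D.I, (D.kap n (i + 1) - D.kap n i) / D.b * deriv (deriv (w i)) t
    = -(D.S ε n w (i + 1) t - D.S ε n w i t)
  init : ∀ i, w i (-1) = 0
  init' : ∀ i, deriv (w i) (-1) = 0

end EulerNM

open MeasureTheory Real Set
open scoped ContDiff

/-! # Part 2: global solvability of the chain ODE -/

namespace EulerNM

theorem contDiff_exp_smul {E : Type*} [NormedAddCommGroup E] [NormedSpace ℝ E] [CompleteSpace E]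
    (A : E →L[ℝ] E) : ContDiff ℝ 1 (fun t : ℝ => NormedSpace.exp (t • A)) := by
  rw [contDiff_one_iff_deriv]
  have h : ∀ t : ℝ, HasDerivAt (fun u : ℝ => NormedSpace.exp (u • A))
      (NormedSpace.exp (t • A) * A) t := fun t => hasDerivAt_exp_smul_const A t
  have hd : Differentiable ℝ (fun u : ℝ => NormedSpace.exp (u • A)) :=
    fun t => (h t).differentiableAt
  refine ⟨hd, ?_⟩
  have : deriv (fun u : ℝ => NormedSpace.exp (u • A)) =
    fun t : ℝ => NormedSpace.exp (t • A) * A := funext fun t => (h t).deriv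
  rw [this]
  exact hd.continuous.mul continuous_const

/-- Global existence for a linear field plus a bounded smooth field. -/
theorem ode_global {E : Type*} [NormedAddCommGroup E] [NormedSpace ℝ E] [FiniteDimensional ℝ E]
    (A : E →L[ℝ] E) (B : ℝ → E → E) (hB : ContDiff ℝ ∞ (Function.uncurry B)) (M : ℝ)
    (hM : ∀ t x, ‖B t x‖ ≤ M) (a c t0 : ℝ) (h0 : t0 ∈ Icc a c) :
    ∃ X : ℝ → E, X t0 = 0 ∧
      (∀ t ∈ Icc a c, HasDerivWithinAt X (A (X t) + B t (X t)) (Icc a c) t) ∧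
      ContDiffOn ℝ ∞ X (Icc a c) := by
  have : CompleteSpace E := FiniteDimensional.complete ℝ E
  have : NormedAlgebra ℚ (E →L[ℝ] E) := NormedAlgebra.restrictScalars ℚ ℝ (E →L[ℝ] E)
  have hE := contDiff_exp_smul A
  have hE' := contDiff_exp_smul (-A)
  set U : ℝ → E →L[ℝ] E := fun t => NormedSpace.exp (t • A) with hU
  set W : ℝ → E →L[ℝ] E := fun t => NormedSpace.exp (t • (-A)) with hW
  have hUW : ∀ t x, U t (W t x) = x := by
    intro t x
    have : U t * W t = 1 := by
      simp only [hU, hW]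
      rw [← NormedSpace.exp_add_of_commute]
      · simp
      · exact ((Commute.refl A).neg_right.smul_left t).smul_right t
    calc U t (W t x) = (U t * W t) x := rfl
      _ = x := by rw [this]; rfl
  set h : ℝ → E → E := fun t Z => W t (B t (U t Z)) with hh
  have hc1 : ContDiff ℝ 1 (Function.uncurry h) := by
    have e1 : ContDiff ℝ 1 (fun q : ℝ × E => U q.1 q.2) :=
      (hE.comp contDiff_fst).clm_apply contDiff_snd
    have e2 : ContDiff ℝ 1 (fun q : ℝ × E => B q.1 (U q.1 q.2)) :=
      (hB.of_le (by exact_mod_cast le_top)).comp (contDiff_fst.prodMk e1)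
    exact (hE'.comp contDiff_fst).clm_apply e2
  obtain ⟨m, hm⟩ : ∃ m, ∀ t ∈ Icc a c, ‖W t‖ ≤ m :=
    isCompact_Icc.exists_bound_of_continuousOn hE'.continuous.continuousOn
  have hM0 : 0 ≤ M := (norm_nonneg _).trans (hM 0 0)
  have hm0 : 0 ≤ m := (norm_nonneg _).trans (hm t0 h0)
  have hac : 0 ≤ c - a := by linarith [h0.1, h0.2]
  set L : NNReal := ⟨m * M, mul_nonneg hm0 hM0⟩
  set r : NNReal := ⟨m * M * (c - a), mul_nonneg (mul_nonneg hm0 hM0) hac⟩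
  obtain ⟨K, hK⟩ := (hc1.contDiffOn (s := Icc a c ×ˢ Metric.closedBall (0:E) r)).exists_lipschitzOnWith
    one_ne_zero ((convex_Icc a c).prod (convex_closedBall 0 _))
    (isCompact_Icc.prod (isCompact_closedBall 0 _))
  have hPL : IsPicardLindelof h (⟨t0, h0⟩ : Icc a c) 0 r 0 L K := by
    refine ⟨?_, ?_, ?_, ?_⟩
    · intro t ht x hx y hy
      have := hK (x := (t, x)) ⟨ht, hx⟩ (y := (t, y)) ⟨ht, hy⟩
      simpa [Function.uncurry, Prod.edist_eq] using this
    · intro x _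
      exact (hc1.continuous.comp (continuous_id.prodMk continuous_const)).continuousOn
    · intro t ht x _
      calc ‖h t x‖ ≤ ‖W t‖ * ‖B t (U t x)‖ := (W t).le_opNorm _
        _ ≤ m * M := mul_le_mul (hm t ht) (hM _ _) (norm_nonneg _) hm0
    · show m * M * max (c - t0) (t0 - a) ≤ m * M * (c - a) - 0
      rw [sub_zero]
      refine mul_le_mul_of_nonneg_left (max_le ?_ ?_) (mul_nonneg hm0 hM0) <;>
        linarith [h0.1, h0.2]
  obtain ⟨Z, hZ0, hZ⟩ := hPL.exists_eq_forall_mem_Icc_hasDerivWithinAt₀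
  have hX : ∀ t ∈ Icc a c, HasDerivWithinAt (fun t => U t (Z t)) (A (U t (Z t)) + B t (U t (Z t)))
      (Icc a c) t := by
    intro t ht
    have h1 : HasDerivAt U (A * U t) t := hasDerivAt_exp_smul_const' A t
    have h2 := h1.hasDerivWithinAt.clm_apply (hZ t ht)
    have h3 : U t (h t (Z t)) = B t (U t (Z t)) := hUW t _
    rw [h3] at h2
    exact h2
  refine ⟨fun t => U t (Z t), ?_, hX, ?_⟩
  · simp only [] at hZ0
    show U t0 (Z t0) = 0
    rw [hZ0]; simp
  · have hf : ContDiff ℝ ∞ (Function.uncurry (fun t x => A x + B t x)) :=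
      (A.contDiff.comp contDiff_snd).add hB
    exact ODE.contDiffOn_enat_Icc_of_hasDerivWithinAt (n := ⊤) (u := univ) hf.contDiffOn hX
      (mapsTo_univ _ _)

theorem contDiff_of_tsup {E F : Type*} [NormedAddCommGroup E] [NormedSpace ℝ E]
    [NormedAddCommGroup F] [NormedSpace ℝ F] {n : WithTop ℕ∞} {f : E → F}
    (h : ∀ x ∈ tsupport f, ContDiffAt ℝ n f x) : ContDiff ℝ n f := by
  rw [contDiff_iff_contDiffAt]
  intro x
  by_cases hx : x ∈ tsupport f
  · exact h x hx
  · exact contDiffAt_const.congr_of_eventuallyEq (notMem_tsupport_iff_eventuallyEq.1 hx)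

theorem Dat.bpos (D : Dat) : 0 < D.b := by linarith [D.hb]

theorem Dat.kap_zero (D : Dat) (n : ℕ) : D.kap n 0 = 0 := by
  simp [Dat.kap, D.bpos.ne']

theorem Dat.kap_nonneg (D : Dat) (n i : ℕ) : 0 ≤ D.kap n i := by
  unfold Dat.kap; positivity

theorem Dat.kap_lt (D : Dat) {n : ℕ} (hn : 0 < n) (i : ℕ) : D.kap n i < D.kap n (i + 1) := by
  unfold Dat.kap
  have : (0:ℝ) < n := by exact_mod_cast hn
  apply Real.rpow_lt_rpow (by positivity) _ D.bpos
  push_cast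
  gcongr
  linarith

theorem Dat.Q_contDiff (D : Dat) (ε : ℝ) {E : Type*} [NormedAddCommGroup E] [NormedSpace ℝ E]
    {τ z V : E → ℝ} (hτ : ContDiff ℝ ∞ τ) (hz : ContDiff ℝ ∞ z) (hV : ContDiff ℝ ∞ V) :
    ContDiff ℝ ∞ (fun q => D.Q ε (τ q) (z q) (V q)) := by
  unfold Dat.Q
  refine (D.chi_s.comp hτ).mul (contDiff_const.mul (D.g_s.comp ?_))
  exact contDiff_const.mul ((D.p_s.comp (hτ.prodMk hz)).add (contDiff_const.mul hV))

theorem Dat.g_bound (D : Dat) : ∃ M, 0 ≤ M ∧ ∀ x, |D.g x| ≤ M := by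
  obtain ⟨M, hM⟩ := D.g_s.continuous.bounded_above_of_compact_support D.g_c
  exact ⟨M, (norm_nonneg _).trans (hM 0), hM⟩

theorem Dat.Q_bound (D : Dat) (ε : ℝ) : ∃ M, 0 ≤ M ∧ ∀ t z V, |D.Q ε t z V| ≤ M := by
  obtain ⟨M, hM0, hM⟩ := D.g_bound
  refine ⟨(ε ^ 2)⁻¹ * M, by positivity, fun t z V => ?_⟩
  unfold Dat.Q
  rw [abs_mul, abs_mul, abs_of_nonneg (D.chi0 t), abs_of_nonneg (by positivity : 0 ≤ (ε^2)⁻¹)]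
  calc D.chi t * ((ε ^ 2)⁻¹ * |D.g (ε * (D.p t z + ε * V))|)
      ≤ 1 * ((ε ^ 2)⁻¹ * M) := by
        gcongr
        · exact D.chi1 t
        · exact hM _
    _ = _ := one_mul _

/-- Extension of a finite vector by zero. -/
def extv (n : ℕ) (x : Fin n → ℝ) (i : ℕ) : ℝ := if h : i < n then x ⟨i, h⟩ else 0

/-- Extension by zero as a linear functional. -/
noncomputable def extL (n i : ℕ) : (Fin n → ℝ) →L[ℝ] ℝ :=
  if h : i < n then ContinuousLinearMap.proj (⟨i, h⟩ : Fin n) else 0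

theorem extL_apply (n i : ℕ) (x : Fin n → ℝ) : extL n i x = extv n x i := by
  unfold extL extv; split_ifs <;> simp

/-- Discrete strain as a linear functional. -/
noncomputable def vL (n i : ℕ) : (Fin n → ℝ) →L[ℝ] ℝ := (n : ℝ) • (extL n i - extL n (i + 1))

theorem Dat.chain_exists (D : Dat) (ε : ℝ) (n : ℕ) (hn : 0 < n) : Nonempty (Chain D ε n) := by
  set c : ℕ → ℝ := fun i => D.b / (D.kap n (i+1) - D.kap n i) with hc
  set E := (Fin n → ℝ) × (Fin n → ℝ)
  let Al : (Fin n → ℝ) →L[ℝ] (Fin n → ℝ) := ContinuousLinearMap.pi fun i =>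
    -(c i) • (D.kap n (i + 1) • vL n i - D.kap n i • vL n ((i:ℕ) - 1))
  let A : E →L[ℝ] E := (ContinuousLinearMap.snd ℝ _ _).prod
    (Al.comp (ContinuousLinearMap.fst ℝ _ _))
  let Bq : ℝ → (Fin n → ℝ) → Fin n → ℝ := fun t x i =>
    -(c i) * (D.kap n (i + 1) * D.Q ε t (((i:ℕ) + 1 : ℕ) / n) (vL n i x)
      - D.kap n i * D.Q ε t ((i:ℕ) / n) (vL n ((i:ℕ) - 1) x))
  let B : ℝ → E → E := fun t X => (0, Bq t X.1)
  have hB : ContDiff ℝ ∞ (Function.uncurry B) := by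
    refine contDiff_const.prodMk (contDiff_pi.2 fun i => ?_)
    refine contDiff_const.mul ((contDiff_const.mul ?_).sub (contDiff_const.mul ?_)) <;>
      exact D.Q_contDiff ε contDiff_fst contDiff_const
        ((vL n _).contDiff.comp (contDiff_fst.comp contDiff_snd))
  obtain ⟨M, hM0, hM⟩ := D.Q_bound ε
  have hBM : ∃ M', ∀ t x, ‖B t x‖ ≤ M' := by
    refine ⟨∑ i : Fin n, |c i| * (D.kap n (i + 1) * M + D.kap n i * M), fun t x => ?_⟩
    have hnn : ∀ i : Fin n, 0 ≤ |c i| * (D.kap n (i + 1) * M + D.kap n i * M) := fun i => by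
      have := D.kap_nonneg n (i+1); have := D.kap_nonneg n i; positivity
    rw [Prod.norm_def]
    refine max_le ?_ ?_
    · simp only [B, norm_zero]; exact Finset.sum_nonneg fun i _ => hnn i
    · rw [pi_norm_le_iff_of_nonneg (Finset.sum_nonneg fun i _ => hnn i)]
      intro i
      refine le_trans ?_ (Finset.single_le_sum (fun i _ => hnn i) (Finset.mem_univ i))
      simp only [B, Bq, Real.norm_eq_abs]
      rw [abs_mul, abs_neg]
      gcongr
      refine (abs_sub _ _).trans ?_
      rw [abs_mul, abs_mul, abs_of_nonneg (D.kap_nonneg n _), abs_of_nonneg (D.kap_nonneg n _)]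
      have h1 := D.kap_nonneg n (i+1); have h2 := D.kap_nonneg n i
      gcongr
      · exact hM _ _ _
      · exact hM _ _ _
  obtain ⟨M', hM'⟩ := hBM
  have hT := D.hT
  obtain ⟨X, hX0, hX, hXs⟩ := ode_global A B hB M' hM' (-2) (D.T + 2) (-1)
    ⟨by norm_num, by linarith⟩
  have hXI : ∀ t ∈ D.I, HasDerivAt X (A (X t) + B t (X t)) t := fun t ht => by
    have h1 : -2 < t := by linarith [ht.1]
    have h2 : t < D.T + 2 := by linarith [ht.2]
    exact (hX t ⟨h1.le, h2.le⟩).hasDerivAt (Icc_mem_nhds h1 h2)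
  have hIo : IsOpen D.I := isOpen_Ioo
  let f : ContDiffBump (D.T / 2) := ⟨D.T / 2 + 3/2, D.T / 2 + 7/4, by linarith, by linarith⟩
  have hf1 : ∀ t ∈ D.I, f t = 1 := fun t ht => f.one_of_mem_closedBall (by
    rw [Metric.mem_closedBall, Real.dist_eq, abs_le]
    constructor <;> simp only [f] <;> linarith [ht.1, ht.2])
  let w : ℕ → ℝ → ℝ := fun i t => f t * extL n i (X t).1
  have hwX : ∀ i, ∀ t ∈ D.I, w i t = extL n i (X t).1 := fun i t ht => by
    simp only [w]; rw [hf1 t ht, one_mul]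
  have hw : ∀ i, ∀ t ∈ D.I, HasDerivAt (w i) (extL n i (X t).2) t := by
    intro i t ht
    have h1 := ((extL n i).comp (ContinuousLinearMap.fst ℝ (Fin n → ℝ) (Fin n → ℝ))).hasFDerivAt.comp_hasDerivAt t (hXI t ht)
    have h2 : (A (X t) + B t (X t)).1 = (X t).2 := add_zero _
    have h3 : extL n i (A (X t) + B t (X t)).1 = extL n i (X t).2 := by rw [h2]
    rw [← h3]
    refine HasDerivAt.congr_of_eventuallyEq h1 ?_
    filter_upwards [hIo.mem_nhds ht] with s hs using hwX i s hs
  have hw2 : ∀ i, ∀ t ∈ D.I, HasDerivAt (fun t => extL n i (X t).2)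
      (extL n i (Al (X t).1 + Bq t (X t).1)) t := by
    intro i t ht
    have h1 := ((extL n i).comp (ContinuousLinearMap.snd ℝ (Fin n → ℝ) (Fin n → ℝ))).hasFDerivAt.comp_hasDerivAt t (hXI t ht)
    exact h1
  have hm1 : (-1 : ℝ) ∈ D.I := ⟨by norm_num, by linarith⟩
  refine ⟨⟨w, ?_, ?_, ?_, ?_, ?_⟩⟩
  · intro i hi t
    simp [w, extL_apply, extv, not_lt.2 hi]
  · intro i
    refine contDiff_of_tsup fun t ht => ?_
    have h1 : t ∈ tsupport f := closure_mono (Function.support_mul_subset_left _ _) ht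
    rw [f.tsupport_eq, Metric.mem_closedBall, Real.dist_eq, abs_le] at h1
    simp only [f] at h1
    refine f.contDiff.contDiffAt.mul ?_
    refine ((extL n i).comp (ContinuousLinearMap.fst ℝ (Fin n → ℝ) (Fin n → ℝ))).contDiff.contDiffAt.comp t ?_
    exact hXs.contDiffAt (Icc_mem_nhds (by linarith [h1.1]) (by linarith [h1.2]))
  · intro i hi t ht
    have e1 : deriv (w i) =ᶠ[nhds t] fun t => extL n i (X t).2 := by
      filter_upwards [hIo.mem_nhds ht] with s hs using (hw i s hs).deriv
    rw [e1.deriv_eq, (hw2 i t ht).deriv, extL_apply]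
    have hk : D.kap n (i+1) - D.kap n i ≠ 0 := (sub_pos.2 (D.kap_lt hn i)).ne'
    have hb := D.bpos.ne'
    have hv : ∀ j, VV n w j t = vL n j (X t).1 := by
      intro j; simp [VV, vL, hwX _ t ht]
    simp only [extv, hi, dif_pos, Dat.S, Dat.Pf, hv, Al, Bq, Pi.add_apply,
      ContinuousLinearMap.coe_pi', hc, Nat.add_sub_cancel]
    simp only [smul_apply, sub_apply, smul_eq_mul]
    field_simp
    ring
  · intro i; rw [hwX i _ hm1]; simp [hX0]
  · intro i; rw [(hw i _ hm1).deriv, hX0]; simp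

end EulerNM

open MeasureTheory Real Set
open scoped ContDiff

/-! # Part 3: tame estimates for the composition -/

namespace EulerNM

theorem cd_at {f : ℝ → ℝ} (hf : ContDiff ℝ ∞ f) (n : ℕ) (t : ℝ) : ContDiffAt ℝ n f t :=
  (hf.of_le (by exact_mod_cast le_top)).contDiffAt

theorem cd_deriv {f : ℝ → ℝ} (hf : ContDiff ℝ ∞ f) : ContDiff ℝ ∞ (deriv f) :=
  ((contDiff_infty_iff_deriv (𝕜 := ℝ)).1 hf).2

theorem cd_iter {f : ℝ → ℝ} (hf : ContDiff ℝ ∞ f) (k : ℕ) : ContDiff ℝ ∞ (iteratedDeriv k f) := by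
  induction k with
  | zero => simpa using hf
  | succ k ih => rw [iteratedDeriv_succ]; exact cd_deriv ih

theorem cd_diff {f : ℝ → ℝ} (hf : ContDiff ℝ ∞ f) : Differentiable ℝ f :=
  hf.differentiable (by simp)

theorem cd_hasDerivAt {f : ℝ → ℝ} (hf : ContDiff ℝ ∞ f) (k : ℕ) (t : ℝ) :
    HasDerivAt (iteratedDeriv k f) (iteratedDeriv (k+1) f t) t := by
  rw [iteratedDeriv_succ]
  exact (cd_diff (cd_iter hf k) t).hasDerivAt

theorem cd_mul {f g : ℝ → ℝ} (hf : ContDiff ℝ ∞ f) (hg : ContDiff ℝ ∞ g) (k : ℕ) (t : ℝ) :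
    iteratedDeriv k (fun s => f s * g s) t = ∑ i ∈ Finset.range (k + 1),
      (k.choose i : ℝ) * iteratedDeriv i f t * iteratedDeriv (k - i) g t :=
  iteratedDeriv_fun_mul (cd_at hf k t) (cd_at hg k t)

theorem cd_comp_succ {f g : ℝ → ℝ} (hf : ContDiff ℝ ∞ f) (hg : ContDiff ℝ ∞ g) (k : ℕ) (t : ℝ) :
    iteratedDeriv (k+1) (fun s => f (g s)) t = ∑ i ∈ Finset.range (k + 1),
      (k.choose i : ℝ) * iteratedDeriv i (fun s => deriv f (g s)) t
        * iteratedDeriv (k - i + 1) g t := by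
  have h1 : deriv (fun s => f (g s)) = fun s => deriv f (g s) * deriv g s := by
    funext s
    exact ((cd_diff hf (g s)).hasDerivAt.comp s (cd_diff hg s).hasDerivAt).deriv
  rw [iteratedDeriv_succ', h1, cd_mul (f := fun s => deriv f (g s)) ((cd_deriv hf).comp hg) (cd_deriv hg)]
  refine Finset.sum_congr rfl fun i _ => ?_
  rw [iteratedDeriv_succ']

/-- Sum of absolute values of lower derivatives. -/
noncomputable def sl (k : ℕ) (f : ℝ → ℝ) (t : ℝ) : ℝ := ∑ j ∈ Finset.range k, |iteratedDeriv j f t|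

theorem sl_nonneg (k : ℕ) (f : ℝ → ℝ) (t : ℝ) : 0 ≤ sl k f t :=
  Finset.sum_nonneg fun _ _ => abs_nonneg _

theorem sl_mono {k l : ℕ} (h : k ≤ l) (f : ℝ → ℝ) (t : ℝ) : sl k f t ≤ sl l f t :=
  Finset.sum_le_sum_of_subset_of_nonneg (Finset.range_mono h) fun _ _ _ => abs_nonneg _

theorem le_sl {j k : ℕ} (h : j < k) (f : ℝ → ℝ) (t : ℝ) : |iteratedDeriv j f t| ≤ sl k f t :=
  Finset.single_le_sum (f := fun j => |iteratedDeriv j f t|) (fun _ _ => abs_nonneg _)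
    (Finset.mem_range.2 h)

theorem sl_succ (k : ℕ) (f : ℝ → ℝ) (t : ℝ) :
    sl (k+1) f t = sl k f t + |iteratedDeriv k f t| := Finset.sum_range_succ _ _

theorem comp_low (A : ℝ) : ∀ k : ℕ, ∀ B : ℕ → ℝ, ∃ C, 0 ≤ C ∧ ∀ f g : ℝ → ℝ, ContDiff ℝ ∞ f →
    ContDiff ℝ ∞ g → ∀ t, (∀ m, |iteratedDeriv m f (g t)| ≤ B m) →
    (∀ j ≤ k, |iteratedDeriv j g t| ≤ A) → |iteratedDeriv k (fun s => f (g s)) t| ≤ C := by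
  intro k
  induction k using Nat.strong_induction_on with
  | _ k ih =>
  intro B
  cases k with
  | zero =>
    refine ⟨|B 0|, abs_nonneg _, fun f g _ _ t h _ => ?_⟩
    simpa using (h 0).trans (le_abs_self _)
  | succ k =>
    have h1 : ∀ i, ∃ C, 0 ≤ C ∧ (i < k + 1 → ∀ f g : ℝ → ℝ, ContDiff ℝ ∞ f →
        ContDiff ℝ ∞ g → ∀ t, (∀ m, |iteratedDeriv m f (g t)| ≤ B (m+1)) →
        (∀ j ≤ i, |iteratedDeriv j g t| ≤ A) → |iteratedDeriv i (fun s => f (g s)) t| ≤ C) := by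
      intro i
      by_cases hi : i < k + 1
      · obtain ⟨C, h0, hC⟩ := ih i hi (fun m => B (m+1))
        exact ⟨C, h0, fun _ => hC⟩
      · exact ⟨0, le_rfl, fun h => absurd h hi⟩
    choose C hC0 hC using h1
    refine ⟨∑ i ∈ Finset.range (k+1), (k.choose i : ℝ) * C i * |A|,
      Finset.sum_nonneg fun i _ => by have := hC0 i; positivity, ?_⟩
    intro f g hf hg t hB hA
    rw [cd_comp_succ hf hg]
    refine (Finset.abs_sum_le_sum_abs _ _).trans (Finset.sum_le_sum fun i hi => ?_)
    have hi' : i < k + 1 := Finset.mem_range.1 hi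
    rw [abs_mul, abs_mul, Nat.abs_cast]
    have e1 := hC i hi' (deriv f) g (cd_deriv hf) hg t
      (fun m => by rw [← iteratedDeriv_succ']; exact hB (m+1)) (fun j hj => hA j (by omega))
    have e2 := (hA (k - i + 1) (by omega)).trans (le_abs_self A)
    have := hC0 i
    gcongr

theorem comp_tame (A : ℝ) (J : ℕ) : ∀ k : ℕ, k ≤ 2 * J + 1 → ∀ B : ℕ → ℝ, ∃ C, 0 ≤ C ∧
    ∀ f g : ℝ → ℝ, ContDiff ℝ ∞ f →
    ContDiff ℝ ∞ g → ∀ t, (∀ m, |iteratedDeriv m f (g t)| ≤ B m) →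
    (∀ j ≤ J, |iteratedDeriv j g t| ≤ A) →
    |iteratedDeriv k (fun s => f (g s)) t - deriv f (g t) * iteratedDeriv k g t|
      ≤ C * (1 + sl k g t) := by
  intro k
  induction k using Nat.strong_induction_on with
  | _ k ih =>
  intro hk B
  cases k with
  | zero =>
    refine ⟨|B 0| + |B 1| * |A|, by positivity, fun f g _ _ t h hA => ?_⟩
    simp only [iteratedDeriv_zero, sl, Finset.range_zero, Finset.sum_empty, add_zero, mul_one]
    refine (abs_sub _ _).trans (add_le_add ?_ ?_)
    · simpa using (h 0).trans (le_abs_self _)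
    · rw [abs_mul]
      have := (h 1).trans (le_abs_self _)
      rw [iteratedDeriv_one] at this
      have h2 := (hA 0 (Nat.zero_le _)).trans (le_abs_self _)
      simp only [iteratedDeriv_zero] at h2
      gcongr
  | succ k =>
    have h1 : ∀ i, ∃ C, 0 ≤ C ∧ (i < k + 1 → ∀ f g : ℝ → ℝ, ContDiff ℝ ∞ f →
        ContDiff ℝ ∞ g → ∀ t, (∀ m, |iteratedDeriv m f (g t)| ≤ B (m+1)) →
        (∀ j ≤ J, |iteratedDeriv j g t| ≤ A) → |iteratedDeriv i (fun s => f (g s)) t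
          - deriv f (g t) * iteratedDeriv i g t| ≤ C * (1 + sl i g t)) := by
      intro i
      by_cases hi : i < k + 1
      · obtain ⟨C, h0, hC⟩ := ih i hi (by omega) (fun m => B (m+1))
        exact ⟨C, h0, fun _ => hC⟩
      · exact ⟨0, le_rfl, fun h => absurd h hi⟩
    choose C hC0 hC using h1
    choose C' hC0' hC' using fun i => comp_low A i (fun m => B (m+1))
    refine ⟨∑ i ∈ Finset.range k, (k.choose (i+1) : ℝ) * (C' (i+1) + (C (i+1) + |B 2|) * |A|),
      Finset.sum_nonneg fun i _ => by have := hC0 (i+1); have := hC0' (i+1); positivity, ?_⟩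
    intro f g hf hg t hB hA
    rw [cd_comp_succ hf hg, Finset.sum_range_succ']
    simp only [Nat.choose_zero_right, Nat.cast_one, one_mul, iteratedDeriv_zero, Nat.sub_zero,
      _root_.add_sub_cancel_right]
    refine (Finset.abs_sum_le_sum_abs _ _).trans ?_
    rw [Finset.sum_mul]
    refine Finset.sum_le_sum fun i hi => ?_
    have hi' : i < k := Finset.mem_range.1 hi
    have hs := sl_nonneg (k+1) g t
    have c1 := hC0 (i+1)
    have c2 := hC0' (i+1)
    rw [abs_mul, abs_mul, Nat.abs_cast, mul_assoc, mul_assoc]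
    refine mul_le_mul_of_nonneg_left ?_ (Nat.cast_nonneg _)
    have hB' : ∀ m, |iteratedDeriv m (deriv f) (g t)| ≤ B (m+1) :=
      fun m => by rw [← iteratedDeriv_succ']; exact hB (m+1)
    by_cases hJ : i + 1 ≤ J
    · have e1 := hC' (i+1) (deriv f) g (cd_deriv hf) hg t hB' (fun j hj => hA j (by omega))
      have e2 : |iteratedDeriv (k - (i+1) + 1) g t| ≤ sl (k+1) g t := le_sl (by omega) g t
      calc _ ≤ C' (i+1) * (1 + sl (k+1) g t) := by
            gcongr; linarith
        _ ≤ _ := by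
            gcongr
            have : 0 ≤ (C (i+1) + |B 2|) * |A| := by positivity
            linarith
    · have e1 := hC (i+1) (by omega) (deriv f) g (cd_deriv hf) hg t hB' hA
      have e2 := (hA (k - (i+1) + 1) (by omega)).trans (le_abs_self A)
      have e3 : |iteratedDeriv (i+1) g t| ≤ sl (k+1) g t := le_sl (by omega) g t
      have e4 := (hB' 1).trans (le_abs_self _)
      rw [iteratedDeriv_one] at e4
      have e5 := sl_mono (show i + 1 ≤ k + 1 by omega) g t
      have e6 : |iteratedDeriv (i+1) (fun s => deriv f (g s)) t| ≤
          (C (i+1) + |B 2|) * (1 + sl (k+1) g t) := by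
        calc |iteratedDeriv (i+1) (fun s => deriv f (g s)) t|
            ≤ |iteratedDeriv (i+1) (fun s => deriv f (g s)) t
              - deriv (deriv f) (g t) * iteratedDeriv (i+1) g t|
              + |deriv (deriv f) (g t) * iteratedDeriv (i+1) g t| := by
              have := abs_add_le (iteratedDeriv (i+1) (fun s => deriv f (g s)) t
              - deriv (deriv f) (g t) * iteratedDeriv (i+1) g t)
                (deriv (deriv f) (g t) * iteratedDeriv (i+1) g t)
              simpa using this
          _ ≤ C (i+1) * (1 + sl (k+1) g t) + |B 2| * (1 + sl (k+1) g t) := by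
              rw [abs_mul (deriv (deriv f) (g t))]
              refine add_le_add (e1.trans ?_) ?_
              · gcongr
              · refine mul_le_mul e4 (by linarith) (abs_nonneg _) (abs_nonneg _)
          _ = _ := by ring
      calc _ ≤ (C (i+1) + |B 2|) * (1 + sl (k+1) g t) * |A| := by
            gcongr
        _ = ((C (i+1) + |B 2|) * |A|) * (1 + sl (k+1) g t) := by ring
        _ ≤ _ := by
            gcongr
            linarith

theorem Dat.gd_bound (D : Dat) (m : ℕ) : ∃ M, 0 ≤ M ∧ ∀ x, |iteratedDeriv m D.g x| ≤ M := by
  have h1 : HasCompactSupport (iteratedDeriv m D.g) := by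
    induction m with
    | zero => simpa using D.g_c
    | succ m ih => rw [iteratedDeriv_succ]; exact ih.deriv
  obtain ⟨M, hM⟩ := (cd_iter D.g_s m).continuous.bounded_above_of_compact_support h1
  exact ⟨M, (norm_nonneg _).trans (hM 0), hM⟩

theorem lin_bound {f : ℝ → ℝ} (hf : Differentiable ℝ f) (h0 : f 0 = 0) {M y : ℝ}
    (hM : ∀ x, |x| ≤ |y| → |deriv f x| ≤ M) : |f y| ≤ M * |y| := by
  have := Convex.norm_image_sub_le_of_norm_deriv_le (f := f) (s := Icc (-|y|) |y|) (C := M)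
    (x := 0) (y := y) (fun x _ => hf x) (fun x hx => hM x (abs_le.2 hx)) (convex_Icc _ _)
    ⟨by simp, by simp⟩ (abs_le.1 le_rfl)
  simpa [h0] using this

/-- The rescaled nonlinearity. -/
noncomputable def Dat.Psi (D : Dat) (ε x : ℝ) : ℝ := (ε ^ 2)⁻¹ * D.g (ε * x)

theorem Dat.Psi_s (D : Dat) (ε : ℝ) : ContDiff ℝ ∞ (D.Psi ε) :=
  contDiff_const.mul (D.g_s.comp (contDiff_const.mul contDiff_id))

theorem Dat.Psi_iter (D : Dat) (ε : ℝ) (m : ℕ) (x : ℝ) :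
    iteratedDeriv m (D.Psi ε) x = (ε ^ 2)⁻¹ * (ε ^ m * iteratedDeriv m D.g (ε * x)) := by
  have h1 : D.Psi ε = fun x => (ε ^ 2)⁻¹ * (fun x => D.g (ε * x)) x := rfl
  have h2 : ContDiff ℝ ∞ (fun x => D.g (ε * x)) := D.g_s.comp (contDiff_const.mul contDiff_id)
  rw [h1, iteratedDeriv_const_mul _ (cd_at h2 m x),
    iteratedDeriv_comp_const_mul (D.g_s.of_le (by exact_mod_cast le_top))]

theorem Dat.Psi_deriv (D : Dat) {ε : ℝ} (h : ε ≠ 0) (x : ℝ) :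
    deriv (D.Psi ε) x * ε = deriv D.g (ε * x) := by
  have := D.Psi_iter ε 1 x
  simp only [iteratedDeriv_one] at this
  rw [this]; field_simp

theorem Dat.Psi_bound (D : Dat) (S : ℝ) : ∃ B : ℕ → ℝ, (∀ m, 0 ≤ B m) ∧ ∀ ε : ℝ, ε ≠ 0 → |ε| ≤ 1 →
    ∀ x, |x| ≤ S → ∀ m, |iteratedDeriv m (D.Psi ε) x| ≤ B m := by
  choose M hM0 hM using D.gd_bound
  refine ⟨fun m => M m + M 2 * |S| + M 2 * |S| * |S|, fun m => ?_, ?_⟩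
  · have := hM0 m; have := hM0 2; positivity
  intro ε h0 h1 x hx m
  have hS : |x| ≤ |S| := hx.trans (le_abs_self S)
  have hg1 : ∀ y, |deriv D.g y| ≤ M 2 * |y| := fun y => lin_bound (cd_diff (cd_deriv D.g_s)) D.g0d
    (fun x _ => by have := hM 2 x; rwa [iteratedDeriv_succ', iteratedDeriv_one] at this)
  have hg0 : ∀ y, |D.g y| ≤ M 2 * |y| * |y| := fun y => lin_bound (cd_diff D.g_s) D.g0
    (fun x hx => (hg1 x).trans (mul_le_mul_of_nonneg_left hx (hM0 2)))
  have ha : 0 < |ε| := abs_pos.2 h0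
  have m0 := hM0 m; have m2 := hM0 2
  rw [D.Psi_iter, abs_mul, abs_inv, abs_mul, abs_pow, abs_pow]
  rcases m with _ | _ | m
  · have := hg0 (ε * x)
    rw [abs_mul] at this
    simp only [iteratedDeriv_zero, pow_zero, one_mul]
    rw [inv_mul_le_iff₀ (by positivity)]
    have e : M 2 * |x| * |x| ≤ M 2 * |S| * |S| := by gcongr
    calc _ ≤ _ := this
      _ = |ε| ^ 2 * (M 2 * |x| * |x|) := by ring
      _ ≤ _ := by
        gcongr
        have : 0 ≤ M 2 * |S| := by positivity
        linarith
  · have := hg1 (ε * x)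
    rw [abs_mul] at this
    simp only [zero_add, iteratedDeriv_one, pow_one]
    rw [inv_mul_le_iff₀ (by positivity)]
    have e : M 2 * |x| ≤ M 2 * |S| := by gcongr
    calc _ ≤ |ε| * (M 2 * (|ε| * |x|)) := by gcongr
      _ = |ε| ^ 2 * (M 2 * |x|) := by ring
      _ ≤ _ := by
        gcongr
        have : 0 ≤ M 2 * |S| * |S| := by positivity
        have := hM0 (0+1)
        simp only [zero_add] at *
        linarith
  · have := hM (m+1+1) (ε * x)
    rw [inv_mul_le_iff₀ (by positivity)]
    have e : |ε| ^ (m+1+1) ≤ |ε| ^ 2 := pow_le_pow_of_le_one ha.le h1 (by omega)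
    have e2 : 0 ≤ M 2 * |S| + M 2 * |S| * |S| := by positivity
    gcongr
    linarith

theorem joint_dt {p : ℝ → ℝ → ℝ} (hp : ContDiff ℝ ∞ (fun q : ℝ × ℝ => p q.1 q.2)) :
    ContDiff ℝ ∞ (fun q : ℝ × ℝ => deriv (fun s => p s q.2) q.1) := by
  have h1 : (fun q : ℝ × ℝ => deriv (fun s => p s q.2) q.1) =
      fun q => fderiv ℝ (fun q : ℝ × ℝ => p q.1 q.2) q (1, 0) := by
    funext q
    have h2 : HasDerivAt (fun s : ℝ => (s, q.2)) ((1:ℝ), (0:ℝ)) q.1 :=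
      (hasDerivAt_id q.1).prodMk (hasDerivAt_const _ _)
    have h3 : HasFDerivAt (fun q : ℝ × ℝ => p q.1 q.2)
      (fderiv ℝ (fun q : ℝ × ℝ => p q.1 q.2) q) ((fun s : ℝ => (s, q.2)) q.1) :=
      (hp.differentiable (by simp) q).hasFDerivAt
    exact (h3.comp_hasDerivAt q.1 h2).deriv
  rw [h1]
  exact (hp.fderiv_right (m := ∞) (by simp)).clm_apply contDiff_const

theorem joint_dt_iter {p : ℝ → ℝ → ℝ} (hp : ContDiff ℝ ∞ (fun q : ℝ × ℝ => p q.1 q.2)) (j : ℕ) :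
    ContDiff ℝ ∞ (fun q : ℝ × ℝ => iteratedDeriv j (fun s => p s q.2) q.1) := by
  induction j with
  | zero => simpa using hp
  | succ j ih =>
    simp only [iteratedDeriv_succ]
    exact joint_dt (p := fun t z => iteratedDeriv j (fun s => p s z) t) ih

theorem Dat.p_bound (D : Dat) (j : ℕ) : ∃ P, 0 ≤ P ∧ ∀ t ∈ D.J, ∀ z ∈ Icc (0:ℝ) 1,
    |iteratedDeriv j (fun s => D.p s z) t| ≤ P := by
  obtain ⟨P, hP⟩ := (isCompact_Icc.prod isCompact_Icc).exists_bound_of_continuousOn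
    (s := D.J ×ˢ Icc (0:ℝ) 1) (joint_dt_iter D.p_s j).continuous.continuousOn
  refine ⟨|P|, abs_nonneg _, fun t ht z hz => (hP (t, z) ⟨ht, hz⟩).trans (le_abs_self _)⟩

theorem Dat.chi_bound (D : Dat) (j : ℕ) : ∃ P, 0 ≤ P ∧ ∀ t ∈ D.J, |iteratedDeriv j D.chi t| ≤ P := by
  obtain ⟨P, hP⟩ := isCompact_Icc.exists_bound_of_continuousOn
    (s := D.J) (cd_iter D.chi_s j).continuous.continuousOn
  refine ⟨|P|, abs_nonneg _, fun t ht => (hP t ht).trans (le_abs_self _)⟩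

theorem Dat.pz_s (D : Dat) (z : ℝ) : ContDiff ℝ ∞ (fun s => D.p s z) :=
  D.p_s.comp (contDiff_id.prodMk contDiff_const)

theorem Dat.xi_iter (D : Dat) (ε z : ℝ) {V : ℝ → ℝ} (hV : ContDiff ℝ ∞ V) (k : ℕ) (t : ℝ) :
    iteratedDeriv k (fun s => D.p s z + ε * V s) t =
      iteratedDeriv k (fun s => D.p s z) t + ε * iteratedDeriv k V t := by
  rw [iteratedDeriv_fun_add (cd_at (D.pz_s z) k t) (cd_at (contDiff_const.mul hV) k t),
    iteratedDeriv_const_mul _ (cd_at hV k t)]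

/-- The coefficient of the top order term. -/
noncomputable def Dat.cc (D : Dat) (ε z : ℝ) (V : ℝ → ℝ) (t : ℝ) : ℝ :=
  D.chi t * deriv D.g (ε * (D.p t z + ε * V t))

theorem Dat.cc_le (D : Dat) (ε z : ℝ) (V : ℝ → ℝ) (t : ℝ) : |D.cc ε z V t| ≤ 1/2 := by
  unfold Dat.cc
  rw [abs_mul, abs_of_nonneg (D.chi0 t)]
  calc _ ≤ 1 * (1/2 : ℝ) := by
        gcongr
        · exact D.chi1 t
        · exact D.g_d _
    _ = _ := one_mul _

/-- The flux along a trajectory. -/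
noncomputable def Dat.qq (D : Dat) (ε z : ℝ) (V : ℝ → ℝ) (t : ℝ) : ℝ := D.Q ε t z (V t)

theorem Dat.tame1 (D : Dat) (J : ℕ) (A : ℝ) (k : ℕ) (hk : k ≤ 2 * J + 1) : ∃ C, 0 ≤ C ∧
    ∀ ε : ℝ, ε ≠ 0 → |ε| ≤ 1 → ∀ z ∈ Icc (0:ℝ) 1, ∀ t ∈ D.J, ∀ V : ℝ → ℝ, ContDiff ℝ ∞ V →
    (∀ j ≤ J, |ε * iteratedDeriv j V t| ≤ A) →
    |iteratedDeriv k (D.qq ε z V) t - D.cc ε z V t * iteratedDeriv k V t| ≤ C * (1 + sl k V t) := by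
  choose P hP0 hP using D.p_bound
  choose X hX0 hX using D.chi_bound
  set Ps := ∑ j ∈ Finset.range (2 * J + 2), P j with hPs
  have hPs0 : 0 ≤ Ps := Finset.sum_nonneg fun j _ => hP0 j
  have hPle : ∀ j, j < 2 * J + 2 → P j ≤ Ps := fun j hj =>
    Finset.single_le_sum (fun j _ => hP0 j) (Finset.mem_range.2 hj)
  obtain ⟨B, hB0, hB⟩ := D.Psi_bound (A + Ps)
  have hT := fun i => fun hi => comp_tame (A + Ps) J i hi B
  have hT' : ∀ i, ∃ C, 0 ≤ C ∧ (i ≤ 2 * J + 1 → ∀ f g : ℝ → ℝ, ContDiff ℝ ∞ f →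
      ContDiff ℝ ∞ g → ∀ t, (∀ m, |iteratedDeriv m f (g t)| ≤ B m) →
      (∀ j ≤ J, |iteratedDeriv j g t| ≤ A + Ps) →
      |iteratedDeriv i (fun s => f (g s)) t - deriv f (g t) * iteratedDeriv i g t|
      ≤ C * (1 + sl i g t)) := by
    intro i
    by_cases hi : i ≤ 2 * J + 1
    · obtain ⟨C, h0, hC⟩ := hT i hi
      exact ⟨C, h0, fun _ => hC⟩
    · exact ⟨0, le_rfl, fun h => absurd h hi⟩
  choose K hK0 hK using hT'
  have kk : ∀ i, 0 ≤ (k.choose i : ℝ) * (K i + B 1) * X (k - i) := fun i => by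
    have := hK0 i; have := hX0 (k - i); have := hB0 1; positivity
  have ksum : 0 ≤ ∑ i ∈ Finset.range k, (k.choose i : ℝ) * (K i + B 1) * X (k - i) :=
    Finset.sum_nonneg fun i _ => kk i
  refine ⟨(∑ i ∈ Finset.range k, (k.choose i : ℝ) * (K i + B 1) * X (k - i)) * (1 + Ps)
    + K k * (1 + Ps) + B 1 * Ps, by have := hK0 k; have := hB0 1; positivity, ?_⟩
  intro ε h0 h1 z hz t ht V hV hA
  set ξ : ℝ → ℝ := fun s => D.p s z + ε * V s with hξ
  have hξs : ContDiff ℝ ∞ ξ := (D.pz_s z).add (contDiff_const.mul hV)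
  have hξi : ∀ j, iteratedDeriv j ξ t = iteratedDeriv j (fun s => D.p s z) t
      + ε * iteratedDeriv j V t := fun j => D.xi_iter ε z hV j t
  have hξA : ∀ j ≤ J, |iteratedDeriv j ξ t| ≤ A + Ps := by
    intro j hj
    rw [hξi]
    refine (abs_add_le _ _).trans ?_
    have := (hP j t ht z hz).trans (hPle j (by omega))
    linarith [hA j hj]
  have hξ0 : |ξ t| ≤ A + Ps := by simpa using hξA 0 (Nat.zero_le _)
  have hBm := hB ε h0 h1 (ξ t) hξ0
  have hb1 : |deriv (D.Psi ε) (ξ t)| ≤ B 1 := by simpa using hBm 1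
  have hsl : sl k ξ t ≤ Ps + sl k V t := by
    have e1 : sl k ξ t ≤ ∑ j ∈ Finset.range k, (P j + |iteratedDeriv j V t|) := by
      refine Finset.sum_le_sum fun j hj => ?_
      rw [hξi]
      refine (abs_add_le _ _).trans (add_le_add (hP j t ht z hz) ?_)
      rw [abs_mul]
      exact mul_le_of_le_one_left (abs_nonneg _) h1
    rw [Finset.sum_add_distrib] at e1
    refine e1.trans (add_le_add ?_ le_rfl)
    exact Finset.sum_le_sum_of_subset_of_nonneg (Finset.range_mono (by omega)) fun j _ _ => hP0 j
  have hsV := sl_nonneg k V t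
  have hsξ := sl_nonneg k ξ t
  have hW : 1 + sl k ξ t ≤ (1 + Ps) * (1 + sl k V t) := by nlinarith
  have hq : D.qq ε z V = fun s => D.Psi ε (ξ s) * D.chi s := by
    funext s; simp only [Dat.qq, Dat.Q, Dat.Psi, hξ]; ring
  have hh := fun i (hi : i ≤ 2 * J + 1) => hK i hi (D.Psi ε) ξ (D.Psi_s ε) hξs t hBm hξA
  have hh2 : ∀ i, i < k → |iteratedDeriv i (fun s => D.Psi ε (ξ s)) t|
      ≤ (K i + B 1) * ((1 + Ps) * (1 + sl k V t)) := by
    intro i hi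
    have e1 := hh i (by omega)
    have e2 : |iteratedDeriv i ξ t| ≤ sl k ξ t := le_sl hi ξ t
    have e3 := sl_mono hi.le ξ t
    have e4 := abs_sub_abs_le_abs_sub (iteratedDeriv i (fun s => D.Psi ε (ξ s)) t)
      (deriv (D.Psi ε) (ξ t) * iteratedDeriv i ξ t)
    rw [abs_mul] at e4
    have e5 : |deriv (D.Psi ε) (ξ t)| * |iteratedDeriv i ξ t| ≤ B 1 * (1 + sl k ξ t) := by
      apply mul_le_mul hb1 (by linarith) (abs_nonneg _) (hB0 1)
    have e6 : K i * (1 + sl i ξ t) ≤ K i * (1 + sl k ξ t) := by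
      have := hK0 i; gcongr
    have e7 : (K i + B 1) * (1 + sl k ξ t) ≤ (K i + B 1) * ((1 + Ps) * (1 + sl k V t)) := by
      have := hK0 i; have := hB0 1; gcongr
    linarith
  rw [hq, cd_mul (f := fun s => D.Psi ε (ξ s)) ((D.Psi_s ε).comp hξs) D.chi_s,
    Finset.sum_range_succ]
  have hd : D.cc ε z V t * iteratedDeriv k V t = D.chi t * (deriv (D.Psi ε) (ξ t)
      * (iteratedDeriv k ξ t - iteratedDeriv k (fun s => D.p s z) t)) := by
    rw [hξi]
    unfold Dat.cc
    rw [← D.Psi_deriv h0]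
    ring
  rw [hd]
  simp only [Nat.choose_self, Nat.cast_one, one_mul, Nat.sub_self, iteratedDeriv_zero]
  have split : ∀ s h c d p x: ℝ, s + h * c - c * (d * (x - p)) = s + c * (h - d * x) + c * (d * p) :=
    fun s h c d p x => by ring
  rw [split]
  have hchi : |D.chi t| ≤ 1 := by rw [abs_of_nonneg (D.chi0 t)]; exact D.chi1 t
  refine (abs_add_le _ _).trans ?_
  refine (add_le_add (abs_add_le _ _) le_rfl).trans ?_
  rw [add_mul, add_mul]
  refine add_le_add (add_le_add ?_ ?_) ?_
  · refine (Finset.abs_sum_le_sum_abs _ _).trans ?_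
    rw [mul_assoc, Finset.sum_mul]
    refine Finset.sum_le_sum fun i hi => ?_
    rw [abs_mul, abs_mul, Nat.abs_cast]
    have e1 := hh2 i (Finset.mem_range.1 hi)
    have e2 := hX (k - i) t ht
    have := hX0 (k - i)
    have := hK0 i
    have := hB0 1
    calc _ ≤ (k.choose i : ℝ) * ((K i + B 1) * ((1 + Ps) * (1 + sl k V t))) * X (k - i) := by
          gcongr
      _ = _ := by ring
  · rw [abs_mul]
    calc _ ≤ 1 * (K k * (1 + sl k ξ t)) := by
          gcongr
          exact hh k hk
      _ ≤ _ := by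
          have := hK0 k
          rw [one_mul, mul_assoc]
          gcongr
  · rw [abs_mul, abs_mul]
    have e1 := (hP k t ht z hz).trans (hPle k (by omega))
    have := hB0 1
    calc _ ≤ 1 * (B 1 * Ps) := by
          gcongr
      _ ≤ _ := by
          rw [one_mul]
          apply le_mul_of_one_le_right (by positivity)
          linarith

theorem Dat.tame (D : Dat) (J : ℕ) (A : ℝ) : ∃ C, 0 ≤ C ∧
    ∀ ε : ℝ, ε ≠ 0 → |ε| ≤ 1 → ∀ z ∈ Icc (0:ℝ) 1, ∀ t ∈ D.J, ∀ V : ℝ → ℝ, ContDiff ℝ ∞ V →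
    (∀ j ≤ J, |ε * iteratedDeriv j V t| ≤ A) → ∀ k ≤ 2 * J + 1,
    |iteratedDeriv k (D.qq ε z V) t - D.cc ε z V t * iteratedDeriv k V t| ≤ C * (1 + sl k V t) := by
  have h : ∀ k, ∃ C, 0 ≤ C ∧ (k ≤ 2 * J + 1 →
    ∀ ε : ℝ, ε ≠ 0 → |ε| ≤ 1 → ∀ z ∈ Icc (0:ℝ) 1, ∀ t ∈ D.J, ∀ V : ℝ → ℝ, ContDiff ℝ ∞ V →
    (∀ j ≤ J, |ε * iteratedDeriv j V t| ≤ A) →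
    |iteratedDeriv k (D.qq ε z V) t - D.cc ε z V t * iteratedDeriv k V t| ≤
      C * (1 + sl k V t)) := by
    intro k
    by_cases hk : k ≤ 2 * J + 1
    · obtain ⟨C, h0, hC⟩ := D.tame1 J A k hk
      exact ⟨C, h0, fun _ => hC⟩
    · exact ⟨0, le_rfl, fun h => absurd h hk⟩
  choose C hC0 hC using h
  refine ⟨∑ k ∈ Finset.range (2 * J + 2), C k, Finset.sum_nonneg fun k _ => hC0 k, ?_⟩
  intro ε h0 h1 z hz t ht V hV hA k hk
  refine (hC k hk ε h0 h1 z hz t ht V hV hA).trans ?_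
  have := sl_nonneg k V t
  gcongr
  exact Finset.single_le_sum (fun k _ => hC0 k) (Finset.mem_range.2 (by omega))

theorem Dat.cc_s (D : Dat) (ε z : ℝ) {V : ℝ → ℝ} (hV : ContDiff ℝ ∞ V) :
    ContDiff ℝ ∞ (D.cc ε z V) :=
  D.chi_s.mul ((cd_deriv D.g_s).comp (contDiff_const.mul ((D.pz_s z).add (contDiff_const.mul hV))))

theorem Dat.qq_s (D : Dat) (ε z : ℝ) {V : ℝ → ℝ} (hV : ContDiff ℝ ∞ V) :
    ContDiff ℝ ∞ (D.qq ε z V) := D.Q_contDiff ε contDiff_id contDiff_const hV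

theorem Dat.cc_deriv (D : Dat) (A : ℝ) : ∃ C, 0 ≤ C ∧
    ∀ ε : ℝ, |ε| ≤ 1 → ∀ z ∈ Icc (0:ℝ) 1, ∀ t ∈ D.J, ∀ V : ℝ → ℝ, ContDiff ℝ ∞ V →
    |ε * iteratedDeriv 1 V t| ≤ A → |deriv (D.cc ε z V) t| ≤ C := by
  obtain ⟨P, hP0, hP⟩ := D.p_bound 1
  obtain ⟨X, hX0, hX⟩ := D.chi_bound 1
  obtain ⟨M1, h10, hM1⟩ := D.gd_bound 1
  obtain ⟨M2, h20, hM2⟩ := D.gd_bound 2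
  refine ⟨X * M1 + M2 * (P + |A|), by positivity, ?_⟩
  intro ε h1 z hz t ht V hV hA
  simp only [iteratedDeriv_succ', iteratedDeriv_zero] at hP hX hM1 hM2 hA
  have e1 : HasDerivAt (fun s => ε * (D.p s z + ε * V s))
      (ε * (deriv (fun s => D.p s z) t + ε * deriv V t)) t :=
    (((cd_diff (D.pz_s z) t).hasDerivAt).add ((cd_diff hV t).hasDerivAt.const_mul ε)).const_mul ε
  have e2 := (cd_diff (cd_deriv D.g_s) (ε * (D.p t z + ε * V t))).hasDerivAt
  have e3 := (cd_diff D.chi_s t).hasDerivAt.mul (e2.comp t e1)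
  have e4 : deriv (D.cc ε z V) t = _ := e3.deriv
  rw [e4]
  refine (abs_add_le _ _).trans (add_le_add ?_ ?_)
  · rw [abs_mul]
    exact mul_le_mul (hX t ht) (hM1 _) (abs_nonneg _) hX0
  · rw [abs_mul, abs_mul, abs_mul, abs_of_nonneg (D.chi0 t)]
    have e5 : |deriv (fun s => D.p s z) t + ε * deriv V t| ≤ P + |A| :=
      (abs_add_le _ _).trans (add_le_add (hP t ht z hz) (hA.trans (le_abs_self _)))
    calc _ ≤ 1 * (M2 * (1 * (P + |A|))) := by
          gcongr
          · exact D.chi1 t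
          · exact hM2 _
      _ = _ := by ring

end EulerNM

open MeasureTheory Real Set
open scoped ContDiff

/-! # Part 4: energy estimates for the chain -/

namespace EulerNM

variable {D : Dat} {ε : ℝ} {n : ℕ}

/-- The strain of the chain. -/
noncomputable def Chain.V (c : Chain D ε n) (i : ℕ) : ℝ → ℝ := VV n c.w i

/-- The position of the spring. -/
noncomputable def zz (n i : ℕ) : ℝ := ((i + 1 : ℕ) : ℝ) / n

/-- The flux of the chain. -/
noncomputable def Chain.F (c : Chain D ε n) (i : ℕ) (t : ℝ) : ℝ :=
  c.V i t + D.qq ε (zz n i) (c.V i) t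

theorem zz_mem {n i : ℕ} (h : i < n) : zz n i ∈ Icc (0:ℝ) 1 := by
  have hn : (0:ℝ) < n := by exact_mod_cast (by omega : 0 < n)
  refine ⟨by unfold zz; positivity, ?_⟩
  unfold zz
  rw [div_le_one hn]
  exact_mod_cast h

theorem Chain.V_s (c : Chain D ε n) (i : ℕ) : ContDiff ℝ ∞ (c.V i) :=
  contDiff_const.mul ((c.smooth i).sub (c.smooth (i+1)))

theorem Chain.F_s (c : Chain D ε n) (i : ℕ) : ContDiff ℝ ∞ (c.F i) :=
  (c.V_s i).add (D.qq_s ε _ (c.V_s i))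

theorem Chain.V_iter (c : Chain D ε n) (k i : ℕ) (t : ℝ) : iteratedDeriv k (c.V i) t =
    n * (iteratedDeriv k (c.w i) t - iteratedDeriv k (c.w (i+1)) t) := by
  have h : c.V i = fun t => (n:ℝ) * (c.w i t - c.w (i+1) t) := rfl
  rw [h, iteratedDeriv_const_mul _ (cd_at ((c.smooth i).sub (c.smooth (i+1))) k t),
    iteratedDeriv_fun_sub (cd_at (c.smooth i) k t) (cd_at (c.smooth (i+1)) k t)]

theorem Chain.F_iter (c : Chain D ε n) (k i : ℕ) (t : ℝ) : iteratedDeriv k (c.F i) t =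
    iteratedDeriv k (c.V i) t + iteratedDeriv k (D.qq ε (zz n i) (c.V i)) t :=
  iteratedDeriv_fun_add (cd_at (c.V_s i) k t) (cd_at (D.qq_s ε _ (c.V_s i)) k t)

theorem Chain.S_eq (c : Chain D ε n) (i : ℕ) (t : ℝ) :
    D.S ε n c.w i t = D.kap n i * c.F (i-1) t := by
  rcases i with _ | i
  · simp [Dat.S, D.kap_zero]
  · rfl

theorem Chain.w_zero (c : Chain D ε n) {i : ℕ} (hi : n ≤ i) (k : ℕ) (t : ℝ) :
    iteratedDeriv k (c.w i) t = 0 := by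
  have : c.w i = fun _ => 0 := funext fun t => c.w_out i hi t
  rw [this]
  simp [iteratedDeriv_const]

theorem Chain.eqn_iter (c : Chain D ε n) (k : ℕ) {i : ℕ} (hi : i < n) {t : ℝ} (ht : t ∈ D.I) :
    (D.kap n (i + 1) - D.kap n i) / D.b * iteratedDeriv (k+2) (c.w i) t =
      -(D.kap n (i+1) * iteratedDeriv k (c.F i) t
        - D.kap n i * iteratedDeriv k (c.F (i-1)) t) := by
  have h1 : EqOn (fun t => (D.kap n (i + 1) - D.kap n i) / D.b * deriv (deriv (c.w i)) t)
      (fun t => (-D.kap n (i+1)) * c.F i t + D.kap n i * c.F (i-1) t) D.I := by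
    intro t ht
    simp only
    rw [c.eqn i hi t ht, c.S_eq, c.S_eq, Nat.add_sub_cancel]
    ring
  have h2 := h1.iteratedDeriv_of_isOpen isOpen_Ioo k ht
  rw [iteratedDeriv_const_mul _ (cd_at (cd_deriv (cd_deriv (c.smooth i))) k t),
    iteratedDeriv_fun_add (cd_at (contDiff_const.mul (c.F_s i)) k t)
      (cd_at (contDiff_const.mul (c.F_s _)) k t),
    iteratedDeriv_const_mul _ (cd_at (c.F_s _) k t),
    iteratedDeriv_const_mul _ (cd_at (c.F_s _) k t)] at h2
  rw [iteratedDeriv_succ', iteratedDeriv_succ', h2]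
  ring

theorem Dat.J_sub (D : Dat) {t : ℝ} (h : t ∈ D.J) : t ∈ D.I :=
  ⟨by linarith [h.1], by linarith [h.2]⟩

theorem Dat.m1_mem (D : Dat) : (-1 : ℝ) ∈ D.J := ⟨le_rfl, by linarith [D.hT]⟩

theorem Dat.qq_m1 (D : Dat) (ε z : ℝ) (V : ℝ → ℝ) (k : ℕ) :
    iteratedDeriv k (D.qq ε z V) (-1) = 0 := by
  have h : D.qq ε z V =ᶠ[nhds (-1)] fun _ => 0 := by
    filter_upwards [Iio_mem_nhds (show (-1 : ℝ) < -(1/2) by norm_num)] with s hs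
    simp only [Dat.qq, Dat.Q, D.chi_z s (le_of_lt hs), zero_mul]
  rw [h.iteratedDeriv_eq]
  simp [iteratedDeriv_const]

theorem Chain.at_m1 (c : Chain D ε n) (k : ℕ) : ∀ i, iteratedDeriv k (c.w i) (-1) = 0 := by
  induction k using Nat.strong_induction_on with
  | _ k ih =>
  intro i
  match k, ih with
  | 0, _ => simpa using c.init i
  | 1, _ => simpa using c.init' i
  | k+2, ih =>
    by_cases hi : i < n
    · have h1 := c.eqn_iter k hi (D.J_sub D.m1_mem)
      have h2 : ∀ j, iteratedDeriv k (c.F j) (-1) = 0 := by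
        intro j
        rw [c.F_iter, c.V_iter, ih k (by omega), ih k (by omega), D.qq_m1]
        simp
      rw [h2, h2] at h1
      simp only [mul_zero, sub_zero, neg_zero, mul_eq_zero] at h1
      rcases h1 with h1 | h1
      · exfalso
        have h3 := D.kap_lt (by omega : 0 < n) i
        have h4 := D.bpos
        have : 0 < (D.kap n (i + 1) - D.kap n i) / D.b := div_pos (by linarith) h4
        linarith
      · exact h1
    · exact c.w_zero (by omega) _ _

theorem Chain.V_m1 (c : Chain D ε n) (k i : ℕ) : iteratedDeriv k (c.V i) (-1) = 0 := by
  rw [c.V_iter, c.at_m1, c.at_m1]; simp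

/-- The remainder in the differentiated flux. -/
noncomputable def Chain.R (c : Chain D ε n) (k i : ℕ) (t : ℝ) : ℝ :=
  iteratedDeriv k (D.qq ε (zz n i) (c.V i)) t
    - D.cc ε (zz n i) (c.V i) t * iteratedDeriv k (c.V i) t

/-- weights -/
noncomputable def Dat.om (D : Dat) (n i : ℕ) : ℝ := D.kap n (i+1) / n

theorem Dat.om_nonneg (D : Dat) (n i : ℕ) : 0 ≤ D.om n i := by
  have := D.kap_nonneg n (i+1); unfold Dat.om; positivity

theorem Dat.kap_le_one (D : Dat) {n i : ℕ} (h : i ≤ n) : D.kap n i ≤ 1 := by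
  unfold Dat.kap
  refine Real.rpow_le_one (by positivity) (div_le_one_of_le₀ ?_ (Nat.cast_nonneg _)) D.bpos.le
  exact_mod_cast h

theorem Dat.om_sum (D : Dat) (n : ℕ) : ∑ i ∈ Finset.range n, D.om n i ≤ 1 := by
  have h : ∑ i ∈ Finset.range n, D.om n i ≤ ∑ _i ∈ Finset.range n, (1 / n : ℝ) := by
    refine Finset.sum_le_sum fun i hi => ?_
    have := D.kap_le_one (show i + 1 ≤ n from Finset.mem_range.1 hi)
    unfold Dat.om
    gcongr
  refine h.trans ?_
  rw [Finset.sum_const, Finset.card_range, nsmul_eq_mul]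
  rw [mul_one_div]; exact div_self_le_one _

/-- The weighted square norm of the strain derivative. -/
noncomputable def Chain.bb (c : Chain D ε n) (k : ℕ) (t : ℝ) : ℝ :=
  ∑ i ∈ Finset.range n, D.om n i * (iteratedDeriv k (c.V i) t) ^ 2

theorem Chain.bb_nonneg (c : Chain D ε n) (k : ℕ) (t : ℝ) : 0 ≤ c.bb k t :=
  Finset.sum_nonneg fun i _ => mul_nonneg (D.om_nonneg n i) (sq_nonneg _)

/-- The energy. -/
noncomputable def Chain.En (c : Chain D ε n) (k : ℕ) (t : ℝ) : ℝ :=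
  (∑ i ∈ Finset.range n, (D.kap n (i + 1) - D.kap n i) / D.b *
      (1/2 * (iteratedDeriv (k+1) (c.w i) t) ^ 2))
  + ∑ i ∈ Finset.range n, D.om n i * (1/2 * (1 + D.cc ε (zz n i) (c.V i) t)
      * (iteratedDeriv k (c.V i) t) ^ 2 + c.R k i t * iteratedDeriv k (c.V i) t)

theorem sum_parts (S u : ℕ → ℝ) (n : ℕ) :
    ∑ i ∈ Finset.range n, (S (i+1) - S i) * u i
      = ∑ i ∈ Finset.range n, S (i+1) * (u i - u (i+1)) + S n * u n - S 0 * u 0 := by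
  induction n with
  | zero => simp
  | succ n ih => rw [Finset.sum_range_succ, Finset.sum_range_succ, ih]; ring

theorem Chain.En_deriv (c : Chain D ε n) (hn : 0 < n) (k : ℕ) {t : ℝ} (ht : t ∈ D.I) :
    HasDerivAt (c.En k) (∑ i ∈ Finset.range n, D.om n i *
      (-(1/2) * deriv (D.cc ε (zz n i) (c.V i)) t * (iteratedDeriv k (c.V i) t) ^ 2
        + c.R (k+1) i t * iteratedDeriv k (c.V i) t)) t := by
  have hR : ∀ i, HasDerivAt (c.R k i) (c.R (k+1) i t
      - deriv (D.cc ε (zz n i) (c.V i)) t * iteratedDeriv k (c.V i) t) t := by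
    intro i
    have h1 := cd_hasDerivAt (D.qq_s ε (zz n i) (c.V_s i)) k t
    have h2 := (cd_diff (D.cc_s ε (zz n i) (c.V_s i)) t).hasDerivAt
    have h3 := cd_hasDerivAt (c.V_s i) k t
    refine (h1.sub (h2.mul h3)).congr_deriv ?_
    simp only [Chain.R]; ring
  have h1 : HasDerivAt (c.En k) ((∑ i ∈ Finset.range n, (D.kap n (i + 1) - D.kap n i) / D.b *
      (1/2 * (2 * iteratedDeriv (k+1) (c.w i) t * iteratedDeriv (k+2) (c.w i) t)))
    + ∑ i ∈ Finset.range n, D.om n i * ((1/2 * deriv (D.cc ε (zz n i) (c.V i)) t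
      * (iteratedDeriv k (c.V i) t) ^ 2 + 1/2 * (1 + D.cc ε (zz n i) (c.V i) t)
      * (2 * iteratedDeriv k (c.V i) t * iteratedDeriv (k+1) (c.V i) t)) +
      ((c.R (k+1) i t - deriv (D.cc ε (zz n i) (c.V i)) t * iteratedDeriv k (c.V i) t)
        * iteratedDeriv k (c.V i) t + c.R k i t * iteratedDeriv (k+1) (c.V i) t))) t := by
    refine HasDerivAt.add (HasDerivAt.fun_sum fun i _ => ?_) (HasDerivAt.fun_sum fun i _ => ?_)
    · have := (((cd_hasDerivAt (c.smooth i) (k+1) t).pow 2).const_mul (1/2)).const_mul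
        ((D.kap n (i + 1) - D.kap n i) / D.b)
      refine this.congr_deriv ?_
      push_cast; ring
    · have h2 := (cd_diff (D.cc_s ε (zz n i) (c.V_s i)) t).hasDerivAt
      have h3 := cd_hasDerivAt (c.V_s i) k t
      have := ((((h2.const_add 1).const_mul (1/2)).mul (h3.pow 2)).add
        ((hR i).mul h3)).const_mul (D.om n i)
      refine this.congr_deriv ?_
      simp only [Pi.pow_apply]; push_cast; ring
  refine h1.congr_deriv ?_
  have h2 : ∑ i ∈ Finset.range n, (D.kap n (i + 1) - D.kap n i) / D.b *
      (1/2 * (2 * iteratedDeriv (k+1) (c.w i) t * iteratedDeriv (k+2) (c.w i) t))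
      = - ∑ i ∈ Finset.range n, D.om n i * (iteratedDeriv k (c.F i) t
        * iteratedDeriv (k+1) (c.V i) t) := by
    have e1 := sum_parts (fun i => D.kap n i * iteratedDeriv k (c.F (i-1)) t)
      (fun i => iteratedDeriv (k+1) (c.w i) t) n
    simp only [D.kap_zero, c.w_zero le_rfl, Nat.add_sub_cancel] at e1
    have e2 : ∑ i ∈ Finset.range n, (D.kap n (i + 1) - D.kap n i) / D.b *
      (1/2 * (2 * iteratedDeriv (k+1) (c.w i) t * iteratedDeriv (k+2) (c.w i) t))
      = - ∑ i ∈ Finset.range n, (D.kap n (i+1) * iteratedDeriv k (c.F i) t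
        - D.kap n i * iteratedDeriv k (c.F (i-1)) t) * iteratedDeriv (k+1) (c.w i) t := by
      rw [← Finset.sum_neg_distrib]
      refine Finset.sum_congr rfl fun i hi => ?_
      rw [← neg_mul, ← c.eqn_iter k (Finset.mem_range.1 hi) ht]
      ring
    rw [e2, e1]
    simp only [mul_zero, zero_mul, add_zero, sub_zero]
    congr 1
    refine Finset.sum_congr rfl fun i _ => ?_
    rw [c.V_iter, Dat.om]
    have : (n:ℝ) ≠ 0 := by exact_mod_cast hn.ne'
    field_simp
  rw [h2, ← Finset.sum_neg_distrib, ← Finset.sum_add_distrib]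
  refine Finset.sum_congr rfl fun i _ => ?_
  rw [c.F_iter]
  simp only [Chain.R]
  ring

theorem gron {E E' : ℝ → ℝ} {a c : ℝ} {K : ℝ} (h : ∀ t ∈ Icc a c, HasDerivAt E (E' t) t)
    (hE : ∀ t ∈ Icc a c, E' t ≤ K * (E t + 1)) {t : ℝ} (ht : t ∈ Icc a c) :
    E t + 1 ≤ (E a + 1) * exp (K * (t - a)) := by
  have h1 : ∀ s ∈ Icc a c, HasDerivAt (fun s => (E s + 1) * exp (-(K * (s - a))))
      ((E' s - K * (E s + 1)) * exp (-(K * (s - a)))) s := by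
    intro s hs
    have e : HasDerivAt (fun s => exp (-(K * (s - a)))) (exp (-(K * (s - a))) * (-(K * 1))) s :=
      ((((hasDerivAt_id s).sub_const a).const_mul K).neg).exp
    refine (((h s hs).add_const 1).mul e).congr_deriv ?_
    ring
  have h2 : AntitoneOn (fun s => (E s + 1) * exp (-(K * (s - a)))) (Icc a c) := by
    refine antitoneOn_of_deriv_nonpos (convex_Icc a c)
      (fun s hs => (h1 s hs).continuousAt.continuousWithinAt) ?_ ?_
    · intro s hs
      exact (h1 s (interior_subset hs)).differentiableAt.differentiableWithinAt
    · intro s hs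
      rw [(h1 s (interior_subset hs)).deriv]
      refine mul_nonpos_of_nonpos_of_nonneg ?_ (exp_pos _).le
      linarith [hE s (interior_subset hs)]
  have h3 := h2 (left_mem_Icc.2 (ht.1.trans ht.2)) ht ht.1
  simp only [sub_self, mul_zero, neg_zero, exp_zero, mul_one] at h3
  calc E t + 1 = (E t + 1) * exp (-(K * (t - a))) * exp (K * (t - a)) := by
        rw [mul_assoc, ← exp_add]; simp
    _ ≤ _ := by gcongr

theorem sl_sq (k : ℕ) (f : ℝ → ℝ) (t : ℝ) :
    (1 + sl k f t) ^ 2 ≤ 2 + 2 * k * ∑ j ∈ Finset.range k, (iteratedDeriv j f t) ^ 2 := by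
  have h1 : (sl k f t) ^ 2 ≤ k * ∑ j ∈ Finset.range k, (iteratedDeriv j f t) ^ 2 := by
    have := sq_sum_le_card_mul_sum_sq (s := Finset.range k) (f := fun j => |iteratedDeriv j f t|)
    simpa [sl, sq_abs] using this
  nlinarith [sq_nonneg (1 - sl k f t)]

/-- Bootstrap hypothesis. -/
def Chain.Hyp (c : Chain D ε n) (J : ℕ) (A t1 : ℝ) : Prop :=
  ∀ t ∈ Icc (-1) t1, ∀ i < n, ∀ j ≤ J, |ε * iteratedDeriv j (c.V i) t| ≤ A

theorem Dat.energy (D : Dat) (J : ℕ) (hJ : 1 ≤ J) (A : ℝ) : ∀ k, k ≤ 2 * J → ∃ C, 0 ≤ C ∧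
    ∀ ε : ℝ, ε ≠ 0 → |ε| ≤ 1 → ∀ n : ℕ, 0 < n → ∀ c : Chain D ε n, ∀ t1 ∈ D.J, c.Hyp J A t1 →
    ∀ t ∈ Icc (-1) t1, c.bb k t ≤ C := by
  intro k
  induction k using Nat.strong_induction_on with
  | _ k ih =>
  intro hk
  have ih' : ∀ j, ∃ C, 0 ≤ C ∧ (j < k → 
    ∀ ε : ℝ, ε ≠ 0 → |ε| ≤ 1 → ∀ n : ℕ, 0 < n → ∀ c : Chain D ε n, ∀ t1 ∈ D.J, c.Hyp J A t1 →
    ∀ t ∈ Icc (-1) t1, c.bb j t ≤ C) := by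
    intro j
    by_cases hj : j < k
    · obtain ⟨C, h0, hC⟩ := ih j hj (by omega)
      exact ⟨C, h0, fun _ => hC⟩
    · exact ⟨0, le_rfl, fun h => absurd h hj⟩
  choose B hB0 hB using ih'
  obtain ⟨C, hC0, hC⟩ := D.tame J A
  obtain ⟨C1, hC10, hC1⟩ := D.cc_deriv A
  set G := 2 + 2 * k * ∑ j ∈ Finset.range k, B j with hG
  have hG0 : 0 ≤ G := by
    have : 0 ≤ ∑ j ∈ Finset.range k, B j := Finset.sum_nonneg fun j _ => hB0 j
    positivity
  set K := (C1 + 2 * C) * (8 + 16 * C ^ 2 * G) + C * G + 8 * (C1 + 2 * C) * (2 * C ^ 2 * G) with hK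
  refine ⟨8 * (1 + 2 * C ^ 2 * G) * exp (K * (D.T + 2)) + 16 * C ^ 2 * G, by positivity, ?_⟩
  intro ε h0 h1 n hn c t1 ht1 hH t ht
  have hsub : ∀ s ∈ Icc (-1) t1, s ∈ D.J := fun s hs => ⟨hs.1, hs.2.trans ht1.2⟩
  have hGs : ∀ s ∈ Icc (-1) t1, ∑ i ∈ Finset.range n, D.om n i * (1 + sl k (c.V i) s) ^ 2 ≤ G := by
    intro s hs
    calc _ ≤ ∑ i ∈ Finset.range n, D.om n i * (2 + 2 * k * ∑ j ∈ Finset.range k,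
          (iteratedDeriv j (c.V i) s) ^ 2) :=
          Finset.sum_le_sum fun i _ => mul_le_mul_of_nonneg_left (sl_sq _ _ _) (D.om_nonneg n i)
      _ = 2 * (∑ i ∈ Finset.range n, D.om n i) + 2 * k * ∑ j ∈ Finset.range k, c.bb j s := by
          simp only [Chain.bb]
          rw [Finset.sum_comm, Finset.mul_sum, Finset.mul_sum, ← Finset.sum_add_distrib]
          refine Finset.sum_congr rfl fun i _ => ?_
          rw [← Finset.mul_sum]
          ring
      _ ≤ 2 * 1 + 2 * k * ∑ j ∈ Finset.range k, B j := by
          gcongr with j hj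
          · exact D.om_sum n
          · exact hB j (Finset.mem_range.1 hj) ε h0 h1 n hn c t1 ht1 hH s hs
      _ = G := by rw [hG]; ring
  have hRk : ∀ s ∈ Icc (-1) t1, ∀ i < n, ∀ m ≤ 2 * J + 1,
      |c.R m i s| ≤ C * (1 + sl m (c.V i) s) := by
    intro s hs i hi m hm
    exact hC ε h0 h1 (zz n i) (zz_mem hi) s (hsub s hs) (c.V i) (c.V_s i) (hH s hs i hi) m hm
  have hlow : ∀ s ∈ Icc (-1) t1, c.bb k s ≤ 8 * c.En k s + 16 * C ^ 2 * G := by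
    intro s hs
    have e1 : ∑ i ∈ Finset.range n, D.om n i * (1/8 * (iteratedDeriv k (c.V i) s) ^ 2
        - 2 * C ^ 2 * (1 + sl k (c.V i) s) ^ 2) ≤ c.En k s := by
      unfold Chain.En
      refine le_add_of_nonneg_of_le (Finset.sum_nonneg fun i hi => ?_)
        (Finset.sum_le_sum fun i hi => mul_le_mul_of_nonneg_left ?_ (D.om_nonneg n i))
      · have := D.kap_lt hn i
        have := D.bpos
        have : 0 ≤ (D.kap n (i + 1) - D.kap n i) / D.b := div_nonneg (by linarith) (by linarith)
        positivity
      · have r1 := hRk s hs i (Finset.mem_range.1 hi) k (by omega)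
        have r2 := (abs_le.1 (D.cc_le ε (zz n i) (c.V i) s)).1
        have r3 : (c.R k i s) ^ 2 ≤ C ^ 2 * (1 + sl k (c.V i) s) ^ 2 := by
          rw [← mul_pow, ← sq_abs]
          exact pow_le_pow_left₀ (abs_nonneg _) r1 2
        have r4 := sq_nonneg (iteratedDeriv k (c.V i) s)
        nlinarith [sq_nonneg (iteratedDeriv k (c.V i) s + 4 * c.R k i s)]
    have e2 : ∑ i ∈ Finset.range n, D.om n i * (1/8 * (iteratedDeriv k (c.V i) s) ^ 2
        - 2 * C ^ 2 * (1 + sl k (c.V i) s) ^ 2) = 1/8 * c.bb k s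
        - 2 * C ^ 2 * ∑ i ∈ Finset.range n, D.om n i * (1 + sl k (c.V i) s) ^ 2 := by
      simp only [Chain.bb, Finset.mul_sum, ← Finset.sum_sub_distrib]
      refine Finset.sum_congr rfl fun i _ => ?_
      ring
    have e3 : 2 * C ^ 2 * ∑ i ∈ Finset.range n, D.om n i * (1 + sl k (c.V i) s) ^ 2
        ≤ 2 * C ^ 2 * G := mul_le_mul_of_nonneg_left (hGs s hs) (by positivity)
    linarith
  have hder : ∀ s ∈ Icc (-1) t1, (∑ i ∈ Finset.range n, D.om n i *
      (-(1/2) * deriv (D.cc ε (zz n i) (c.V i)) s * (iteratedDeriv k (c.V i) s) ^ 2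
        + c.R (k+1) i s * iteratedDeriv k (c.V i) s)) ≤ (C1 + 2 * C) * c.bb k s + C * G := by
    intro s hs
    have e1 : ∀ i ∈ Finset.range n, D.om n i *
      (-(1/2) * deriv (D.cc ε (zz n i) (c.V i)) s * (iteratedDeriv k (c.V i) s) ^ 2
        + c.R (k+1) i s * iteratedDeriv k (c.V i) s) ≤
        (C1 + 2 * C) * (D.om n i * (iteratedDeriv k (c.V i) s) ^ 2)
          + C * (D.om n i * (1 + sl k (c.V i) s) ^ 2) := by
      intro i hi
      have hi' := Finset.mem_range.1 hi
      have r1 := hRk s hs i hi' (k+1) (by omega)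
      rw [sl_succ] at r1
      have r2 := (abs_le.1 (hC1 ε h1 (zz n i) (zz_mem hi') s (hsub s hs) (c.V i) (c.V_s i)
        (hH s hs i hi' 1 hJ))).1
      have r3 : c.R (k+1) i s * iteratedDeriv k (c.V i) s
          ≤ C * (1 + (sl k (c.V i) s + |iteratedDeriv k (c.V i) s|))
            * |iteratedDeriv k (c.V i) s| := by
        refine (le_abs_self _).trans ?_
        rw [abs_mul]
        exact mul_le_mul_of_nonneg_right r1 (abs_nonneg _)
      have r4 := sq_nonneg (iteratedDeriv k (c.V i) s)
      have r5 := sq_abs (iteratedDeriv k (c.V i) s)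
      have key : (-(1/2) * deriv (D.cc ε (zz n i) (c.V i)) s * (iteratedDeriv k (c.V i) s) ^ 2
        + c.R (k+1) i s * iteratedDeriv k (c.V i) s) ≤
        (C1 + 2 * C) * (iteratedDeriv k (c.V i) s) ^ 2 + C * (1 + sl k (c.V i) s) ^ 2 := by
        have q1 : C * (1 + (sl k (c.V i) s + |iteratedDeriv k (c.V i) s|))
            * |iteratedDeriv k (c.V i) s| ≤ C * (2 * (iteratedDeriv k (c.V i) s) ^ 2
              + (1 + sl k (c.V i) s) ^ 2) := by
          rw [mul_assoc]
          refine mul_le_mul_of_nonneg_left ?_ hC0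
          nlinarith [sq_nonneg (1 + sl k (c.V i) s - |iteratedDeriv k (c.V i) s|),
            sq_nonneg (1 + sl k (c.V i) s)]
        have q2 : -(1/2) * deriv (D.cc ε (zz n i) (c.V i)) s * (iteratedDeriv k (c.V i) s) ^ 2
            ≤ C1 * (iteratedDeriv k (c.V i) s) ^ 2 := by
          refine mul_le_mul_of_nonneg_right ?_ r4
          linarith
        linarith
      have := mul_le_mul_of_nonneg_left key (D.om_nonneg n i)
      linarith
    refine (Finset.sum_le_sum e1).trans ?_
    rw [Finset.sum_add_distrib, ← Finset.mul_sum, ← Finset.mul_sum]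
    have := mul_le_mul_of_nonneg_left (hGs s hs) hC0
    simp only [Chain.bb]
    linarith
  have hlowE : ∀ s ∈ Icc (-1) t1, 0 ≤ c.En k s + 2 * C ^ 2 * G := by
    intro s hs
    have := hlow s hs
    have := c.bb_nonneg k s
    linarith
  have hg := gron (E := fun s => c.En k s + 2 * C ^ 2 * G) (a := -1) (c := t1) (K := K)
    (fun s hs => (c.En_deriv hn k (D.J_sub (hsub s hs))).add_const _) (by
      intro s hs
      refine (hder s hs).trans ?_
      have q1 := hlow s hs
      have q2 := hlowE s hs
      have q3 : (C1 + 2 * C) * c.bb k s ≤ (C1 + 2 * C) * (8 * (c.En k s + 2 * C ^ 2 * G)) :=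
        mul_le_mul_of_nonneg_left (by linarith) (by positivity)
      have q4 : 8 * (C1 + 2 * C) ≤ K := by
        rw [hK]
        have : 0 ≤ (C1 + 2 * C) * (16 * C ^ 2 * G) := by positivity
        have : 0 ≤ C * G := by positivity
        have : 0 ≤ 8 * (C1 + 2 * C) * (2 * C ^ 2 * G) := by positivity
        linarith
      have q5 : C * G ≤ K := by
        rw [hK]
        have : 0 ≤ (C1 + 2 * C) * (8 + 16 * C ^ 2 * G) := by positivity
        have : 0 ≤ 8 * (C1 + 2 * C) * (2 * C ^ 2 * G) := by positivity
        linarith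
      have q6 := mul_le_mul_of_nonneg_right q4 q2
      linarith) ht
  have hE0 : c.En k (-1) = 0 := by
    unfold Chain.En
    simp [c.at_m1, c.V_m1]
  rw [hE0] at hg
  have hexp : exp (K * (t - -1)) ≤ exp (K * (D.T + 2)) := by
    refine exp_le_exp.2 (mul_le_mul_of_nonneg_left ?_ (by positivity))
    have := ht.2; have := ht1.2; linarith
  have hfin := mul_le_mul_of_nonneg_left hexp (show 0 ≤ 1 + 2 * C ^ 2 * G by positivity)
  have := hlow t ht
  have h9 : (0 + 2 * C ^ 2 * G + 1) = 1 + 2 * C ^ 2 * G := by ring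
  rw [h9] at hg
  have : 0 ≤ 2 * C ^ 2 * G := by positivity
  linarith

end EulerNM

open MeasureTheory Real Set
open scoped ContDiff

/-! # Part 5: pointwise bounds for the chain -/

namespace EulerNM

variable {D : Dat} {ε : ℝ} {n : ℕ}

theorem zz_pos {n : ℕ} (hn : 0 < n) (i : ℕ) : 0 < zz n i := by
  unfold zz; positivity

theorem zz_mono {n : ℕ} {i j : ℕ} (h : i ≤ j) : zz n i ≤ zz n j := by
  unfold zz; gcongr

/-- Uniform weighted bound under the bootstrap hypothesis. -/
def Dat.UB (D : Dat) (J : ℕ) (A : ℝ) (P : (ε : ℝ) → (n : ℕ) → Chain D ε n → ℕ → ℝ → ℝ)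
    (α : ℝ) : Prop :=
  ∃ C, 0 ≤ C ∧ ∀ ε : ℝ, ε ≠ 0 → |ε| ≤ 1 → ∀ n : ℕ, 0 < n → ∀ c : Chain D ε n, ∀ t1 ∈ D.J,
    c.Hyp J A t1 → ∀ t ∈ Icc (-1) t1, ∀ i < n, |P ε n c i t| ≤ C * zz n i ^ (-α)

theorem Chain.w_sum (c : Chain D ε n) (hn : 0 < n) (k : ℕ) (t : ℝ) {i : ℕ} (hi : i ≤ n) :
    iteratedDeriv k (c.w i) t = (1 / n : ℝ) * ∑ j ∈ Finset.Ico i n, iteratedDeriv k (c.V j) t := by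
  have hn' : (n:ℝ) ≠ 0 := by positivity
  simp only [c.V_iter]
  rw [← Finset.mul_sum, ← mul_assoc, one_div_mul_cancel hn', one_mul]
  obtain ⟨m, rfl⟩ := Nat.exists_eq_add_of_le hi
  rw [Finset.sum_Ico_eq_sum_range, Nat.add_sub_cancel_left]
  have h1 := Finset.sum_range_sub' (fun j => iteratedDeriv k (c.w (i + j)) t) m
  simp only [add_zero] at h1
  rw [c.w_zero le_rfl, sub_zero] at h1
  rw [← h1]
  rfl

theorem Chain.base_bound (c : Chain D ε n) (hn : 0 < n) (k : ℕ) (t : ℝ) {C : ℝ}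
    (hC : c.bb k t ≤ C) {i : ℕ} (hi : i < n) :
    |iteratedDeriv k (c.w i) t| ≤ √C * zz n i ^ (-(D.b / 2)) := by
  have hn' : (0:ℝ) < n := by positivity
  have hz := zz_pos hn i
  rw [c.w_sum hn k t hi.le]
  have hk : 0 < zz n i ^ D.b := Real.rpow_pos_of_pos hz _
  have h1 : ((1 / n : ℝ) * ∑ j ∈ Finset.Ico i n, iteratedDeriv k (c.V j) t) ^ 2
      ≤ C * zz n i ^ (-D.b) := by
    have e1 := sq_sum_le_card_mul_sum_sq (s := Finset.Ico i n)
      (f := fun j => iteratedDeriv k (c.V j) t)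
    have e2 : ((Finset.Ico i n).card : ℝ) ≤ n := by
      rw [Nat.card_Ico]; exact_mod_cast Nat.sub_le _ _
    have e3 : zz n i ^ D.b * ((1 / n : ℝ) * ∑ j ∈ Finset.Ico i n, iteratedDeriv k (c.V j) t ^ 2)
        ≤ c.bb k t := by
      unfold Chain.bb
      calc _ = ∑ j ∈ Finset.Ico i n, (zz n i ^ D.b / n) * iteratedDeriv k (c.V j) t ^ 2 := by
            rw [← Finset.mul_sum]; ring
        _ ≤ ∑ j ∈ Finset.Ico i n, D.om n j * iteratedDeriv k (c.V j) t ^ 2 := by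
            refine Finset.sum_le_sum fun j hj => mul_le_mul_of_nonneg_right ?_ (sq_nonneg _)
            unfold Dat.om Dat.kap
            have := Real.rpow_le_rpow hz.le (zz_mono (n := n) (Finset.mem_Ico.1 hj).1) D.bpos.le
            unfold zz at this ⊢
            gcongr
        _ ≤ _ := by
            refine Finset.sum_le_sum_of_subset_of_nonneg ?_
              fun j _ _ => mul_nonneg (D.om_nonneg n j) (sq_nonneg _)
            intro j hj
            exact Finset.mem_range.2 (Finset.mem_Ico.1 hj).2
    have e4 : 0 ≤ ∑ j ∈ Finset.Ico i n, iteratedDeriv k (c.V j) t ^ 2 :=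
      Finset.sum_nonneg fun j _ => sq_nonneg _
    have e5 : ((1 / n : ℝ) * ∑ j ∈ Finset.Ico i n, iteratedDeriv k (c.V j) t) ^ 2
        ≤ (1 / n : ℝ) * ∑ j ∈ Finset.Ico i n, iteratedDeriv k (c.V j) t ^ 2 := by
      calc _ = (1/n:ℝ)^2 * (∑ j ∈ Finset.Ico i n, iteratedDeriv k (c.V j) t)^2 := by ring
        _ ≤ (1/n:ℝ)^2 * (n * ∑ j ∈ Finset.Ico i n, iteratedDeriv k (c.V j) t ^ 2) := by
          gcongr
          exact e1.trans (mul_le_mul_of_nonneg_right e2 e4)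
        _ = _ := by field_simp
    rw [Real.rpow_neg hz.le, ← div_eq_mul_inv, le_div_iff₀ hk]
    calc _ ≤ (1 / n : ℝ) * (∑ j ∈ Finset.Ico i n, iteratedDeriv k (c.V j) t ^ 2)
          * zz n i ^ D.b := by gcongr
      _ ≤ C := by linarith
  have hC0 : 0 ≤ C := (c.bb_nonneg k t).trans hC
  refine abs_le_of_sq_le_sq ?_ (by positivity)
  rw [mul_pow (√C), Real.sq_sqrt hC0, ← Real.rpow_natCast (zz n i ^ (-(D.b/2))), ← Real.rpow_mul hz.le]
  have e : -(D.b / 2) * ((2:ℕ):ℝ) = -D.b := by push_cast; ring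
  rw [e]
  exact h1

theorem Dat.WB_base (D : Dat) (J : ℕ) (hJ : 1 ≤ J) (A : ℝ) {k : ℕ} (hk : k ≤ 2 * J) :
    D.UB J A (fun _ _ c i t => iteratedDeriv k (c.w i) t) (D.b / 2) := by
  obtain ⟨C, h0, hC⟩ := D.energy J hJ A k hk
  refine ⟨√C, Real.sqrt_nonneg _, ?_⟩
  intro ε h0 h1 n hn c t1 ht1 hH t ht i hi
  exact c.base_bound hn k t (hC ε h0 h1 n hn c t1 ht1 hH t ht) hi

theorem pow_ineq {x y b α : ℝ} (hy : 0 ≤ y) (hx : y < x) (hb : 0 < b) (_h0 : 0 ≤ α)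
    (h1 : α ≤ b / 2) : (x ^ b - y ^ b) * x ^ (-α) ≤ 2 * (x ^ (b - α) - y ^ (b - α)) := by
  have hx0 : 0 < x := by linarith
  have hs : 0 ≤ y / x := by positivity
  have hs1 : y / x ≤ 1 := (div_le_one hx0).2 hx.le
  set s := y / x with hsd
  have hy' : y = s * x := by rw [hsd]; field_simp
  have e1 : y ^ b = s ^ b * x ^ b := by rw [hy', Real.mul_rpow hs hx0.le]
  have e2 : y ^ (b-α) = s ^ (b-α) * x ^ (b-α) := by rw [hy', Real.mul_rpow hs hx0.le]
  have e3 : x ^ b * x ^ (-α) = x ^ (b - α) := by rw [← Real.rpow_add hx0]; rfl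
  have e4 : s ^ (b-α) ≤ s ^ (b/2) := by
    rcases hs.eq_or_lt with h | h
    · rw [← h, Real.zero_rpow (by linarith), Real.zero_rpow (by linarith)]
    · exact Real.rpow_le_rpow_of_exponent_ge h hs1 (by linarith)
  have e5 : s ^ b = (s ^ (b/2)) ^ 2 := by
    rw [← Real.rpow_natCast, ← Real.rpow_mul hs]; congr 1; push_cast; ring
  have e6 : 0 < x ^ (b-α) := Real.rpow_pos_of_pos hx0 _
  have : (x ^ b - y ^ b) * x ^ (-α) = (1 - s ^ b) * x ^ (b - α) := by rw [e1, ← e3]; ring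
  rw [this, e2]
  have : (1 - s ^ b) ≤ 2 * (1 - s ^ (b-α)) := by
    rw [e5]; nlinarith [sq_nonneg (1 - s ^ (b/2))]
  nlinarith

theorem Chain.flux_id (c : Chain D ε n) (k : ℕ) {t : ℝ} (ht : t ∈ D.I) {i : ℕ} (hi : i < n) :
    D.kap n (i+1) * iteratedDeriv k (c.F i) t =
      - ∑ j ∈ Finset.range (i+1), (D.kap n (j+1) - D.kap n j) / D.b
        * iteratedDeriv (k+2) (c.w j) t := by
  induction i with
  | zero =>
    have := c.eqn_iter k hi ht
    simp only [D.kap_zero, zero_mul, sub_zero] at this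
    rw [Finset.sum_range_one, D.kap_zero, sub_zero, this]
    simp
  | succ i ih =>
    have h1 := c.eqn_iter k hi ht
    have h2 := ih (by omega)
    rw [Finset.sum_range_succ, h1]
    simp only [Nat.add_sub_cancel] at h1 ⊢
    linarith

theorem Chain.F_bound (c : Chain D ε n) (hn : 0 < n) (k : ℕ) {t : ℝ} (ht : t ∈ D.I) {α C : ℝ}
    (hα : 0 ≤ α) (hα' : α ≤ D.b / 2) (hC : 0 ≤ C)
    (h : ∀ i < n, |iteratedDeriv (k+2) (c.w i) t| ≤ C * zz n i ^ (-α)) {i : ℕ} (hi : i < n) :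
    |iteratedDeriv k (c.F i) t| ≤ C * zz n i ^ (-α) := by
  have hz := zz_pos hn i
  have hb := D.hb
  have hk : 0 < D.kap n (i+1) := by
    have := D.kap_lt hn i; have := D.kap_nonneg n i; linarith
  have h1 : |D.kap n (i+1) * iteratedDeriv k (c.F i) t| ≤ (2 * C / D.b) * zz n i ^ (D.b - α) := by
    rw [c.flux_id k ht hi, abs_neg]
    refine (Finset.abs_sum_le_sum_abs _ _).trans ?_
    have e1 : ∀ j ∈ Finset.range (i+1), |(D.kap n (j+1) - D.kap n j) / D.b
        * iteratedDeriv (k+2) (c.w j) t| ≤ (2 * C / D.b) * ((((j+1 : ℕ) : ℝ) / n) ^ (D.b - α)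
          - ((j : ℝ) / n) ^ (D.b - α)) := by
      intro j hj
      have hj' : j < n := by have := Finset.mem_range.1 hj; omega
      have q := D.kap_lt hn j
      rw [abs_mul, abs_of_nonneg (div_nonneg (by linarith) (by linarith))]
      have r : ((j : ℝ) / n) < (((j+1 : ℕ) : ℝ) / n) := by
        have : (0:ℝ) < n := by positivity
        gcongr; push_cast; linarith
      have r2 := pow_ineq (by positivity) r D.bpos hα hα'
      calc _ ≤ (D.kap n (j+1) - D.kap n j) / D.b * (C * zz n j ^ (-α)) :=
            mul_le_mul_of_nonneg_left (h j hj') (div_nonneg (by linarith) (by linarith))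
        _ = (C / D.b) * ((D.kap n (j+1) - D.kap n j) * zz n j ^ (-α)) := by ring
        _ ≤ (C / D.b) * (2 * ((((j+1 : ℕ) : ℝ) / n) ^ (D.b - α) - ((j : ℝ) / n) ^ (D.b - α))) :=
            mul_le_mul_of_nonneg_left r2 (div_nonneg hC (by linarith))
        _ = _ := by ring
    refine (Finset.sum_le_sum e1).trans ?_
    rw [← Finset.mul_sum, Finset.sum_range_sub (fun j : ℕ => ((j : ℝ) / n) ^ (D.b - α))]
    simp only [Nat.cast_zero, zero_div]
    rw [Real.zero_rpow (by linarith), sub_zero]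
    rfl
  have h2 : zz n i ^ (D.b - α) = D.kap n (i+1) * zz n i ^ (-α) := by
    rw [show D.b - α = D.b + -α by ring, Real.rpow_add hz]; rfl
  rw [h2, abs_mul, abs_of_pos hk] at h1
  have h3 : D.kap n (i+1) * |iteratedDeriv k (c.F i) t|
      ≤ D.kap n (i+1) * ((2 * C / D.b) * zz n i ^ (-α)) := by linarith
  have h4 := le_of_mul_le_mul_left h3 hk
  refine h4.trans (mul_le_mul_of_nonneg_right ?_ (Real.rpow_nonneg hz.le _))
  rw [div_le_iff₀ (by linarith)]
  nlinarith

theorem Dat.VB (D : Dat) (J : ℕ) (A : ℝ) {α : ℝ} (hα : 0 ≤ α) (hα' : α ≤ D.b / 2) (K : ℕ)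
    (hK : K ≤ 2 * J)
    (hW : ∀ k ≤ K + 2, D.UB J A (fun _ _ c i t => iteratedDeriv k (c.w i) t) α) :
    ∀ k ≤ K, D.UB J A (fun _ _ c i t => iteratedDeriv k (c.V i) t) α := by
  intro k
  induction k using Nat.strong_induction_on with
  | _ k ih =>
  intro hk
  have ih' : ∀ j, ∃ C, 0 ≤ C ∧ (j < k → ∀ ε : ℝ, ε ≠ 0 → |ε| ≤ 1 → ∀ n : ℕ, 0 < n →
      ∀ c : Chain D ε n, ∀ t1 ∈ D.J, c.Hyp J A t1 →
      ∀ t ∈ Icc (-1) t1, ∀ i < n, |iteratedDeriv j (c.V i) t| ≤ C * zz n i ^ (-α)) := by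
    intro j
    by_cases hj : j < k
    · obtain ⟨C, h0, hC⟩ := ih j hj (by omega)
      exact ⟨C, h0, fun _ => hC⟩
    · exact ⟨0, le_rfl, fun h => absurd h hj⟩
  choose B hB0 hB using ih'
  obtain ⟨C, hC0, hC⟩ := D.tame J A
  obtain ⟨C2, hC20, hC2⟩ := hW (k+2) (by omega)
  have hS : 0 ≤ ∑ j ∈ Finset.range k, B j := Finset.sum_nonneg fun j _ => hB0 j
  refine ⟨2 * C2 + 2 * (C * (1 + ∑ j ∈ Finset.range k, B j)), by positivity, ?_⟩
  intro ε h0 h1 n hn c t1 ht1 hH t ht i hi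
  have htJ : t ∈ D.J := ⟨ht.1, ht.2.trans ht1.2⟩
  have hz := zz_pos hn i
  have hz1 : 1 ≤ zz n i ^ (-α) :=
    Real.one_le_rpow_of_pos_of_le_one_of_nonpos hz (zz_mem hi).2 (by linarith)
  have f1 := c.F_bound hn k (D.J_sub htJ) hα hα' hC20
    (fun i hi => hC2 ε h0 h1 n hn c t1 ht1 hH t ht i hi) hi
  have f2 := hC ε h0 h1 (zz n i) (zz_mem hi) t htJ (c.V i) (c.V_s i) (hH t ht i hi) k (by omega)
  have f3 : sl k (c.V i) t ≤ (∑ j ∈ Finset.range k, B j) * zz n i ^ (-α) := by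
    unfold sl
    rw [Finset.sum_mul]
    exact Finset.sum_le_sum fun j hj =>
      hB j (Finset.mem_range.1 hj) ε h0 h1 n hn c t1 ht1 hH t ht i hi
  have f4 := D.cc_le ε (zz n i) (c.V i) t
  rw [c.F_iter] at f1
  set v := iteratedDeriv k (c.V i) t
  set q := iteratedDeriv k (D.qq ε (zz n i) (c.V i)) t
  set cc := D.cc ε (zz n i) (c.V i) t
  have f5 : |v| ≤ |v + q| + |q - cc * v| + |cc * v| := by
    have : v = (v + q) - (q - cc * v) - cc * v := by ring
    calc |v| = |(v + q) - (q - cc * v) - cc * v| := by rw [← this]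
      _ ≤ |(v + q) - (q - cc * v)| + |cc * v| := abs_sub _ _
      _ ≤ _ := by linarith [abs_sub (v + q) (q - cc * v)]
  have f6 : |cc * v| ≤ 1/2 * |v| := by
    rw [abs_mul]; exact mul_le_mul_of_nonneg_right f4 (abs_nonneg _)
  have f7 : C * (1 + sl k (c.V i) t) ≤
      C * ((1 + ∑ j ∈ Finset.range k, B j) * zz n i ^ (-α)) := by
    refine mul_le_mul_of_nonneg_left ?_ hC0
    linarith
  show |v| ≤ _
  linarith

theorem sum_inv_sqrt (n : ℕ) : ∑ j ∈ Finset.range n, (1 / √((j+1 : ℕ) : ℝ)) ≤ 2 * √(n:ℝ) := by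
  induction n with
  | zero => simp
  | succ n ih =>
    rw [Finset.sum_range_succ]
    have h1 : (0:ℝ) < √((n+1 : ℕ) : ℝ) := by positivity
    have h2 := Real.sqrt_nonneg (n:ℝ)
    have h3 : √((n+1 : ℕ) : ℝ) ^ 2 = n + 1 := by rw [Real.sq_sqrt (by positivity)]; push_cast; ring
    have h4 : √(n : ℝ) ^ 2 = n := Real.sq_sqrt (by positivity)
    have : 1 / √((n+1 : ℕ) : ℝ) ≤ 2 * √((n+1 : ℕ) : ℝ) - 2 * √(n:ℝ) := by
      rw [div_le_iff₀ h1]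
      nlinarith [sq_nonneg (√((n+1 : ℕ) : ℝ) - √(n:ℝ))]
    linarith

theorem Dat.WB_step (D : Dat) (J : ℕ) (A : ℝ) {α : ℝ} {k : ℕ}
    (hV : D.UB J A (fun _ _ c i t => iteratedDeriv k (c.V i) t) α) :
    D.UB J A (fun _ _ c i t => iteratedDeriv k (c.w i) t) (max (α - 1/2) 0) := by
  obtain ⟨C, hC0, hC⟩ := hV
  refine ⟨2 * C, by positivity, ?_⟩
  intro ε h0 h1 n hn c t1 ht1 hH t ht i hi
  have hn' : (0:ℝ) < n := by positivity
  set β := max (α - 1/2) 0 with hβ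
  have hβ0 : 0 ≤ β := le_max_right _ _
  have hβ1 : α ≤ 1/2 + β := by have := le_max_left (α - 1/2) 0; linarith
  have hz := zz_pos hn i
  show |iteratedDeriv k (c.w i) t| ≤ _
  rw [c.w_sum hn k t hi.le, abs_mul, abs_of_pos (by positivity)]
  have h2 : |∑ j ∈ Finset.Ico i n, iteratedDeriv k (c.V j) t|
      ≤ ∑ j ∈ Finset.Ico i n, (C * zz n i ^ (-β) * √(n:ℝ)) * (1 / √((j+1 : ℕ) : ℝ)) := by
    refine (Finset.abs_sum_le_sum_abs _ _).trans (Finset.sum_le_sum fun j hj => ?_)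
    obtain ⟨hj1, hj2⟩ := Finset.mem_Ico.1 hj
    have hzj := zz_pos hn j
    refine (hC ε h0 h1 n hn c t1 ht1 hH t ht j hj2).trans ?_
    have e1 : zz n j ^ (-α) ≤ zz n j ^ (-(1/2 : ℝ)) * zz n j ^ (-β) := by
      rw [← Real.rpow_add hzj]
      exact Real.rpow_le_rpow_of_exponent_ge hzj (zz_mem hj2).2 (by linarith)
    have e2 : zz n j ^ (-β) ≤ zz n i ^ (-β) :=
      Real.rpow_le_rpow_of_nonpos hz (zz_mono hj1) (by linarith)
    have e3 : zz n j ^ (-(1/2 : ℝ)) = √(n:ℝ) * (1 / √((j+1 : ℕ) : ℝ)) := by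
      rw [Real.rpow_neg hzj.le, ← Real.sqrt_eq_rpow]
      unfold zz
      rw [Real.sqrt_div (by positivity)]
      field_simp
    have e4 : zz n j ^ (-α) ≤ (√(n:ℝ) * (1 / √((j+1 : ℕ) : ℝ))) * zz n i ^ (-β) := by
      rw [← e3]
      exact e1.trans (mul_le_mul_of_nonneg_left e2 (Real.rpow_nonneg hzj.le _))
    calc _ ≤ C * ((√(n:ℝ) * (1 / √((j+1 : ℕ) : ℝ))) * zz n i ^ (-β)) := by gcongr
      _ = _ := by ring
  rw [← Finset.mul_sum] at h2
  have h3 : ∑ j ∈ Finset.Ico i n, (1 / √((j+1 : ℕ) : ℝ)) ≤ 2 * √(n:ℝ) := by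
    refine le_trans (Finset.sum_le_sum_of_subset_of_nonneg ?_ ?_) (sum_inv_sqrt n)
    · intro j hj
      exact Finset.mem_range.2 (Finset.mem_Ico.1 hj).2
    · intros; positivity
  have hp := Real.rpow_nonneg hz.le (-β)
  calc _ ≤ (1 / n : ℝ) * ((C * zz n i ^ (-β) * √(n:ℝ)) * (2 * √(n:ℝ))) := by gcongr; exact h2.trans (by gcongr)
    _ = (1 / n : ℝ) * (2 * C * zz n i ^ (-β)) * (√(n:ℝ) * √(n:ℝ)) := by ring
    _ = _ := by rw [Real.mul_self_sqrt hn'.le]; field_simp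

theorem Dat.WB_all (D : Dat) (J : ℕ) (hJ : 1 ≤ J) (A : ℝ) (m : ℕ) : ∀ k, k + 2 * m ≤ 2 * J →
    D.UB J A (fun _ _ c i t => iteratedDeriv k (c.w i) t) (max (D.b / 2 - m / 2) 0) := by
  have hb := D.hb
  induction m with
  | zero =>
    intro k hk
    have := D.WB_base J hJ A (k := k) (by omega)
    convert this using 1
    rw [max_eq_left (by push_cast; linarith)]; push_cast; ring
  | succ m ih =>
    intro k hk
    have h1 := D.VB J A (le_max_right (D.b / 2 - m / 2) 0)
      (max_le (by have : (0:ℝ) ≤ m := by positivity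
                  linarith) (by linarith)) k (by omega)
      (fun j hj => ih j (by omega)) k le_rfl
    have h2 := D.WB_step J A h1
    convert h2 using 1
    push_cast
    rcases le_total (D.b / 2 - m / 2) 0 with h | h
    · rw [max_eq_right h, max_eq_right (by linarith), max_eq_right (by linarith)]
    · rw [max_eq_left h]; congr 1; ring

/-- Loss of derivatives. -/
noncomputable def Dat.loss (D : Dat) : ℕ := 2 * ⌈D.b⌉₊ + 2

theorem Dat.step (D : Dat) (J : ℕ) (hJ : 1 ≤ J) (A : ℝ) : ∃ C, 0 ≤ C ∧
    ∀ ε : ℝ, ε ≠ 0 → |ε| ≤ 1 → ∀ n : ℕ, 0 < n → ∀ c : Chain D ε n, ∀ t1 ∈ D.J, c.Hyp J A t1 →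
    ∀ t ∈ Icc (-1) t1, ∀ i < n, ∀ k, k + D.loss ≤ 2 * J → |iteratedDeriv k (c.V i) t| ≤ C := by
  have hb := D.hb
  have h1 : ∀ k, ∃ C, 0 ≤ C ∧ (k + D.loss ≤ 2 * J → ∀ ε : ℝ, ε ≠ 0 → |ε| ≤ 1 → ∀ n : ℕ, 0 < n →
      ∀ c : Chain D ε n, ∀ t1 ∈ D.J, c.Hyp J A t1 →
      ∀ t ∈ Icc (-1) t1, ∀ i < n, |iteratedDeriv k (c.V i) t| ≤ C) := by
    intro k
    by_cases hk : k + D.loss ≤ 2 * J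
    · have e0 : max (D.b / 2 - (⌈D.b⌉₊ : ℝ) / 2) 0 = 0 :=
        max_eq_right (by linarith [Nat.le_ceil D.b])
      unfold Dat.loss at hk
      have := D.VB J A le_rfl (by linarith) k (by omega)
        (fun j hj => by
          have := D.WB_all J hJ A ⌈D.b⌉₊ j (by omega)
          rwa [e0] at this) k le_rfl
      obtain ⟨C, h0, hC⟩ := this
      refine ⟨C, h0, fun _ => ?_⟩
      intro ε h0 h1 n hn c t1 ht1 hH t ht i hi
      have := hC ε h0 h1 n hn c t1 ht1 hH t ht i hi
      simpa using this
    · exact ⟨0, le_rfl, fun h => absurd h hk⟩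
  choose B hB0 hB using h1
  refine ⟨∑ k ∈ Finset.range (2 * J + 1), B k, Finset.sum_nonneg fun k _ => hB0 k, ?_⟩
  intro ε h0 h1 n hn c t1 ht1 hH t ht i hi k hk
  refine (hB k hk ε h0 h1 n hn c t1 ht1 hH t ht i hi).trans ?_
  exact Finset.single_le_sum (f := B) (fun k _ => hB0 k) (Finset.mem_range.2 (by omega))


theorem cont_arg {f : ℝ → ℝ} {a b : ℝ} (hf : Continuous f)
    (h : ∀ t1 ∈ Icc a b, (∀ t ∈ Icc a t1, f t ≤ 1) → f t1 ≤ 1/2) (ha : f a ≤ 1/2) :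
    ∀ t ∈ Icc a b, f t ≤ 1 := by
  by_contra! hcon
  obtain ⟨t0, ht0, h0⟩ := hcon
  have hc : IsCompact (Icc a b ∩ f ⁻¹' Ici (3/4)) :=
    isCompact_Icc.inter_right (isClosed_Ici.preimage hf)
  obtain ⟨τ, hτ, hmin⟩ := hc.exists_isLeast ⟨t0, ht0, by simp only [mem_preimage, mem_Ici]; linarith⟩
  have hτ2 : (3/4 : ℝ) ≤ f τ := hτ.2
  have hlt : ∀ t ∈ Ico a τ, f t ≤ 3/4 := by
    intro t ht
    by_contra! hh
    have := hmin ⟨⟨ht.1, ht.2.le.trans hτ.1.2⟩, hh.le⟩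
    exact absurd ht.2 (not_lt.2 this)
  have haτ : a < τ := by
    rcases hτ.1.1.eq_or_lt with h | h
    · rw [← h] at hτ2; linarith
    · exact h
  have hle : ∀ t ∈ Icc a τ, f t ≤ 3/4 := by
    have : closure (Ico a τ) ⊆ {t | f t ≤ 3/4} :=
      closure_minimal hlt (isClosed_le hf continuous_const)
    rw [closure_Ico haτ.ne] at this
    exact this
  have := h τ hτ.1 fun t ht => (hle t ht).trans (by norm_num)
  linarith

theorem Dat.bootstrap (D : Dat) : ∃ ε0 : ℝ, 0 < ε0 ∧ ε0 ≤ 1 ∧ ∃ C, 0 ≤ C ∧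
    ∀ ε : ℝ, ε ≠ 0 → |ε| ≤ ε0 → ∀ n : ℕ, 0 < n → ∀ c : Chain D ε n, ∀ t ∈ D.J, ∀ i < n,
      ∀ k ≤ D.loss + 1, |iteratedDeriv k (c.V i) t| ≤ C := by
  obtain ⟨C, hC0, hC⟩ := D.step (D.loss + 1) (by omega) 1
  refine ⟨min 1 (1 / (2 * (C + 1))), by positivity, min_le_left _ _, C, hC0, ?_⟩
  intro ε h0 h1 n hn c
  have h2 : |ε| ≤ 1 := h1.trans (min_le_left _ _)
  have h3 : |ε| * C ≤ 1/2 := by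
    have : |ε| ≤ 1 / (2 * (C + 1)) := h1.trans (min_le_right _ _)
    calc |ε| * C ≤ 1 / (2 * (C + 1)) * C := by gcongr
      _ ≤ 1/2 := by
        rw [div_mul_eq_mul_div, div_le_div_iff₀ (by positivity) (by norm_num)]; linarith
  set f : ℝ → ℝ := fun t => ‖fun q : Fin n × Fin (D.loss + 2) =>
    ε * iteratedDeriv q.2 (c.V q.1) t‖ with hf
  have hfc : Continuous f := by
    refine continuous_norm.comp (continuous_pi fun q => continuous_const.mul ?_)
    exact (cd_iter (c.V_s _) _).continuous
  have hle : ∀ t r, 0 ≤ r → (f t ≤ r ↔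
      ∀ i < n, ∀ j ≤ D.loss + 1, |ε * iteratedDeriv j (c.V i) t| ≤ r) := by
    intro t r hr
    rw [hf]
    simp only
    rw [pi_norm_le_iff_of_nonneg hr]
    constructor
    · intro h i hi j hj
      exact h (⟨i, hi⟩, ⟨j, by omega⟩)
    · intro h q
      exact h q.1 q.1.2 q.2 (by have := q.2.2; omega)
  have key : ∀ t ∈ D.J, f t ≤ 1 := by
    refine cont_arg hfc ?_ ?_
    · intro t1 ht1 hh
      rw [hle _ _ (by norm_num)]
      intro i hi j hj
      have := hC ε h0 h2 n hn c t1 ht1 (fun t ht => (hle t 1 zero_le_one).1 (hh t ht)) t1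
        ⟨ht1.1, le_rfl⟩ i hi j (by omega)
      rw [abs_mul]
      exact (mul_le_mul_of_nonneg_left this (abs_nonneg _)).trans h3
    · rw [hle _ _ (by norm_num)]
      intro i hi j hj
      rw [c.V_m1]; norm_num
  intro t ht i hi k hk
  refine hC ε h0 h2 n hn c t ht (fun s hs => (hle s 1 zero_le_one).1
    (key s ⟨hs.1, hs.2.trans ht.2⟩)) t ⟨ht.1, le_rfl⟩ i hi k (by omega)

theorem Dat.bounds (D : Dat) : ∃ ε0 : ℝ, 0 < ε0 ∧ ε0 ≤ 1 ∧ ∀ J : ℕ, ∃ C, 0 ≤ C ∧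
    ∀ ε : ℝ, ε ≠ 0 → |ε| ≤ ε0 → ∀ n : ℕ, 0 < n → ∀ c : Chain D ε n, ∀ t ∈ D.J,
      ∀ k ≤ J, (∀ i < n, |iteratedDeriv k (c.V i) t| ≤ C) ∧
        ∀ i, |iteratedDeriv k (c.w i) t| ≤ C := by
  obtain ⟨ε0, h0, h1, C0, hC00, hC0⟩ := D.bootstrap
  refine ⟨ε0, h0, h1, ?_⟩
  have main : ∀ J : ℕ, ∃ C, 0 ≤ C ∧
    ∀ ε : ℝ, ε ≠ 0 → |ε| ≤ ε0 → ∀ n : ℕ, 0 < n → ∀ c : Chain D ε n, ∀ t ∈ D.J,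
      ∀ k ≤ J, (∀ i < n, |iteratedDeriv k (c.V i) t| ≤ C) := by
    intro J
    induction J with
    | zero => exact ⟨C0, hC00, fun ε e0 e1 n hn c t ht k hk i hi =>
        hC0 ε e0 e1 n hn c t ht i hi k (by omega)⟩
    | succ J ih =>
      by_cases hJ : J ≤ D.loss
      · exact ⟨C0, hC00, fun ε e0 e1 n hn c t ht k hk i hi =>
          hC0 ε e0 e1 n hn c t ht i hi k (by omega)⟩
      · obtain ⟨A, hA0, hA⟩ := ih
        obtain ⟨C, hC0, hC⟩ := D.step J (by omega) A
        refine ⟨C, hC0, ?_⟩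
        intro ε e0 e1 n hn c t ht k hk i hi
        refine hC ε e0 (e1.trans h1) n hn c t ht ?_ t ⟨ht.1, le_rfl⟩ i hi k (by omega)
        intro s hs i hi j hj
        rw [abs_mul]
        have := hA ε e0 e1 n hn c s ⟨hs.1, hs.2.trans ht.2⟩ j hj i hi
        nlinarith [abs_nonneg ε, abs_nonneg (iteratedDeriv j (c.V i) s)]
  intro J
  obtain ⟨C, hC0, hC⟩ := main J
  refine ⟨C, hC0, ?_⟩
  intro ε e0 e1 n hn c t ht k hk
  refine ⟨hC ε e0 e1 n hn c t ht k hk, fun i => ?_⟩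
  by_cases hi : i < n
  · rw [c.w_sum hn k t hi.le, abs_mul, abs_of_nonneg (by positivity)]
    have hn' : (0:ℝ) < n := by positivity
    have : |∑ j ∈ Finset.Ico i n, iteratedDeriv k (c.V j) t| ≤ n * C := by
      refine (Finset.abs_sum_le_sum_abs _ _).trans ?_
      refine (Finset.sum_le_sum fun j hj => hC ε e0 e1 n hn c t ht k hk j
        (Finset.mem_Ico.1 hj).2).trans ?_
      rw [Finset.sum_const, nsmul_eq_mul, Nat.card_Ico]
      gcongr
      exact Nat.sub_le _ _
    calc _ ≤ (1 / n : ℝ) * (n * C) := by gcongr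
      _ = C := by field_simp
  · rw [c.w_zero (by omega)]; simpa using hC0

end EulerNM

open MeasureTheory Real Set
open scoped ContDiff

/-! # Part 6: passage to the limit -/

namespace EulerNM

open Filter Topology

variable {D : Dat} {ε : ℝ} {n : ℕ}

theorem Dat.g_lip (D : Dat) (x y : ℝ) : |D.g x - D.g y| ≤ 1/2 * |x - y| := by
  have := Convex.norm_image_sub_le_of_norm_deriv_le (f := D.g) (s := univ) (C := 1/2)
    (x := y) (y := x) (fun x _ => D.g_s.differentiable (by simp) x) (fun x _ => D.g_d x)
    convex_univ (mem_univ _) (mem_univ _)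
  simpa using this

theorem Dat.p_lip (D : Dat) : ∃ L, 0 ≤ L ∧ ∀ t ∈ D.J, ∀ z ∈ Icc (0:ℝ) 1, ∀ z' ∈ Icc (0:ℝ) 1,
    |D.p t z - D.p t z'| ≤ L * |z - z'| := by
  have hc : Continuous (fderiv ℝ (fun q : ℝ × ℝ => D.p q.1 q.2)) :=
    D.p_s.continuous_fderiv (by simp)
  obtain ⟨L, hL⟩ := (isCompact_Icc.prod isCompact_Icc).exists_bound_of_continuousOn
    (s := D.J ×ˢ Icc (0:ℝ) 1) hc.continuousOn
  refine ⟨|L|, abs_nonneg _, fun t ht z hz z' hz' => ?_⟩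
  have := Convex.norm_image_sub_le_of_norm_fderiv_le (𝕜 := ℝ) (f := fun q : ℝ × ℝ => D.p q.1 q.2)
    (s := D.J ×ˢ Icc (0:ℝ) 1) (C := |L|) (x := (t, z')) (y := (t, z))
    (fun x _ => D.p_s.differentiable (by simp) x) (fun x hx => (hL x hx).trans (le_abs_self _))
    ((convex_Icc _ _).prod (convex_Icc _ _)) ⟨ht, hz'⟩ ⟨ht, hz⟩
  simpa [Prod.norm_def] using this

theorem Dat.Q_lipV (D : Dat) (h0 : ε ≠ 0) (t z V V' : ℝ) :
    |D.Q ε t z V - D.Q ε t z V'| ≤ 1/2 * |V - V'| := by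
  unfold Dat.Q
  rw [← mul_sub, ← mul_sub, abs_mul, abs_mul, abs_of_nonneg (D.chi0 t),
    abs_of_nonneg (by positivity : 0 ≤ (ε^2)⁻¹)]
  have h1 := D.g_lip (ε * (D.p t z + ε * V)) (ε * (D.p t z + ε * V'))
  have h2 : |ε * (D.p t z + ε * V) - ε * (D.p t z + ε * V')| = ε ^ 2 * |V - V'| := by
    rw [← abs_of_nonneg (sq_nonneg ε), ← abs_mul]; congr 1; ring
  rw [h2] at h1
  have h3 : 0 < ε ^ 2 := by positivity
  calc _ ≤ 1 * ((ε ^ 2)⁻¹ * (1/2 * (ε ^ 2 * |V - V'|))) := by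
        gcongr
        exact D.chi1 t
    _ = _ := by field_simp

theorem Dat.Pf_mono (D : Dat) (h0 : ε ≠ 0) (t z V V' : ℝ) :
    |V - V'| ≤ 2 * |D.Pf ε t z V - D.Pf ε t z V'| := by
  have h1 := D.Q_lipV h0 t z V V'
  unfold Dat.Pf
  have h2 : |V - V'| ≤ |V + D.Q ε t z V - (V' + D.Q ε t z V')| + |D.Q ε t z V - D.Q ε t z V'| := by
    have := abs_sub (V + D.Q ε t z V - (V' + D.Q ε t z V')) (D.Q ε t z V - D.Q ε t z V')
    have e : (V + D.Q ε t z V - (V' + D.Q ε t z V')) - (D.Q ε t z V - D.Q ε t z V') = V - V' := by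
      ring
    rwa [e] at this
  linarith

theorem Dat.Q_lipz (D : Dat) (ε : ℝ) : ∃ L, 0 ≤ L ∧ ∀ t ∈ D.J, ∀ z ∈ Icc (0:ℝ) 1,
    ∀ z' ∈ Icc (0:ℝ) 1, ∀ V, |D.Pf ε t z V - D.Pf ε t z' V| ≤ L * |z - z'| := by
  obtain ⟨L, hL0, hL⟩ := D.p_lip
  refine ⟨(ε^2)⁻¹ * (1/2 * (|ε| * L)), by positivity, fun t ht z hz z' hz' V => ?_⟩
  unfold Dat.Pf Dat.Q
  rw [add_sub_add_left_eq_sub, ← mul_sub, ← mul_sub, abs_mul, abs_mul, abs_of_nonneg (D.chi0 t),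
    abs_of_nonneg (by positivity : 0 ≤ (ε^2)⁻¹)]
  have h1 := D.g_lip (ε * (D.p t z + ε * V)) (ε * (D.p t z' + ε * V))
  have h2 : |ε * (D.p t z + ε * V) - ε * (D.p t z' + ε * V)| = |ε| * |D.p t z - D.p t z'| := by
    rw [← abs_mul]; congr 1; ring
  rw [h2] at h1
  calc _ ≤ 1 * ((ε ^ 2)⁻¹ * (1/2 * (|ε| * (L * |z - z'|)))) := by
        gcongr
        · exact D.chi1 t
        · refine h1.trans ?_
          gcongr
          exact hL t ht z hz z' hz'
    _ = _ := by ring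

theorem Chain.F_eq (c : Chain D ε n) (i : ℕ) (t : ℝ) :
    c.F i t = D.Pf ε t (zz n i) (c.V i t) := rfl

/-- Lipschitz in the space index. -/
theorem Chain.w_lip (c : Chain D ε n) (hn : 0 < n) (k : ℕ) (t : ℝ) {C : ℝ}
    (h : ∀ i < n, |iteratedDeriv k (c.V i) t| ≤ C) {i j : ℕ} (hij : i ≤ j) (hj : j ≤ n) :
    |iteratedDeriv k (c.w i) t - iteratedDeriv k (c.w j) t| ≤ C * (((j:ℝ) - i) / n) := by
  have hn' : (0:ℝ) < n := by positivity
  induction j, hij using Nat.le_induction with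
  | base => simp
  | succ j hij ih =>
    have h1 := ih (by omega)
    have h2 := h j (by omega)
    rw [c.V_iter, abs_mul, abs_of_pos hn'] at h2
    have h3 : |iteratedDeriv k (c.w j) t - iteratedDeriv k (c.w (j+1)) t| ≤ C / n := by
      rw [le_div_iff₀ hn']; linarith
    have h4 := abs_sub_le (iteratedDeriv k (c.w i) t) (iteratedDeriv k (c.w j) t)
      (iteratedDeriv k (c.w (j+1)) t)
    refine h4.trans ((add_le_add h1 h3).trans (le_of_eq ?_))
    push_cast; field_simp; ring

/-- Taylor in time. -/
theorem taylor_le {f : ℝ → ℝ} (hf : ContDiff ℝ ∞ f) (k : ℕ) {S : Set ℝ} (hS : Convex ℝ S) {C : ℝ}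
    (h : ∀ t ∈ S, |iteratedDeriv (k+2) f t| ≤ C) {s t : ℝ} (hs : s ∈ S) (ht : t ∈ S) :
    |iteratedDeriv k f t - iteratedDeriv k f s - (t - s) * iteratedDeriv (k+1) f s|
      ≤ C * (t - s) ^ 2 := by
  have h1 : ∀ τ ∈ S, |iteratedDeriv (k+1) f τ - iteratedDeriv (k+1) f s| ≤ C * |τ - s| :=
    fun τ hτ => Convex.norm_image_sub_le_of_norm_hasDerivWithin_le
      (fun x _ => (cd_hasDerivAt hf (k+1) x).hasDerivWithinAt) (fun x hx => h x hx) hS hs hτ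
  have hC : 0 ≤ C := (abs_nonneg _).trans (h s hs)
  have h2 := Convex.norm_image_sub_le_of_norm_hasDerivWithin_le
    (f := fun τ => iteratedDeriv k f τ - τ * iteratedDeriv (k+1) f s)
    (f' := fun τ => iteratedDeriv (k+1) f τ - 1 * iteratedDeriv (k+1) f s)
    (s := segment ℝ s t) (x := s) (y := t) (C := C * |t - s|)
    (fun x _ => ((cd_hasDerivAt hf k x).sub
      ((hasDerivAt_id x).mul_const _)).hasDerivWithinAt)
    (fun x hx => by
      rw [one_mul]
      refine (h1 x (hS.segment_subset hs ht hx)).trans ?_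
      rw [segment_eq_uIcc] at hx
      exact mul_le_mul_of_nonneg_left (abs_sub_left_of_mem_uIcc hx) hC) (convex_segment _ _)
    (left_mem_segment _ _ _) (right_mem_segment _ _ _)
  rw [Real.norm_eq_abs, Real.norm_eq_abs, mul_assoc, ← sq, sq_abs] at h2
  convert h2 using 2
  ring

theorem Dat.kap_mono (D : Dat) (n : ℕ) {i j : ℕ} (h : i ≤ j) : D.kap n i ≤ D.kap n j := by
  unfold Dat.kap
  have := D.bpos
  gcongr

/-- Flux increments. -/
theorem Chain.flux_inc (c : Chain D ε n) (hn : 0 < n) {t : ℝ} (ht : t ∈ D.J) {C : ℝ}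
    (h : ∀ i < n, |iteratedDeriv 2 (c.V i) t| ≤ C) {i j : ℕ} (hij : i ≤ j) (hj : j < n) :
    |D.kap n (j+1) * c.F j t - D.kap n (i+1) * c.F i t
      + (D.kap n (j+1) - D.kap n (i+1)) / D.b * iteratedDeriv 2 (c.w i) t|
      ≤ (D.kap n (j+1) - D.kap n (i+1)) * (C * (((j:ℝ) - i) / n)) := by
  have hn' : (0:ℝ) < n := by positivity
  have hb := D.hb
  induction j, hij using Nat.le_induction with
  | base => simp
  | succ j hij ih =>
    have h1 := ih (by omega)
    have h2 := c.eqn_iter 0 hj (D.J_sub ht)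
    simp only [iteratedDeriv_zero, Nat.add_sub_cancel, zero_add] at h2
    have h3 := c.w_lip hn 2 t h (show i ≤ j + 1 by omega) (by omega)
    have k1 := D.kap_lt hn (j+1)
    have k2 := D.kap_mono n (show i + 1 ≤ j + 1 by omega)
    have hC : 0 ≤ C := (abs_nonneg _).trans (h j (by omega))
    have ij : (i:ℝ) ≤ j := by exact_mod_cast hij
    set a := D.kap n (j+1+1) - D.kap n (j+1)
    have e : D.kap n (j+1+1) * c.F (j+1) t - D.kap n (i+1) * c.F i t
      + (D.kap n (j+1+1) - D.kap n (i+1)) / D.b * iteratedDeriv 2 (c.w i) t =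
      (D.kap n (j+1) * c.F j t - D.kap n (i+1) * c.F i t
      + (D.kap n (j+1) - D.kap n (i+1)) / D.b * iteratedDeriv 2 (c.w i) t) +
      a / D.b * (iteratedDeriv 2 (c.w i) t - iteratedDeriv 2 (c.w (j+1)) t) := by
      rw [mul_sub (a / D.b), h2]; ring
    rw [e]
    refine (abs_add_le _ _).trans ?_
    have a0 : 0 ≤ a := by simp only [a]; linarith
    have h4 : |a / D.b * (iteratedDeriv 2 (c.w i) t - iteratedDeriv 2 (c.w (j+1)) t)| ≤
        a * (C * ((((j+1 : ℕ):ℝ) - i) / n)) := by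
      rw [abs_mul, abs_of_nonneg (by positivity)]
      refine mul_le_mul ?_ h3 (abs_nonneg _) a0
      exact div_le_self a0 (by linarith)
    have h5 : (D.kap n (j+1) - D.kap n (i+1)) * (C * (((j:ℝ) - i) / n)) ≤
        (D.kap n (j+1) - D.kap n (i+1)) * (C * ((((j+1 : ℕ):ℝ) - i) / n)) := by
      refine mul_le_mul_of_nonneg_left ?_ (by linarith)
      push_cast
      gcongr
      linarith
    have : D.kap n (j+1+1) - D.kap n (i+1) = (D.kap n (j+1) - D.kap n (i+1)) + a := by
      simp only [a]; ring
    rw [this, add_mul]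
    linarith

theorem Dat.kap_lip (D : Dat) {n : ℕ} (hn : 0 < n) {i j : ℕ} (hij : i ≤ j) (hj : j ≤ n) :
    D.kap n j - D.kap n i ≤ D.b * (((j:ℝ) - i) / n) := by
  have hn' : (0:ℝ) < n := by positivity
  have hb := D.hb
  have := Convex.norm_image_sub_le_of_norm_hasDerivWithin_le (f := fun x : ℝ => x ^ D.b)
    (f' := fun x => D.b * x ^ (D.b - 1)) (s := Icc 0 1) (x := (i:ℝ)/n) (y := (j:ℝ)/n) (C := D.b)
    (fun x _ => (Real.hasDerivAt_rpow_const (Or.inr (by linarith))).hasDerivWithinAt)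
    (fun x hx => by
      rw [Real.norm_eq_abs, abs_of_nonneg (mul_nonneg (by linarith) (Real.rpow_nonneg hx.1 _))]
      have := Real.rpow_le_one hx.1 hx.2 (show 0 ≤ D.b - 1 by linarith)
      nlinarith) (convex_Icc 0 1)
    ⟨by positivity, (div_le_one hn').2 (by exact_mod_cast hij.trans hj)⟩
    ⟨by positivity, (div_le_one hn').2 (by exact_mod_cast hj)⟩
  have e : (j:ℝ)/n - (i:ℝ)/n = ((j:ℝ) - i)/n := by ring
  rw [e, Real.norm_eq_abs, Real.norm_eq_abs, abs_of_nonneg (a := ((j:ℝ) - i)/n)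
    (div_nonneg (sub_nonneg.2 (by exact_mod_cast hij)) hn'.le)] at this
  exact (le_abs_self _).trans this

/-- Strain increments. -/
theorem Dat.V_inc (D : Dat) (ε : ℝ) (h0 : ε ≠ 0) {C : ℝ} (hC : 0 ≤ C) : ∃ L, 0 ≤ L ∧
    ∀ n : ℕ, 0 < n → ∀ c : Chain D ε n, ∀ t ∈ D.J,
    (∀ i < n, |c.V i t| ≤ C) → (∀ i < n, |iteratedDeriv 2 (c.V i) t| ≤ C) →
    (∀ i, |iteratedDeriv 2 (c.w i) t| ≤ C) → ∀ i j : ℕ, i ≤ j → j < n →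
    |c.V j t - c.V i t| ≤ L * (((j:ℝ) - i) / n) / D.kap n (i+1) := by
  obtain ⟨L, hL0, hL⟩ := D.Q_lipz ε
  obtain ⟨M, hM0, hM⟩ := D.Q_bound ε
  have hb := D.hb
  refine ⟨2 * (D.b * (C + (C + (C + M))) + L), by positivity, ?_⟩
  intro n hn c t ht hV hV2 hw i j hij hj
  have hn' : (0:ℝ) < n := by positivity
  have h1 := c.flux_inc hn ht hV2 hij hj
  have h2 := D.kap_lip hn (show i + 1 ≤ j + 1 by omega) hj
  have ij : (i:ℝ) ≤ j := by exact_mod_cast hij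
  have jn : (j:ℝ) ≤ n := by exact_mod_cast hj.le
  set δ := ((j:ℝ) - i) / n with hδ
  have hδ0 : 0 ≤ δ := div_nonneg (by linarith) hn'.le
  have hδ1 : δ ≤ 1 := (div_le_one hn').2 (by have : (0:ℝ) ≤ i := by positivity
                                             linarith)
  have e2 : (((j+1:ℕ):ℝ) - ((i+1:ℕ):ℝ)) / n = δ := by rw [hδ]; push_cast; ring
  rw [e2] at h2
  have k0 : 0 < D.kap n (i+1) := by have := D.kap_lt hn i; have := D.kap_nonneg n i; linarith
  have k1 := D.kap_le_one (show i + 1 ≤ n by omega)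
  have k2 := D.kap_mono n (show i + 1 ≤ j + 1 by omega)
  have hF : |c.F i t| ≤ C + M := by
    rw [c.F_eq]
    exact (abs_add_le _ _).trans (add_le_add (hV i (by omega)) (hM _ _ _))
  set a := D.kap n (j+1) - D.kap n (i+1) with ha
  have a0 : 0 ≤ a := by linarith
  have hw2 := hw i
  have h3 : |D.kap n (j+1) * (c.F j t - c.F i t)| ≤ a * (C + (C + (C + M))) := by
    have e : D.kap n (j+1) * (c.F j t - c.F i t) = (D.kap n (j+1) * c.F j t
      - D.kap n (i+1) * c.F i t + a / D.b * iteratedDeriv 2 (c.w i) t)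
      - a / D.b * iteratedDeriv 2 (c.w i) t - a * c.F i t := by rw [ha]; ring
    rw [e]
    have r1 : |a / D.b * iteratedDeriv 2 (c.w i) t| ≤ a * C := by
      rw [abs_mul, abs_of_nonneg (by positivity)]
      exact mul_le_mul (div_le_self a0 (by linarith)) hw2 (abs_nonneg _) a0
    have r2 : |a * c.F i t| ≤ a * (C + M) := by
      rw [abs_mul, abs_of_nonneg a0]; gcongr
    have r3 : a * (C * δ) ≤ a * C := by
      refine mul_le_mul_of_nonneg_left ?_ a0
      nlinarith
    have s1 := abs_sub ((D.kap n (j+1) * c.F j t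
      - D.kap n (i+1) * c.F i t + a / D.b * iteratedDeriv 2 (c.w i) t)
      - a / D.b * iteratedDeriv 2 (c.w i) t) (a * c.F i t)
    have s2 := abs_sub (D.kap n (j+1) * c.F j t
      - D.kap n (i+1) * c.F i t + a / D.b * iteratedDeriv 2 (c.w i) t)
      (a / D.b * iteratedDeriv 2 (c.w i) t)
    linarith
  have h4 : D.kap n (i+1) * |c.F j t - c.F i t| ≤ D.b * (C + (C + (C + M))) * δ := by
    rw [abs_mul, abs_of_nonneg (by linarith)] at h3
    calc _ ≤ D.kap n (j+1) * |c.F j t - c.F i t| := by gcongr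
      _ ≤ a * (C + (C + (C + M))) := h3
      _ ≤ (D.b * δ) * (C + (C + (C + M))) := by gcongr
      _ = _ := by ring
  have h5 := D.Pf_mono h0 t (zz n j) (c.V j t) (c.V i t)
  have h6 := hL t ht (zz n i) (zz_mem (by omega)) (zz n j) (zz_mem hj) (c.V i t)
  have e3 : |zz n i - zz n j| = δ := by
    rw [abs_sub_comm, abs_of_nonneg (sub_nonneg.2 (zz_mono hij))]
    unfold zz; rw [← e2]; ring
  rw [e3] at h6
  have h7 : |D.Pf ε t (zz n j) (c.V j t) - D.Pf ε t (zz n j) (c.V i t)| ≤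
      |c.F j t - c.F i t| + L * δ := by
    rw [c.F_eq, c.F_eq]
    exact (abs_sub_le _ (D.Pf ε t (zz n i) (c.V i t)) _).trans (by linarith)
  rw [le_div_iff₀ k0]
  calc |c.V j t - c.V i t| * D.kap n (i+1) ≤ (2 * (|c.F j t - c.F i t| + L * δ)) * D.kap n (i+1) :=
        mul_le_mul_of_nonneg_right (by linarith) k0.le
    _ = 2 * (D.kap n (i+1) * |c.F j t - c.F i t|) + 2 * (L * δ) * D.kap n (i+1) := by ring
    _ ≤ 2 * (D.b * (C + (C + (C + M))) * δ) + 2 * (L * δ) * 1 := by gcongr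
    _ = _ := by ring

/-- Displacement increments. -/
theorem Chain.w_inc (c : Chain D ε n) (hn : 0 < n) (t : ℝ) {i : ℕ} {X : ℝ} : ∀ {j : ℕ}, i ≤ j →
    (∀ l, i ≤ l → l < j → |c.V l t - c.V i t| ≤ X) →
    |c.w i t - c.w j t - ((j:ℝ) - i) / n * c.V i t| ≤ ((j:ℝ) - i) / n * X := by
  intro j hij
  have hn' : (0:ℝ) < n := by positivity
  induction j, hij using Nat.le_induction with
  | base => intro _; simp
  | succ j hij ih =>
    intro h
    have h1 := ih (fun l h1 h2 => h l h1 (by omega))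
    have h2 := h j hij (by omega)
    have e : c.w j t - c.w (j+1) t = c.V j t / n := by
      simp only [Chain.V, VV]; field_simp
    have e1 : c.w i t - c.w (j+1) t - (((j+1:ℕ):ℝ) - i) / n * c.V i t =
      (c.w i t - c.w j t - ((j:ℝ) - i) / n * c.V i t) + (c.V j t - c.V i t) / n := by
      rw [sub_div (c.V j t), ← e]; push_cast; ring
    rw [e1]
    refine (abs_add_le _ _).trans ?_
    rw [abs_div, abs_of_pos hn']
    have : |c.V j t - c.V i t| / n ≤ X / n := by gcongr
    have e2 : (((j+1:ℕ):ℝ) - i) / n * X = ((j:ℝ) - i) / n * X + X / n := by push_cast; ring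
    linarith


theorem ulim_exists {a : ℕ → ℝ} {C : ℝ} (h : ∀ n, |a n| ≤ C) :
    ∃ L, Tendsto a (hyperfilter ℕ : Filter ℕ) (𝓝 L) := by
  obtain ⟨L, _, hL⟩ := (isCompact_Icc (a := -C) (b := C)).ultrafilter_le_nhds
    ((hyperfilter ℕ).map a) (by
      rw [Ultrafilter.coe_map]
      refine tendsto_principal.2 (Eventually.of_forall fun n => abs_le.1 (h n)))
  exact ⟨L, hL⟩

/-- discrete index of a point -/
noncomputable def ix (n : ℕ) (z : ℝ) : ℕ := ⌊z * ((n + 1 : ℕ) : ℝ)⌋₊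

theorem ix_lt {n : ℕ} {z : ℝ} (h0 : 0 ≤ z) (h : z < 1) : ix n z < n + 1 := by
  unfold ix
  rw [Nat.floor_lt (by positivity)]
  have : (0:ℝ) < ((n + 1 : ℕ) : ℝ) := by positivity
  nlinarith

theorem ix_le {n : ℕ} {z : ℝ} (h : z ≤ 1) : ix n z ≤ n + 1 := by
  unfold ix
  refine Nat.floor_le_of_le ?_
  have : (0:ℝ) < ((n + 1 : ℕ) : ℝ) := by positivity
  nlinarith

theorem ix_mono {n : ℕ} {z z' : ℝ} (h : z ≤ z') : ix n z ≤ ix n z' := by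
  unfold ix
  gcongr

theorem ix_lim {z : ℝ} (h : 0 ≤ z) :
    Tendsto (fun n => (ix n z : ℝ) / ((n + 1 : ℕ) : ℝ)) (hyperfilter ℕ : Filter ℕ) (𝓝 z) := by
  have h1 := (tendsto_nat_floor_mul_div_atTop h).comp
    ((tendsto_natCast_atTop_atTop (R := ℝ)).comp (tendsto_add_atTop_nat 1))
  exact h1.mono_left Nat.hyperfilter_le_atTop

theorem ix_lim1 {z : ℝ} (h : 0 ≤ z) :
    Tendsto (fun n => zz (n+1) (ix n z)) (hyperfilter ℕ : Filter ℕ) (𝓝 z) := by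
  have h1 := ix_lim h
  have h2 : Tendsto (fun n : ℕ => 1 / ((n + 1 : ℕ) : ℝ)) (hyperfilter ℕ : Filter ℕ) (𝓝 0) := by
    have := tendsto_one_div_add_atTop_nhds_zero_nat (𝕜 := ℝ)
    refine (this.mono_left Nat.hyperfilter_le_atTop).congr fun n => ?_
    push_cast; rfl
  have := h1.add h2
  rw [add_zero] at this
  refine this.congr fun n => ?_
  unfold zz
  push_cast; ring

theorem ix_lim2 {z z' : ℝ} (h : 0 ≤ z) (h' : 0 ≤ z') :
    Tendsto (fun n => ((ix n z : ℝ) - ix n z') / ((n + 1 : ℕ) : ℝ)) (hyperfilter ℕ : Filter ℕ)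
      (𝓝 (z - z')) :=
  ((ix_lim h).sub (ix_lim h')).congr fun n => by ring

theorem Dat.kap_lim (D : Dat) {z : ℝ} (h : 0 ≤ z) :
    Tendsto (fun n => D.kap (n+1) (ix n z + 1)) (hyperfilter ℕ : Filter ℕ) (𝓝 (z ^ D.b)) := by
  have := (Real.continuousAt_rpow_const z D.b (Or.inr D.bpos.le)).tendsto.comp (ix_lim1 h)
  exact this

/-- The limit solution: pointwise information. -/
structure Dat.Lim (D : Dat) (ε C : ℝ) (W : ℕ → ℝ → ℝ → ℝ) (V : ℝ → ℝ → ℝ) : Prop where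
  time : ∀ k, ∃ L, 0 ≤ L ∧ ∀ s ∈ D.J, ∀ t ∈ D.J, ∀ z ∈ Icc (0:ℝ) 1,
    |W k t z - W k s z - (t - s) * W (k+1) s z| ≤ L * (t - s) ^ 2
  space : ∀ k, ∃ L, 0 ≤ L ∧ ∀ t ∈ D.J, ∀ z ∈ Icc (0:ℝ) 1, ∀ z' ∈ Icc (0:ℝ) 1,
    |W k t z - W k t z'| ≤ L * |z - z'|
  bdry : ∀ k, ∀ t ∈ D.J, W k t 1 = 0
  bdd : ∀ k, ∃ L, 0 ≤ L ∧ ∀ t ∈ D.J, ∀ z ∈ Icc (0:ℝ) 1, |W k t z| ≤ L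
  W_le : ∀ t ∈ D.J, ∀ z ∈ Icc (0:ℝ) 1, |W 0 t z| ≤ C
  V_le : ∀ t ∈ D.J, ∀ z ∈ Ico (0:ℝ) 1, |V t z| ≤ C
  flux : ∃ L, 0 ≤ L ∧ ∀ t ∈ D.J, ∀ z' ∈ Ico (0:ℝ) 1, ∀ z ∈ Ico (0:ℝ) 1, z' ≤ z →
    |z ^ D.b * D.Pf ε t z (V t z) - z' ^ D.b * D.Pf ε t z' (V t z')
      + (z ^ D.b - z' ^ D.b) / D.b * W 2 t z'| ≤ (z ^ D.b - z' ^ D.b) * (L * (z - z'))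
  strain : ∃ L, 0 ≤ L ∧ ∀ t ∈ D.J, ∀ z' ∈ Ioo (0:ℝ) 1, ∀ z ∈ Ico (0:ℝ) 1, z' ≤ z →
    |W 0 t z' - W 0 t z - (z - z') * V t z'| ≤ (z - z') * (L * (z - z') / z' ^ D.b)

theorem Dat.limit (D : Dat) : ∃ ε0 : ℝ, 0 < ε0 ∧ ε0 ≤ 1 ∧ ∃ C, 0 ≤ C ∧
    ∀ ε : ℝ, ε ≠ 0 → |ε| ≤ ε0 → ∃ W V, D.Lim ε C W V := by
  obtain ⟨ε0, h0, h1, hb⟩ := D.bounds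
  choose B hB0 hB using hb
  refine ⟨ε0, h0, h1, B 0, hB0 0, ?_⟩
  intro ε e0 e1
  have hc : ∀ n : ℕ, ∃ c : Chain D ε (n+1), True := fun n =>
    ⟨(D.chain_exists ε (n+1) (Nat.succ_pos n)).some, trivial⟩
  choose c _ using hc
  have bw : ∀ k n, ∀ t ∈ D.J, ∀ i, |iteratedDeriv k ((c n).w i) t| ≤ B k := fun k n t ht i =>
    (hB k ε e0 e1 (n+1) (Nat.succ_pos n) (c n) t ht k le_rfl).2 i
  have bV : ∀ k n, ∀ t ∈ D.J, ∀ i < n + 1, |iteratedDeriv k ((c n).V i) t| ≤ B k :=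
    fun k n t ht => (hB k ε e0 e1 (n+1) (Nat.succ_pos n) (c n) t ht k le_rfl).1
  have hW : ∀ (k : ℕ) (t z : ℝ), ∃ L : ℝ, t ∈ D.J → Tendsto
      (fun n => iteratedDeriv k ((c n).w (ix n z)) t) (hyperfilter ℕ : Filter ℕ) (𝓝 L) := by
    intro k t z
    by_cases ht : t ∈ D.J
    · obtain ⟨L, hL⟩ := ulim_exists (a := fun n => iteratedDeriv k ((c n).w (ix n z)) t)
        (fun n => bw k n t ht _)
      exact ⟨L, fun _ => hL⟩
    · exact ⟨0, fun h => absurd h ht⟩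
  have hV : ∀ (t z : ℝ), ∃ L : ℝ, t ∈ D.J → z ∈ Ico (0:ℝ) 1 → Tendsto
      (fun n => (c n).V (ix n z) t) (hyperfilter ℕ : Filter ℕ) (𝓝 L) := by
    intro t z
    by_cases ht : t ∈ D.J ∧ z ∈ Ico (0:ℝ) 1
    · obtain ⟨L, hL⟩ := ulim_exists (a := fun n => (c n).V (ix n z) t)
        (C := B 0) (fun n => by
          have := bV 0 n t ht.1 _ (ix_lt ht.2.1 ht.2.2)
          simpa using this)
      exact ⟨L, fun _ _ => hL⟩
    · exact ⟨0, fun h h' => absurd ⟨h, h'⟩ ht⟩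
  choose W hW using hW
  choose V hV using hV
  have hW0 : ∀ t ∈ D.J, ∀ z, Tendsto
      (fun n => (c n).w (ix n z) t) (hyperfilter ℕ : Filter ℕ) (𝓝 (W 0 t z)) := by
    intro t ht z
    simpa using hW 0 t z ht
  refine ⟨W, V, ?_, ?_, ?_, ?_, ?_, ?_, ?_, ?_⟩
  · intro k
    refine ⟨B (k+2), hB0 _, fun s hs t ht z hz => ?_⟩
    refine le_of_tendsto ((((hW k t z ht).sub (hW k s z hs)).sub
      ((hW (k+1) s z hs).const_mul (t - s))).abs) (Eventually.of_forall fun n => ?_)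
    exact taylor_le ((c n).smooth _) k (convex_Icc _ _) (fun τ hτ => bw (k+2) n τ hτ _) hs ht
  · intro k
    refine ⟨B k, hB0 _, fun t ht => ?_⟩
    have key : ∀ z ∈ Icc (0:ℝ) 1, ∀ z' ∈ Icc (0:ℝ) 1, z ≤ z' →
        |W k t z - W k t z'| ≤ B k * (z' - z) := by
      intro z hz z' hz' hzz
      refine le_of_tendsto_of_tendsto ((hW k t z ht).sub (hW k t z' ht)).abs
        ((ix_lim2 hz'.1 hz.1).const_mul (B k)) (Eventually.of_forall fun n => ?_)
      exact (c n).w_lip (Nat.succ_pos n) k t (bV k n t ht) (ix_mono hzz) (ix_le hz'.2)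
    intro z hz z' hz'
    rcases le_total z z' with h | h
    · rw [abs_sub_comm z z', abs_of_nonneg (sub_nonneg.2 h)]; exact key z hz z' hz' h
    · rw [abs_sub_comm (W k t z), abs_of_nonneg (sub_nonneg.2 h)]; exact key z' hz' z hz h
  · intro k t ht
    refine tendsto_nhds_unique (hW k t 1 ht) (tendsto_const_nhds.congr fun n => ?_)
    have : ix n 1 = n + 1 := by unfold ix; rw [one_mul, Nat.floor_natCast]
    rw [this, (c n).w_zero le_rfl]
  · intro k
    refine ⟨B k, hB0 _, fun t ht z hz => ?_⟩
    exact le_of_tendsto (hW k t z ht).abs (Eventually.of_forall fun n => bw k n t ht _)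
  · intro t ht z hz
    exact le_of_tendsto (hW 0 t z ht).abs (Eventually.of_forall fun n => bw 0 n t ht _)
  · intro t ht z hz
    refine le_of_tendsto (hV t z ht hz).abs (Eventually.of_forall fun n => ?_)
    have := bV 0 n t ht _ (ix_lt hz.1 hz.2)
    simpa using this
  · refine ⟨B 2, hB0 _, fun t ht z' hz' z hz hzz => ?_⟩
    have hF : ∀ z ∈ Ico (0:ℝ) 1, Tendsto (fun n => (c n).F (ix n z) t)
        (hyperfilter ℕ : Filter ℕ) (𝓝 (D.Pf ε t z (V t z))) := by
      intro z hz
      have hcont : Continuous fun q : ℝ × ℝ => D.Pf ε t q.1 q.2 := by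
        unfold Dat.Pf
        exact continuous_snd.add (D.Q_contDiff ε contDiff_const contDiff_fst contDiff_snd).continuous
      exact (hcont.tendsto (z, V t z)).comp ((ix_lim1 hz.1).prodMk_nhds (hV t z ht hz))
    refine le_of_tendsto_of_tendsto (((((D.kap_lim hz.1).mul (hF z hz)).sub
      ((D.kap_lim hz'.1).mul (hF z' hz'))).add ((((D.kap_lim hz.1).sub
        (D.kap_lim hz'.1)).div_const D.b).mul (hW 2 t z' ht))).abs)
      (((D.kap_lim hz.1).sub (D.kap_lim hz'.1)).mul ((ix_lim2 hz.1 hz'.1).const_mul (B 2)))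
      (Eventually.of_forall fun n => ?_)
    exact (c n).flux_inc (Nat.succ_pos n) ht (bV 2 n t ht) (ix_mono hzz) (ix_lt hz.1 hz.2)
  · obtain ⟨L, hL0, hL⟩ := D.V_inc ε e0 (C := B 0 + B 2) (by have := hB0 0; have := hB0 2; positivity)
    refine ⟨L, hL0, fun t ht z' hz' z hz hzz => ?_⟩
    have hz'0 : z' ∈ Ico (0:ℝ) 1 := ⟨hz'.1.le, hz'.2⟩
    have hkne : z' ^ D.b ≠ 0 := (Real.rpow_pos_of_pos hz'.1 _).ne'
    refine le_of_tendsto_of_tendsto ((((hW0 t ht z').sub (hW0 t ht z)).sub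
      ((ix_lim2 hz.1 hz'0.1).mul (hV t z' ht hz'0))).abs)
      ((ix_lim2 hz.1 hz'0.1).mul (((ix_lim2 hz.1 hz'0.1).const_mul L).div
        (D.kap_lim hz'0.1) hkne)) (Eventually.of_forall fun n => ?_)
    refine (c n).w_inc (Nat.succ_pos n) t (ix_mono hzz) fun l hl1 hl2 => ?_
    have hn' : (0:ℝ) < ((n + 1 : ℕ) : ℝ) := by positivity
    refine (hL (n+1) (Nat.succ_pos n) (c n) t ht
      (fun i hi => by
        have := bV 0 n t ht i hi
        rw [iteratedDeriv_zero] at this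
        linarith [hB0 2])
      (fun i hi => (bV 2 n t ht i hi).trans (by linarith [hB0 0]))
      (fun i => (bw 2 n t ht i).trans (by linarith [hB0 0])) (ix n z') l hl1
      (hl2.trans (ix_lt hz.1 hz.2))).trans ?_
    have : (l:ℝ) ≤ ix n z := by exact_mod_cast hl2.le
    have := D.kap_nonneg (n+1) (ix n z' + 1)
    show L * (((l:ℝ) - ix n z') / ((n+1:ℕ):ℝ)) / D.kap (n+1) (ix n z' + 1) ≤
      L * (((ix n z:ℝ) - ix n z') / ((n+1:ℕ):ℝ)) / D.kap (n+1) (ix n z' + 1)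
    gcongr

end EulerNM

open MeasureTheory Real Set
open scoped ContDiff

/-! # Part 7: calculus of functions of two variables on rectangles -/

namespace EulerNM
open Filter Topology

/-- Joint regularity on a rectangle. -/
def CD (A B : Set ℝ) (n : WithTop ℕ∞) (f : ℝ → ℝ → ℝ) : Prop :=
  ContDiffOn ℝ n (fun q : ℝ × ℝ => f q.1 q.2) (A ×ˢ B)

/-- `f'` is the partial derivative of `f` in the first variable. -/
def PT (A B : Set ℝ) (f f' : ℝ → ℝ → ℝ) : Prop :=
  ∀ t ∈ A, ∀ z ∈ B, HasDerivWithinAt (fun s => f s z) (f' t z) A t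

/-- `f'` is the partial derivative of `f` in the second variable. -/
def PZ (A B : Set ℝ) (f f' : ℝ → ℝ → ℝ) : Prop :=
  ∀ t ∈ A, ∀ z ∈ B, HasDerivWithinAt (f t) (f' t z) B z

/-- Quantitative mean value estimate. -/
theorem mvt_le {K : Set ℝ} (hK : Convex ℝ K) {f f' : ℝ → ℝ} {c e : ℝ} {r : ℝ} {x y : ℝ}
    (hf : ∀ u ∈ K, HasDerivWithinAt f (f' u) K u) (hx : x ∈ K) (hy : y ∈ K)
    (hxy : |y - x| < r)
    (h : ∀ u ∈ K, |u - x| < r → |f' u - c| ≤ e) :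
    |f y - f x - (y - x) * c| ≤ e * |y - x| := by
  have hr : 0 < r := (abs_nonneg _).trans_lt hxy
  have hc : Convex ℝ (K ∩ Metric.ball x r) := hK.inter (convex_ball x r)
  have h1 : ∀ u ∈ K ∩ Metric.ball x r,
      HasDerivWithinAt (fun u => f u - u * c) (f' u - 1 * c) (K ∩ Metric.ball x r) u := by
    intro u hu
    exact ((hf u hu.1).mono inter_subset_left).sub ((hasDerivWithinAt_id u _).mul_const c)
  have h2 : ∀ u ∈ K ∩ Metric.ball x r, ‖f' u - 1 * c‖ ≤ e := by
    intro u hu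
    have := h u hu.1 (by simpa [Real.dist_eq] using hu.2)
    simpa using this
  have := hc.norm_image_sub_le_of_norm_hasDerivWithin_le h1 h2
    (x := x) (y := y) ⟨hx, Metric.mem_ball_self hr⟩ ⟨hy, by simpa [Real.dist_eq] using hxy⟩
  simp only [Real.norm_eq_abs] at this
  convert this using 2
  ring

theorem CD.cont {A B : Set ℝ} {n : WithTop ℕ∞} {f : ℝ → ℝ → ℝ} (h : CD A B n f) :
    ContinuousOn (fun q : ℝ × ℝ => f q.1 q.2) (A ×ˢ B) := ContDiffOn.continuousOn h

theorem CD.of_le {A B : Set ℝ} {n m : WithTop ℕ∞} {f : ℝ → ℝ → ℝ} (h : CD A B n f)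
    (hmn : m ≤ n) : CD A B m f := ContDiffOn.of_le h hmn

theorem near {A B : Set ℝ} {f : ℝ → ℝ → ℝ}
    (h : ContinuousOn (fun q : ℝ × ℝ => f q.1 q.2) (A ×ˢ B)) {t z : ℝ} (ht : t ∈ A)
    (hz : z ∈ B) {e : ℝ} (he : 0 < e) :
    ∃ δ > 0, ∀ s ∈ A, |s - t| < δ → ∀ x ∈ B, |x - z| < δ → |f s x - f t z| ≤ e := by
  obtain ⟨δ, hδ, H⟩ := Metric.continuousOn_iff.1 h (t, z) ⟨ht, hz⟩ e he
  refine ⟨δ, hδ, fun s hs hst x hx hxz => ?_⟩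
  have := H (s, x) ⟨hs, hx⟩ (by
    rw [Prod.dist_eq]; exact max_lt (by simpa [Real.dist_eq] using hst)
      (by simpa [Real.dist_eq] using hxz))
  rw [Real.dist_eq] at this
  exact this.le

theorem hasF {A B : Set ℝ} (hA : Convex ℝ A) (hB : Convex ℝ B)
    {f ft fz : ℝ → ℝ → ℝ} (h1 : PT A B f ft) (h2 : PZ A B f fz)
    (c1 : ContinuousOn (fun q : ℝ × ℝ => ft q.1 q.2) (A ×ˢ B))
    {t z : ℝ} (ht : t ∈ A) (hz : z ∈ B) :
    HasFDerivWithinAt (fun q : ℝ × ℝ => f q.1 q.2)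
      (ft t z • ContinuousLinearMap.fst ℝ ℝ ℝ + fz t z • ContinuousLinearMap.snd ℝ ℝ ℝ)
      (A ×ˢ B) (t, z) := by
  rw [hasFDerivWithinAt_iff_isLittleO, Asymptotics.isLittleO_iff]
  intro e he
  have he2 : 0 < e / 2 := by positivity
  obtain ⟨δ, hδ, H⟩ := near c1 ht hz he2
  have h2' := (hasDerivWithinAt_iff_isLittleO.1 (h2 t ht z hz))
  rw [Asymptotics.isLittleO_iff] at h2'
  have h3 := h2' he2
  rw [eventually_nhdsWithin_iff, Metric.eventually_nhds_iff] at h3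
  obtain ⟨δ', hδ', H'⟩ := h3
  rw [eventually_nhdsWithin_iff, Metric.eventually_nhds_iff]
  refine ⟨min δ δ', lt_min hδ hδ', ?_⟩
  rintro ⟨s, x⟩ hd ⟨hs, hx⟩
  rw [Prod.dist_eq] at hd
  have ha : |s - t| ≤ ‖((s, x) : ℝ × ℝ) - (t, z)‖ := by
    have := norm_fst_le (((s, x) : ℝ × ℝ) - (t, z)); simpa using this
  have hb : |x - z| ≤ ‖((s, x) : ℝ × ℝ) - (t, z)‖ := by
    have := norm_snd_le (((s, x) : ℝ × ℝ) - (t, z)); simpa using this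
  have d1 : |s - t| < min δ δ' := by
    have := (le_max_left _ _).trans_lt hd; simpa [Real.dist_eq] using this
  have d2 : |x - z| < min δ δ' := by
    have := (le_max_right _ _).trans_lt hd; simpa [Real.dist_eq] using this
  have e1 := mvt_le hA (f := fun s => f s x) (f' := fun s => ft s x) (c := ft t z) (e := e/2)
    (r := δ) (fun u hu => h1 u hu x hx) ht hs (d1.trans_le (min_le_left _ _))
    (fun u hu hut => H u hu hut x hx (d2.trans_le (min_le_left _ _)))
  have e2 := H' (y := x) (by rw [Real.dist_eq]; exact d2.trans_le (min_le_right _ _)) hx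
  simp only [Real.norm_eq_abs, smul_eq_mul] at e2
  have : f s x - f t z - (ft t z • ContinuousLinearMap.fst ℝ ℝ ℝ +
      fz t z • ContinuousLinearMap.snd ℝ ℝ ℝ) (((s, x) : ℝ × ℝ) - (t, z)) =
      (f s x - f t x - (s - t) * ft t z) + (f t x - f t z - (x - z) * fz t z) := by
    simp; ring
  simp only
  rw [this, Real.norm_eq_abs]
  calc _ ≤ _ := abs_add_le _ _
    _ ≤ e/2 * |s - t| + e/2 * |x - z| := add_le_add e1 e2
    _ ≤ e/2 * ‖((s, x) : ℝ × ℝ) - (t, z)‖ + e/2 * ‖((s, x) : ℝ × ℝ) - (t, z)‖ := by gcongr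
    _ = _ := by ring

/-- Joint regularity from partial derivatives. -/
theorem CD.succ {A B : Set ℝ} (hA : Convex ℝ A) (hB : Convex ℝ B) (uA : UniqueDiffOn ℝ A)
    (uB : UniqueDiffOn ℝ B) {n : ℕ}
    {f ft fz : ℝ → ℝ → ℝ} (h1 : PT A B f ft) (h2 : PZ A B f fz) (c1 : CD A B n ft)
    (c2 : CD A B n fz) : CD A B (n + 1) f := by
  unfold CD
  rw [contDiffOn_succ_iff_hasFDerivWithinAt_of_uniqueDiffOn (uA.prod uB)]
  refine ⟨fun h => absurd h (by simp), fun q => ft q.1 q.2 • ContinuousLinearMap.fst ℝ ℝ ℝ +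
    fz q.1 q.2 • ContinuousLinearMap.snd ℝ ℝ ℝ, ?_, ?_⟩
  · exact (ContDiffOn.smul c1 contDiffOn_const).add (ContDiffOn.smul c2 contDiffOn_const)
  · rintro ⟨t, z⟩ ⟨ht, hz⟩
    exact hasF hA hB h1 h2 c1.cont ht hz

/-- Existence and regularity of partial derivatives. -/
theorem CD.partials {A B : Set ℝ} (uA : UniqueDiffOn ℝ A)
    (uB : UniqueDiffOn ℝ B) {n m : WithTop ℕ∞} (hmn : m + 1 ≤ n)
    {f : ℝ → ℝ → ℝ} (h : CD A B n f) :
    ∃ ft fz, PT A B f ft ∧ PZ A B f fz ∧ CD A B m ft ∧ CD A B m fz := by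
  have hd := ContDiffOn.fderivWithin h (uA.prod uB) hmn
  have hdiff : DifferentiableOn ℝ (fun q : ℝ × ℝ => f q.1 q.2) (A ×ˢ B) :=
    ContDiffOn.differentiableOn h (fun h0 => by subst h0; simp at hmn)
  refine ⟨fun t z => fderivWithin ℝ (fun q : ℝ × ℝ => f q.1 q.2) (A ×ˢ B) (t, z) (1, 0),
    fun t z => fderivWithin ℝ (fun q : ℝ × ℝ => f q.1 q.2) (A ×ˢ B) (t, z) (0, 1), ?_, ?_, ?_, ?_⟩
  · intro t ht z hz
    have h1 := (hdiff (t, z) (mk_mem_prod ht hz)).hasFDerivWithinAt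
    have h2 : HasDerivWithinAt (fun s : ℝ => ((s, z) : ℝ × ℝ)) (1, 0) A t :=
      (hasDerivWithinAt_id t A).prodMk (hasDerivWithinAt_const t A z)
    exact h1.comp_hasDerivWithinAt t h2 (fun s hs => mk_mem_prod hs hz)
  · intro t ht z hz
    have h1 := (hdiff (t, z) (mk_mem_prod ht hz)).hasFDerivWithinAt
    have h2 : HasDerivWithinAt (fun x : ℝ => ((t, x) : ℝ × ℝ)) (0, 1) B z :=
      (hasDerivWithinAt_const z B t).prodMk (hasDerivWithinAt_id z B)
    exact h1.comp_hasDerivWithinAt z h2 (fun s hs => mk_mem_prod ht hs)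
  · exact hd.clm_apply contDiffOn_const
  · exact hd.clm_apply contDiffOn_const

/-- Commutation of partial derivatives. -/
theorem comm_tz {A B : Set ℝ} (hA : Convex ℝ A) (hB : Convex ℝ B) (uA : UniqueDiffOn ℝ A)
    {f ft fz fzt : ℝ → ℝ → ℝ} (h1 : PT A B f ft) (h2 : PZ A B f fz)
    (h3 : PT A B fz fzt) (c : ContinuousOn (fun q : ℝ × ℝ => fzt q.1 q.2) (A ×ˢ B)) :
    PZ A B ft fzt := by
  intro t ht z hz
  rw [hasDerivWithinAt_iff_isLittleO, Asymptotics.isLittleO_iff]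
  intro e he
  obtain ⟨δ, hδ, H⟩ := near c ht hz he
  rw [eventually_nhdsWithin_iff, Metric.eventually_nhds_iff]
  refine ⟨δ, hδ, fun x hxd hx => ?_⟩
  rw [Real.dist_eq] at hxd
  simp only [Real.norm_eq_abs, smul_eq_mul]
  have hbd : ∀ s ∈ A, |s - t| < δ →
      |(f s x - f t x) - (f s z - f t z) - (x - z) * ((s - t) * fzt t z)| ≤
        (e * |s - t|) * |x - z| := by
    intro s hs hst
    refine mvt_le hB (f := fun x => f s x - f t x) (f' := fun x => fz s x - fz t x) (r := δ)
      (fun u hu => (h2 s hs u hu).sub (h2 t ht u hu)) hz hx hxd (fun u hu huz => ?_)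
    refine mvt_le hA (f := fun s => fz s u) (f' := fun s => fzt s u) (r := δ)
      (fun v hv => h3 v hv u hu) ht hs hst (fun v hv hvt => H v hv hvt u hu huz)
  have hder : HasDerivWithinAt (fun s => f s x - f s z - s * ((x - z) * fzt t z))
      (ft t x - ft t z - 1 * ((x - z) * fzt t z)) A t :=
    ((h1 t ht x hx).sub (h1 t ht z hz)).sub ((hasDerivWithinAt_id t A).mul_const _)
  have hs := (hasDerivWithinAt_iff_tendsto_slope.1 hder).abs
  have hne : (𝓝[A \ {t}] t).NeBot := by
    have := (uA t ht).accPt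
    rw [accPt_iff_frequently_nhdsNE] at this
    rw [← mem_closure_iff_nhdsWithin_neBot, mem_closure_iff_frequently]
    have h4 := frequently_nhdsWithin_iff.1 this
    exact h4.mono fun y hy => ⟨hy.1, hy.2⟩
  have := le_of_tendsto hs (b := e * |x - z|) ?_
  · rwa [one_mul] at this
  · rw [eventually_nhdsWithin_iff, Metric.eventually_nhds_iff]
    refine ⟨δ, hδ, fun s hsd hs => ?_⟩
    rw [Real.dist_eq] at hsd
    have h5 := hbd s hs.1 hsd
    have h6 : 0 < |s - t| := abs_pos.2 (sub_ne_zero.2 hs.2)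
    rw [slope_def_field, abs_div, div_le_iff₀ h6]
    calc _ = |(f s x - f t x) - (f s z - f t z) - (x - z) * ((s - t) * fzt t z)| := by
          congr 1; ring
      _ ≤ _ := h5
      _ = _ := by ring

end EulerNM

open MeasureTheory Real Set
open scoped ContDiff

/-! # Part 8: averaging operators, time-regular classes, inversion of the flux -/

namespace EulerNM
open Filter Topology

theorem int_bd {F : ℝ → ℝ} {e : ℝ} (h : ∀ σ ∈ Icc (0:ℝ) 1, |F σ| ≤ e) :
    |∫ σ in (0:ℝ)..1, F σ| ≤ e := by
  have := intervalIntegral.norm_integral_le_of_norm_le_const (a := (0:ℝ)) (b := 1) (f := F)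
    (C := e) (fun x hx => by
      rw [uIoc_of_le zero_le_one] at hx
      exact h x ⟨hx.1.le, hx.2⟩)
  simpa using this

theorem rpow_le1 {c σ : ℝ} (hc : 1 ≤ c) (h : σ ∈ Icc (0:ℝ) 1) : |σ ^ (c - 1)| ≤ 1 := by
  rw [abs_of_nonneg (Real.rpow_nonneg h.1 _)]
  exact Real.rpow_le_one h.1 h.2 (by linarith)

theorem w_int {c : ℝ} (hc : 1 ≤ c) {h : ℝ → ℝ} (hh : ContinuousOn h (Icc 0 1)) :
    IntervalIntegrable (fun σ => σ ^ (c-1) * h σ) volume 0 1 := by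
  apply ContinuousOn.intervalIntegrable
  rw [uIcc_of_le zero_le_one]
  exact (Real.continuous_rpow_const (by linarith)).continuousOn.mul hh

theorem unif {K : Set ℝ} (hc : IsCompact K) {h : ℝ → ℝ → ℝ}
    (hh : ContinuousOn (fun q : ℝ × ℝ => h q.1 q.2) (K ×ˢ Icc 0 1)) {e : ℝ} (he : 0 < e) :
    ∃ δ > 0, ∀ s ∈ K, ∀ t ∈ K, |s - t| < δ → ∀ x ∈ Icc (0:ℝ) 1, ∀ z ∈ Icc (0:ℝ) 1,
      |x - z| < δ → |h s x - h t z| ≤ e := by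
  have := (hc.prod isCompact_Icc).uniformContinuousOn_of_continuous hh
  rw [Metric.uniformContinuousOn_iff] at this
  obtain ⟨δ, hδ, H⟩ := this e he
  refine ⟨δ, hδ, fun s hs t ht hst x hx z hz hxz => ?_⟩
  have := H (s, x) (mk_mem_prod hs hx) (t, z) (mk_mem_prod ht hz) (by
    rw [Prod.dist_eq]; exact max_lt (by simpa [Real.dist_eq] using hst)
      (by simpa [Real.dist_eq] using hxz))
  rw [Real.dist_eq] at this
  exact this.le

/-- Differentiation under the integral sign. -/
theorem diff_int {K : Set ℝ} (hK : Convex ℝ K) (hKc : IsCompact K) {c : ℝ} (hc : 1 ≤ c)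
    {h h' : ℝ → ℝ → ℝ} (hd : PT K (Icc 0 1) h h')
    (hh : ∀ x ∈ K, ContinuousOn (h x) (Icc 0 1))
    (hh' : ContinuousOn (fun q : ℝ × ℝ => h' q.1 q.2) (K ×ˢ Icc 0 1)) {x : ℝ} (hx : x ∈ K) :
    HasDerivWithinAt (fun x => ∫ σ in (0:ℝ)..1, σ ^ (c-1) * h x σ)
      (∫ σ in (0:ℝ)..1, σ ^ (c-1) * h' x σ) K x := by
  rw [hasDerivWithinAt_iff_isLittleO, Asymptotics.isLittleO_iff]
  intro e he
  obtain ⟨δ, hδ, H⟩ := unif hKc hh' he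
  rw [eventually_nhdsWithin_iff, Metric.eventually_nhds_iff]
  refine ⟨δ, hδ, fun y hyd hy => ?_⟩
  rw [Real.dist_eq] at hyd
  simp only [Real.norm_eq_abs, smul_eq_mul]
  have i1 := w_int hc (hh y hy)
  have i2 := w_int hc (hh x hx)
  have i3 := w_int hc (h := h' x) (hh'.comp (Continuous.prodMk_right x).continuousOn
    (fun σ hσ => mk_mem_prod hx hσ))
  rw [← intervalIntegral.integral_sub i1 i2, ← intervalIntegral.integral_const_mul,
    ← intervalIntegral.integral_sub (i1.sub i2) (i3.const_mul _)]
  refine int_bd fun σ hσ => ?_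
  have e1 := mvt_le hK (f := fun s => h s σ) (f' := fun s => h' s σ) (c := h' x σ) (e := e)
    (r := δ) (fun u hu => hd u hu σ hσ) hx hy hyd
    (fun u hu hut => H u hu x hx hut σ hσ σ hσ (by simpa using hδ))
  calc _ = |σ ^ (c-1)| * |h y σ - h x σ - (y - x) * h' x σ| := by
        rw [← abs_mul]; congr 1; ring
    _ ≤ 1 * (e * |y - x|) := mul_le_mul (rpow_le1 hc hσ) e1 (abs_nonneg _) zero_le_one
    _ = _ := one_mul _

/-- The averaging operator. -/
noncomputable def Aop (c : ℝ) (f : ℝ → ℝ → ℝ) (t z : ℝ) : ℝ :=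
  ∫ σ in (0:ℝ)..1, σ ^ (c-1) * f t (σ * z)

theorem mul_mem01 {σ z : ℝ} (h : σ ∈ Icc (0:ℝ) 1) (hz : z ∈ Icc (0:ℝ) 1) :
    σ * z ∈ Icc (0:ℝ) 1 := ⟨mul_nonneg h.1 hz.1, mul_le_one₀ h.2 hz.1 hz.2⟩

variable {a b : ℝ}

theorem slice_c {A : Set ℝ} {f : ℝ → ℝ → ℝ}
    (hf : ContinuousOn (fun q : ℝ × ℝ => f q.1 q.2) (A ×ˢ Icc 0 1)) {t z : ℝ}
    (ht : t ∈ A) (hz : z ∈ Icc (0:ℝ) 1) : ContinuousOn (fun σ => f t (σ * z)) (Icc 0 1) :=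
  hf.comp (f := fun σ => (t, σ * z)) (by fun_prop)
    (fun σ hσ => mk_mem_prod ht (mul_mem01 hσ hz))

theorem Aop_cont {c : ℝ} (hc : 1 ≤ c) {f : ℝ → ℝ → ℝ}
    (hf : ContinuousOn (fun q : ℝ × ℝ => f q.1 q.2) (Icc a b ×ˢ Icc 0 1)) :
    ContinuousOn (fun q : ℝ × ℝ => Aop c f q.1 q.2) (Icc a b ×ˢ Icc 0 1) := by
  rw [Metric.continuousOn_iff]
  rintro ⟨t, z⟩ ⟨ht, hz⟩ e he
  simp only at ht hz
  obtain ⟨δ, hδ, H⟩ := unif isCompact_Icc hf (half_pos he)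
  refine ⟨δ, hδ, ?_⟩
  rintro ⟨s, x⟩ ⟨hs, hx⟩ hd
  simp only at hs hx
  rw [Prod.dist_eq] at hd
  have d1 : |s - t| < δ := by
    have := (le_max_left _ _).trans_lt hd; simpa [Real.dist_eq] using this
  have d2 : |x - z| < δ := by
    have := (le_max_right _ _).trans_lt hd; simpa [Real.dist_eq] using this
  rw [Real.dist_eq]
  refine lt_of_le_of_lt (b := e/2) ?_ (by linarith)
  simp only [Aop]
  rw [← intervalIntegral.integral_sub (w_int hc (slice_c hf hs hx)) (w_int hc (slice_c hf ht hz))]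
  refine int_bd fun σ hσ => ?_
  rw [← mul_sub, abs_mul]
  calc _ ≤ 1 * (e/2) := by
        refine mul_le_mul (rpow_le1 hc hσ) ?_ (abs_nonneg _) zero_le_one
        refine H s hs t ht d1 _ (mul_mem01 hσ hx) _ (mul_mem01 hσ hz) ?_
        rw [← mul_sub, abs_mul, abs_of_nonneg hσ.1]
        exact (mul_le_of_le_one_left (abs_nonneg _) hσ.2).trans_lt d2
    _ = _ := one_mul _

theorem Aop_PT {c : ℝ} (hc : 1 ≤ c) {f ft : ℝ → ℝ → ℝ}
    (hf : ContinuousOn (fun q : ℝ × ℝ => f q.1 q.2) (Icc a b ×ˢ Icc 0 1))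
    (hft : ContinuousOn (fun q : ℝ × ℝ => ft q.1 q.2) (Icc a b ×ˢ Icc 0 1))
    (h : PT (Icc a b) (Icc 0 1) f ft) : PT (Icc a b) (Icc 0 1) (Aop c f) (Aop c ft) := by
  intro t ht z hz
  refine diff_int (h := fun s σ => f s (σ * z)) (h' := fun s σ => ft s (σ * z)) (convex_Icc a b)
    isCompact_Icc hc (fun s hs σ hσ => h s hs _ (mul_mem01 hσ hz)) (fun s hs => slice_c hf hs hz)
    ?_ ht
  exact hft.comp (f := fun q : ℝ × ℝ => (q.1, q.2 * z)) (by fun_prop)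
    (fun q hq => mk_mem_prod hq.1 (mul_mem01 hq.2 hz))

theorem Aop_PZ {c : ℝ} (hc : 1 ≤ c) {f fz : ℝ → ℝ → ℝ}
    (hf : ContinuousOn (fun q : ℝ × ℝ => f q.1 q.2) (Icc a b ×ˢ Icc 0 1))
    (hfz : ContinuousOn (fun q : ℝ × ℝ => fz q.1 q.2) (Icc a b ×ˢ Icc 0 1))
    (h : PZ (Icc a b) (Icc 0 1) f fz) : PZ (Icc a b) (Icc 0 1) (Aop c f) (Aop (c+1) fz) := by
  intro t ht z hz
  have key : PT (Icc 0 1) (Icc 0 1) (fun x σ => f t (σ * x)) (fun x σ => σ * fz t (σ * x)) := by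
    intro x hx σ hσ
    have h1 : HasDerivWithinAt (fun x => σ * x) σ (Icc 0 1) x := by
      simpa using (hasDerivWithinAt_id x (Icc (0:ℝ) 1)).const_mul σ
    have := (h t ht _ (mul_mem01 hσ hx)).comp x h1 (fun y hy => mul_mem01 hσ hy)
    rw [mul_comm] at this
    exact this
  have := diff_int (h := fun x σ => f t (σ * x)) (h' := fun x σ => σ * fz t (σ * x))
    (convex_Icc (0:ℝ) 1) isCompact_Icc hc key (fun x hx => slice_c hf ht hx)
    ?_ hz
  · have e : (∫ σ in (0:ℝ)..1, σ ^ (c-1) * (σ * fz t (σ * z))) = Aop (c+1) fz t z := ?_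
    · rw [e] at this; exact this
    refine intervalIntegral.integral_congr fun σ hσ => ?_
    rw [uIcc_of_le zero_le_one] at hσ
    rcases hσ.1.eq_or_lt with h0 | h0
    · subst h0
      rw [zero_mul, mul_zero, Real.zero_rpow (by linarith), zero_mul]
    · rw [add_sub_cancel_right, ← mul_assoc]
      congr 1
      rw [Real.rpow_sub_one h0.ne']; field_simp
  · refine continuous_snd.continuousOn.mul ?_
    exact hfz.comp (f := fun q : ℝ × ℝ => (t, q.2 * q.1)) (by fun_prop)
      (fun q hq => mk_mem_prod ht (mul_mem01 hq.2 hq.1))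

theorem uD (hab : a < b) : UniqueDiffOn ℝ (Icc a b) := uniqueDiffOn_Icc hab

theorem Aop_CD (hab : a < b) (m : ℕ) : ∀ {c : ℝ}, 1 ≤ c → ∀ {f : ℝ → ℝ → ℝ},
    CD (Icc a b) (Icc 0 1) m f → CD (Icc a b) (Icc 0 1) m (Aop c f) := by
  induction m with
  | zero =>
    intro c hc f hf
    exact contDiffOn_zero.2 (Aop_cont hc hf.cont)
  | succ m ih =>
    intro c hc f hf
    obtain ⟨ft, fz, h1, h2, h3, h4⟩ := hf.partials (uD hab) (uD zero_lt_one)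
      (m := (m : WithTop ℕ∞)) (by push_cast; exact le_rfl)
    have := CD.succ (convex_Icc a b) (convex_Icc 0 1) (uD hab) (uD zero_lt_one)
      (Aop_PT hc hf.cont h3.cont h1) (Aop_PZ hc hf.cont h4.cont h2) (ih hc h3)
      (ih (by linarith) h4)
    exact_mod_cast this

/-- Functions with `l` time derivatives of class `C^m`. -/
def TD (A B : Set ℝ) (m : ℕ) : ℕ → (ℝ → ℝ → ℝ) → Prop
  | 0 => fun f => CD A B m f
  | l + 1 => fun f => CD A B m f ∧ ∃ f', PT A B f f' ∧ TD A B m l f'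

theorem TD.cd {A B : Set ℝ} {m l : ℕ} {f : ℝ → ℝ → ℝ} (h : TD A B m l f) : CD A B m f := by
  cases l with
  | zero => exact h
  | succ l => exact h.1

theorem TD.down {A B : Set ℝ} {m : ℕ} : ∀ {l : ℕ} {f : ℝ → ℝ → ℝ}, TD A B m (l+1) f →
    TD A B m l f := by
  intro l
  induction l with
  | zero => intro f h; exact h.1
  | succ l ih =>
    intro f h
    obtain ⟨h1, f', h2, h3⟩ := h
    exact ⟨h1, f', h2, ih h3⟩

theorem TD.add {A B : Set ℝ} {m : ℕ} : ∀ {l : ℕ} {f g : ℝ → ℝ → ℝ}, TD A B m l f →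
    TD A B m l g → TD A B m l (fun t z => f t z + g t z) := by
  intro l
  induction l with
  | zero => intro f g hf hg; exact ContDiffOn.add hf hg
  | succ l ih =>
    rintro f g ⟨h1, f', h2, h3⟩ ⟨k1, g', k2, k3⟩
    exact ⟨ContDiffOn.add h1 k1, _, fun t ht z hz => (h2 t ht z hz).add (k2 t ht z hz), ih h3 k3⟩

theorem TD.mul {A B : Set ℝ} {m : ℕ} : ∀ {l : ℕ} {f g : ℝ → ℝ → ℝ}, TD A B m l f →
    TD A B m l g → TD A B m l (fun t z => f t z * g t z) := by
  intro l
  induction l with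
  | zero => intro f g hf hg; exact ContDiffOn.mul hf hg
  | succ l ih =>
    intro f g hf hg
    have hf0 := hf.down
    have hg0 := hg.down
    obtain ⟨h1, f', h2, h3⟩ := hf
    obtain ⟨k1, g', k2, k3⟩ := hg
    exact ⟨ContDiffOn.mul h1 k1, _, fun t ht z hz => (h2 t ht z hz).mul (k2 t ht z hz),
      (ih h3 hg0).add (ih hf0 k3)⟩

theorem CD.comp3 {A B : Set ℝ} {m : ℕ} {P : ℝ → ℝ → ℝ} (h : CD A B m P)
    {ψ : ℝ × ℝ × ℝ → ℝ} (hψ : ContDiff ℝ ∞ ψ) : CD A B m (fun t z => ψ (t, z, P t z)) :=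
  (hψ.of_le (by exact_mod_cast le_top)).comp_contDiffOn
    (contDiff_fst.contDiffOn.prodMk (contDiff_snd.contDiffOn.prodMk h))

theorem TD.comp3 {A B : Set ℝ} {m : ℕ} : ∀ {l : ℕ} {P : ℝ → ℝ → ℝ}, TD A B m l P →
    ∀ {ψ : ℝ × ℝ × ℝ → ℝ}, ContDiff ℝ ∞ ψ → TD A B m l (fun t z => ψ (t, z, P t z)) := by
  intro l
  induction l with
  | zero => intro P hP ψ hψ; exact CD.comp3 hP hψ
  | succ l ih =>
    intro P hP ψ hψ
    have hP0 := hP.down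
    obtain ⟨h1, P', h2, h3⟩ := hP
    have hfd : ContDiff ℝ ∞ (fderiv ℝ ψ) := hψ.fderiv_right (by simp)
    refine ⟨h1.comp3 hψ, fun t z => fderiv ℝ ψ (t, z, P t z) (1, 0, 0) +
      fderiv ℝ ψ (t, z, P t z) (0, 0, 1) * P' t z, ?_, ?_⟩
    · intro t ht z hz
      have k1 : HasFDerivAt ψ (fderiv ℝ ψ (t, z, P t z)) (t, z, P t z) :=
        (hψ.differentiable (by simp) _).hasFDerivAt
      have k2 : HasDerivWithinAt (fun s : ℝ => ((s, z, P s z) : ℝ × ℝ × ℝ)) (1, 0, P' t z) A t :=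
        (hasDerivWithinAt_id t A).prodMk ((hasDerivWithinAt_const t A z).prodMk (h2 t ht z hz))
      have k3 := k1.comp_hasDerivWithinAt t k2
      have : ((1, 0, P' t z) : ℝ × ℝ × ℝ) = (1, 0, 0) + (P' t z) • (0, 0, 1) := by simp
      rw [this, map_add, map_smul, smul_eq_mul, mul_comm] at k3
      exact k3
    · exact (ih hP0 (ψ := fun q => fderiv ℝ ψ q (1, 0, 0)) (hfd.clm_apply contDiff_const)).add
        ((ih hP0 (ψ := fun q => fderiv ℝ ψ q (0, 0, 1)) (hfd.clm_apply contDiff_const)).mul h3)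

theorem TD.of_seq {A B : Set ℝ} {m : ℕ} (l : ℕ) : ∀ {P : ℕ → ℝ → ℝ → ℝ}, (∀ k, CD A B m (P k)) →
    (∀ k, PT A B (P k) (P (k+1))) → TD A B m l (P 0) := by
  induction l with
  | zero => intro P h _; exact h 0
  | succ l ih =>
    intro P h h'
    exact ⟨h 0, P 1, h' 0, ih (P := fun k => P (k+1)) (fun k => h _) (fun k => h' _)⟩

theorem TD.chain {A B : Set ℝ} (hA : Convex ℝ A) (hB : Convex ℝ B) (uA : UniqueDiffOn ℝ A)
    {m : ℕ} (l : ℕ) : ∀ {w : ℕ → ℝ → ℝ → ℝ} {f : ℝ → ℝ → ℝ},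
    (∀ k, PT A B (w k) (w (k+1))) → PZ A B (w 0) f → TD A B m l f →
    ∃ v, CD A B m v ∧ PZ A B (w l) v := by
  induction l with
  | zero => intro w f _ h1 h2; exact ⟨f, h2, h1⟩
  | succ l ih =>
    intro w f hw h1 h2
    obtain ⟨_, f', k2, k3⟩ := h2
    exact ih (w := fun k => w (k+1)) (fun k => hw _) (comm_tz hA hB uA (hw 0) h1 k2 k3.cd.cont) k3

end EulerNM

open MeasureTheory Real Set
open scoped ContDiff

/-! # Part 9: the limit solves the continuous equation and is smooth -/

namespace EulerNM
open Filter Topology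

/-- Smooth inversion of the nonlinear strain. -/
theorem Dat.inv (D : Dat) : ∃ H : ℝ × ℝ → ℝ, ContDiff ℝ ∞ H ∧
    (∀ t x, H (t, x + D.chi t * D.g x) = x) ∧
    (∀ t y, H (t, y) + D.chi t * D.g (H (t, y)) = y) := by
  obtain ⟨M, hM0, hM⟩ := D.g_bound
  have hcg : ∀ t x, |D.chi t * D.g x| ≤ M := by
    intro t x
    rw [abs_mul, abs_of_nonneg (D.chi0 t)]
    exact (mul_le_of_le_one_left (abs_nonneg _) (D.chi1 t)).trans (hM x)
  have hs : ∀ t y, ∃ x, x + D.chi t * D.g x = y := by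
    intro t y
    have hc : Continuous fun x => x + D.chi t * D.g x :=
      continuous_id.add (continuous_const.mul D.g_s.continuous)
    refine mem_range_of_exists_le_of_exists_ge hc ⟨y - M, ?_⟩ ⟨y + M, ?_⟩
    · have := (abs_le.1 (hcg t (y - M))).2; linarith
    · have := (abs_le.1 (hcg t (y + M))).1; linarith
  have hmono : ∀ t x x', |x - x'| ≤ 2 * |(x + D.chi t * D.g x) - (x' + D.chi t * D.g x')| := by
    intro t x x'
    have h1 : |D.chi t * (D.g x - D.g x')| ≤ 1/2 * |x - x'| := by
      rw [abs_mul, abs_of_nonneg (D.chi0 t)]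
      exact (mul_le_of_le_one_left (abs_nonneg _) (D.chi1 t)).trans (D.g_lip x x')
    have h2 := abs_sub ((x + D.chi t * D.g x) - (x' + D.chi t * D.g x')) (D.chi t * (D.g x - D.g x'))
    rw [show (x + D.chi t * D.g x) - (x' + D.chi t * D.g x') - D.chi t * (D.g x - D.g x') = x - x'
      by ring] at h2
    linarith
  choose K hK using hs
  have hK' : ∀ t x, K t (x + D.chi t * D.g x) = x := by
    intro t x
    have := hmono t (K t (x + D.chi t * D.g x)) x
    rw [hK, sub_self, abs_zero, mul_zero] at this
    exact sub_eq_zero.1 (abs_nonpos_iff.1 this)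
  have hKc : Continuous fun q : ℝ × ℝ => K q.1 q.2 := by
    rw [continuous_iff_continuousAt]
    rintro ⟨t, y⟩
    rw [ContinuousAt, tendsto_iff_dist_tendsto_zero]
    have hlim : Tendsto (fun q : ℝ × ℝ => 2 * (|q.2 - y| + |D.chi t - D.chi q.1| * M))
        (𝓝 (t, y)) (𝓝 0) := by
      have : Continuous fun q : ℝ × ℝ => 2 * (|q.2 - y| + |D.chi t - D.chi q.1| * M) := by
        have := D.chi_s.continuous
        fun_prop
      have := this.tendsto (t, y)
      simpa using this
    refine squeeze_zero (fun _ => dist_nonneg) (fun q => ?_) hlim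
    rw [Real.dist_eq]
    refine (hmono t _ _).trans ?_
    simp only
    rw [hK t y]
    have e : K q.1 q.2 + D.chi t * D.g (K q.1 q.2) - y =
      (q.2 - y) + (D.chi t - D.chi q.1) * D.g (K q.1 q.2) := by
      have := hK q.1 q.2; linear_combination this
    rw [e]
    refine mul_le_mul_of_nonneg_left ((abs_add_le _ _).trans ?_) (by norm_num)
    rw [abs_mul]
    gcongr
    exact hM _
  have hΘ : ContDiff ℝ ∞ (fun q : ℝ × ℝ => (q.1, q.2 + D.chi q.1 * D.g q.2)) :=
    contDiff_fst.prodMk (contDiff_snd.add ((D.chi_s.comp contDiff_fst).mul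
      (D.g_s.comp contDiff_snd)))
  let Θ : (ℝ × ℝ) ≃ₜ (ℝ × ℝ) :=
    { toFun := fun q => (q.1, q.2 + D.chi q.1 * D.g q.2)
      invFun := fun q => (q.1, K q.1 q.2)
      left_inv := fun q => by simp only [hK']
      right_inv := fun q => by simp only [hK]
      continuous_toFun := hΘ.continuous
      continuous_invFun := continuous_fst.prodMk hKc }
  have hne : ∀ q : ℝ × ℝ, 1 + D.chi q.1 * deriv D.g q.2 ≠ 0 := by
    intro q
    have h1 : |D.chi q.1 * deriv D.g q.2| ≤ 1/2 := by
      rw [abs_mul, abs_of_nonneg (D.chi0 _)]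
      exact (mul_le_of_le_one_left (abs_nonneg _) (D.chi1 _)).trans (D.g_d _)
    have := (abs_le.1 h1).1
    intro h; linarith
  let c : ℝ × ℝ → ℝ := fun q => deriv D.chi q.1 * D.g q.2
  let d : ℝ × ℝ → ℝ := fun q => 1 + D.chi q.1 * deriv D.g q.2
  let F : ℝ × ℝ → (ℝ × ℝ) ≃L[ℝ] (ℝ × ℝ) := fun q =>
    ContinuousLinearEquiv.equivOfInverse
      ((ContinuousLinearMap.fst ℝ ℝ ℝ).prod
        (c q • ContinuousLinearMap.fst ℝ ℝ ℝ + d q • ContinuousLinearMap.snd ℝ ℝ ℝ))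
      ((ContinuousLinearMap.fst ℝ ℝ ℝ).prod
        ((-(c q) * (d q)⁻¹) • ContinuousLinearMap.fst ℝ ℝ ℝ +
          (d q)⁻¹ • ContinuousLinearMap.snd ℝ ℝ ℝ))
      (fun x => by
        have := hne q
        ext
        · simp
        · have hd : d q ≠ 0 := this
          simp
          field_simp
          ring)
      (fun x => by
        have := hne q
        ext
        · simp
        · have hd : d q ≠ 0 := this
          simp
          field_simp
          ring)
  have hF : ∀ q, HasFDerivAt Θ (F q : (ℝ × ℝ) →L[ℝ] (ℝ × ℝ)) q := by
    intro q
    have h1 : HasFDerivAt (fun q : ℝ × ℝ => q.1) (ContinuousLinearMap.fst ℝ ℝ ℝ) q :=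
      hasFDerivAt_fst
    have h2 : HasFDerivAt (fun q : ℝ × ℝ => q.2) (ContinuousLinearMap.snd ℝ ℝ ℝ) q :=
      hasFDerivAt_snd
    have h3 := ((D.chi_s.differentiable (by simp) q.1).hasDerivAt).comp_hasFDerivAt q h1
    have h4 := ((D.g_s.differentiable (by simp) q.2).hasDerivAt).comp_hasFDerivAt q h2
    have h5 := h1.prodMk (h2.add (h3.mul h4))
    refine h5.congr_fderiv ?_
    apply ContinuousLinearMap.ext
    intro x
    show _ = ((ContinuousLinearMap.fst ℝ ℝ ℝ).prod
        (c q • ContinuousLinearMap.fst ℝ ℝ ℝ + d q • ContinuousLinearMap.snd ℝ ℝ ℝ)) x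
    ext
    · simp
    · simp [c, d]; ring
  have hsm := Θ.contDiff_symm hF hΘ
  refine ⟨fun q => K q.1 q.2, contDiff_snd.comp hsm, fun t x => hK' t x, fun t y => hK t y⟩

theorem der_sq {K : Set ℝ} {f : ℝ → ℝ} {c L x : ℝ}
    (h : ∀ y ∈ K, |f y - f x - (y - x) * c| ≤ L * (y - x) ^ 2) : HasDerivWithinAt f c K x := by
  rw [hasDerivWithinAt_iff_isLittleO, Asymptotics.isLittleO_iff]
  intro e he
  rw [eventually_nhdsWithin_iff, Metric.eventually_nhds_iff]
  refine ⟨e / (|L| + 1), by positivity, fun y hyd hy => ?_⟩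
  rw [Real.dist_eq, lt_div_iff₀ (by positivity)] at hyd
  simp only [Real.norm_eq_abs, smul_eq_mul]
  refine (h y hy).trans ?_
  rw [← sq_abs]
  have h1 : L * |y - x| ≤ e := by
    have := mul_le_mul_of_nonneg_right (le_abs_self L) (abs_nonneg (y - x))
    nlinarith [abs_nonneg (y - x)]
  nlinarith [abs_nonneg (y - x)]

theorem Dat.Lim.pt {D : Dat} {ε C : ℝ} {W V} (L : D.Lim ε C W V) (k : ℕ) :
    PT D.J (Icc 0 1) (W k) (W (k+1)) := by
  obtain ⟨B, _, h⟩ := L.time k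
  intro t ht z hz
  exact der_sq (L := B) fun y hy => h t ht y hy z hz

theorem Dat.Lim.jc {D : Dat} {ε C : ℝ} {W V} (L : D.Lim ε C W V) (k : ℕ) :
    ContinuousOn (fun q : ℝ × ℝ => W k q.1 q.2) (D.J ×ˢ Icc 0 1) := by
  obtain ⟨B, hB, h⟩ := L.space k
  refine continuousOn_prod_of_continuousOn_lipschitzOnWith' _ ⟨B, hB⟩ (fun t ht => ?_)
    (fun z hz t ht => (L.pt k t ht z hz).continuousWithinAt)
  refine LipschitzOnWith.of_dist_le_mul fun x hx y hy => ?_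
  rw [Real.dist_eq, Real.dist_eq]
  exact h t ht x hx y hy

theorem rpow_lip {b x y : ℝ} (hb : 1 ≤ b) (hx : 0 ≤ x) (hxy : x ≤ y) (hy : y ≤ 1) :
    y ^ b - x ^ b ≤ b * (y - x) := by
  have := Convex.norm_image_sub_le_of_norm_hasDerivWithin_le (f := fun x : ℝ => x ^ b)
    (f' := fun x => b * x ^ (b - 1)) (s := Icc 0 1) (x := x) (y := y) (C := b)
    (fun x _ => (Real.hasDerivAt_rpow_const (Or.inr (by linarith))).hasDerivWithinAt)
    (fun x hx => by
      rw [Real.norm_eq_abs, abs_of_nonneg (mul_nonneg (by linarith) (Real.rpow_nonneg hx.1 _))]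
      have := Real.rpow_le_one hx.1 hx.2 (show 0 ≤ b - 1 by linarith)
      nlinarith) (convex_Icc 0 1) ⟨hx, hxy.trans hy⟩ ⟨hx.trans hxy, hy⟩
  rw [Real.norm_eq_abs, Real.norm_eq_abs, abs_of_nonneg (a := y - x) (by linarith)] at this
  exact (le_abs_self _).trans this

/-- A primitive of a function continuous on `[0,1]`. -/
theorem prim {f : ℝ → ℝ} (hf : ContinuousOn f (Icc 0 1)) : ∃ M : ℝ → ℝ, M 0 = 0 ∧
    Continuous M ∧ (∀ z ∈ Icc (0:ℝ) 1, HasDerivWithinAt M (f z) (Icc 0 1) z) ∧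
    (∀ z ∈ Ioo (0:ℝ) 1, HasDerivAt M (f z) z) ∧
    (∀ z ∈ Ico (0:ℝ) 1, HasDerivWithinAt M (f z) (Ici z) z) ∧
    (∀ z ∈ Icc (0:ℝ) 1, M z = ∫ s in (0:ℝ)..z, f s) := by
  let F : ℝ → ℝ := IccExtend (zero_le_one (α := ℝ)) ((Icc (0:ℝ) 1).domRestrict f)
  have hF : Continuous F := hf.domRestrict.Icc_extend'
  have hFe : ∀ z ∈ Icc (0:ℝ) 1, F z = f z := fun z hz => by
    simp only [F]; rw [IccExtend_of_mem _ _ hz]; rfl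
  have hd : ∀ z, HasDerivAt (fun z => ∫ s in (0:ℝ)..z, F s) (F z) z := fun z =>
    intervalIntegral.integral_hasDerivAt_right (hF.intervalIntegrable _ _)
      (hF.stronglyMeasurableAtFilter _ _) hF.continuousAt
  refine ⟨fun z => ∫ s in (0:ℝ)..z, F s, intervalIntegral.integral_same,
    continuous_iff_continuousAt.2 fun z => (hd z).continuousAt, ?_, ?_, ?_, ?_⟩
  · intro z hz; rw [← hFe z hz]; exact (hd z).hasDerivWithinAt
  · intro z hz; rw [← hFe z ⟨hz.1.le, hz.2.le⟩]; exact hd z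
  · intro z hz; rw [← hFe z ⟨hz.1, hz.2.le⟩]; exact (hd z).hasDerivWithinAt
  · intro z hz
    refine intervalIntegral.integral_congr fun s hs => ?_
    rw [uIcc_of_le hz.1] at hs
    exact hFe s ⟨hs.1, hs.2.trans hz.2⟩

theorem Aop_eq {c : ℝ} (hc : 1 ≤ c) (f : ℝ → ℝ → ℝ) (t : ℝ) {z : ℝ} (hz : 0 ≤ z) :
    z ^ c * Aop c f t z = ∫ s in (0:ℝ)..z, s ^ (c-1) * f t s := by
  rcases hz.eq_or_lt with h | h
  · subst h; rw [Real.zero_rpow (by linarith)]; simp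
  · have h1 := intervalIntegral.mul_integral_comp_mul_left (a := (0:ℝ)) (b := 1)
      (f := fun s => s ^ (c-1) * f t s) z
    rw [mul_zero, mul_one] at h1
    rw [← h1]
    unfold Aop
    rw [← intervalIntegral.integral_const_mul, ← intervalIntegral.integral_const_mul]
    refine intervalIntegral.integral_congr fun s hs => ?_
    rw [uIcc_of_le zero_le_one] at hs
    rw [Real.mul_rpow hz hs.1, mul_comm s z]
    have : z ^ c = z * z ^ (c-1) := by rw [Real.rpow_sub_one h.ne']; field_simp
    rw [this]; ring

theorem right_der {f : ℝ → ℝ} {c z : ℝ} (hz : z < 1) (h : HasDerivWithinAt f c (Ico z 1) z) :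
    HasDerivWithinAt f c (Ici z) z := h.mono_of_mem_nhdsWithin (Ico_mem_nhdsGE hz)

theorem Dat.Lim.flux_eq {D : Dat} {ε C : ℝ} {W V} (L : D.Lim ε C W V) {t : ℝ} (ht : t ∈ D.J)
    {z : ℝ} (hz : z ∈ Ioo (0:ℝ) 1) : D.Pf ε t z (V t z) = -(Aop D.b (W 2) t z) := by
  have hb := D.hb
  have hc : ContinuousOn (fun s => s ^ (D.b-1) * W 2 t s) (Icc 0 1) :=
    (Real.continuous_rpow_const (by linarith)).continuousOn.mul
      ((L.jc 2).comp (Continuous.prodMk_right t).continuousOn (fun σ hσ => mk_mem_prod ht hσ))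
  obtain ⟨M, M0, Mc, _, _, Mr, Me⟩ := prim hc
  obtain ⟨B, hB, hfl⟩ := L.flux
  have hder : ∀ x ∈ Ico (0:ℝ) 1,
      HasDerivWithinAt (fun x => x ^ D.b * D.Pf ε t x (V t x) + M x) 0 (Ici x) x := by
    intro x hx
    have h1 : HasDerivWithinAt (fun y => y ^ D.b * D.Pf ε t y (V t y) + y ^ D.b / D.b * W 2 t x) 0
        (Ico x 1) x := by
      refine der_sq (L := D.b * B) fun y hy => ?_
      have h2 := hfl t ht x hx y ⟨hx.1.trans hy.1, hy.2⟩ hy.1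
      have h3 := rpow_lip (b := D.b) (by linarith) hx.1 hy.1 hy.2.le
      calc _ = |y ^ D.b * D.Pf ε t y (V t y) - x ^ D.b * D.Pf ε t x (V t x)
            + (y ^ D.b - x ^ D.b) / D.b * W 2 t x| := by congr 1; ring
        _ ≤ _ := h2
        _ ≤ (D.b * (y - x)) * (B * (y - x)) := by
            refine mul_le_mul_of_nonneg_right h3 (mul_nonneg hB (by linarith [hy.1]))
        _ = _ := by ring
    have h2 : HasDerivAt (fun y => y ^ D.b / D.b * W 2 t x) (x ^ (D.b-1) * W 2 t x) x := by
      have := ((Real.hasDerivAt_rpow_const (x := x) (p := D.b) (Or.inr (by linarith))).div_const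
        D.b).mul_const (W 2 t x)
      have e : D.b * x ^ (D.b-1) / D.b = x ^ (D.b-1) := by
        field_simp [D.bpos.ne']
      rwa [e] at this
    have h3 := ((right_der hx.2 h1).sub h2.hasDerivWithinAt).add (Mr x hx)
    have h4 := h3.congr_deriv (sub_add_cancel _ _)
    refine h4.congr_of_eventuallyEq (Eventually.of_forall fun y => ?_) ?_ <;> simp
  have hcon : ContinuousOn (fun x => x ^ D.b * D.Pf ε t x (V t x) + M x) (Icc 0 z) := by
    obtain ⟨B2, hB2, hbd⟩ := L.bdd 2
    refine LipschitzOnWith.continuousOn (K := ⟨D.b * B + B2, by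
      have := D.bpos; positivity⟩) ?_ |>.add Mc.continuousOn
    have key : ∀ x ∈ Icc 0 z, ∀ y ∈ Icc 0 z, x ≤ y →
      |y ^ D.b * D.Pf ε t y (V t y) - x ^ D.b * D.Pf ε t x (V t x)| ≤ (D.b * B + B2) * (y - x) := by
      intro x hx y hy hxy
      have hx1 : x < 1 := hx.2.trans_lt hz.2
      have hy1 : y < 1 := hy.2.trans_lt hz.2
      have h2 := hfl t ht x ⟨hx.1, hx1⟩ y ⟨hy.1, hy1⟩ hxy
      have h3 := rpow_lip (b := D.b) (by linarith) hx.1 hxy hy1.le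
      have h4 : 0 ≤ y ^ D.b - x ^ D.b := sub_nonneg.2 (Real.rpow_le_rpow hx.1 hxy D.bpos.le)
      have h5 : |(y ^ D.b - x ^ D.b) / D.b * W 2 t x| ≤ (y - x) * B2 := by
        rw [abs_mul, abs_of_nonneg (div_nonneg h4 D.bpos.le)]
        refine mul_le_mul ?_ (hbd t ht x ⟨hx.1, hx1.le⟩) (abs_nonneg _) (by linarith)
        rw [div_le_iff₀ D.bpos]; linarith
      have h6 : (y ^ D.b - x ^ D.b) * (B * (y - x)) ≤ D.b * (y - x) * B := by
        refine mul_le_mul h3 ?_ (mul_nonneg hB (by linarith)) (mul_nonneg D.bpos.le (by linarith))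
        nlinarith [hx.1]
      have h7 := abs_sub (y ^ D.b * D.Pf ε t y (V t y) - x ^ D.b * D.Pf ε t x (V t x)
            + (y ^ D.b - x ^ D.b) / D.b * W 2 t x) ((y ^ D.b - x ^ D.b) / D.b * W 2 t x)
      rw [add_sub_cancel_right] at h7
      linarith
    refine LipschitzOnWith.of_dist_le_mul fun x hx y hy => ?_
    rw [Real.dist_eq, Real.dist_eq]
    show _ ≤ (D.b * B + B2) * _
    rcases le_total x y with h | h
    · rw [abs_sub_comm, abs_sub_comm x y, abs_of_nonneg (sub_nonneg.2 h)]; exact key x hx y hy h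
    · rw [abs_of_nonneg (sub_nonneg.2 h)]; exact key y hy x hx h
  have h0 := constant_of_has_deriv_right_zero hcon (fun x hx => hder x ⟨hx.1, hx.2.trans hz.2⟩) z
    ⟨hz.1.le, le_rfl⟩
  rw [Real.zero_rpow D.bpos.ne', M0, zero_mul, add_zero, Me z ⟨hz.1.le, hz.2.le⟩,
    ← Aop_eq (by linarith) _ _ hz.1.le] at h0
  have hp : (0:ℝ) < z ^ D.b := Real.rpow_pos_of_pos hz.1 _
  have : z ^ D.b * (D.Pf ε t z (V t z) + Aop D.b (W 2) t z) = 0 := by linarith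
  rcases mul_eq_zero.1 this with h | h
  · exact absurd h hp.ne'
  · linarith

end EulerNM

open MeasureTheory Real Set
open scoped ContDiff

/-! # Part 10: smoothness of the limit -/

namespace EulerNM
open Filter Topology

theorem prim_pz {w v : ℝ → ℝ} (hw : ContinuousOn w (Icc 0 1)) (hv : ContinuousOn v (Icc 0 1))
    (h : ∀ x ∈ Ioo (0:ℝ) 1, HasDerivWithinAt w (-(v x)) (Ici x) x) :
    ∀ z ∈ Icc (0:ℝ) 1, HasDerivWithinAt w (-(v z)) (Icc 0 1) z := by
  obtain ⟨M, M0, Mc, Md, _, Mr, _⟩ := prim hv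
  have hU : ContinuousOn (fun x => w x + M x) (Icc 0 1) := hw.add Mc.continuousOn
  have h1 : ∀ x ∈ Ioc (0:ℝ) 1, w x + M x = w 1 + M 1 := by
    intro x hx
    have := constant_of_has_deriv_right_zero (a := x) (b := 1)
      (hU.mono (Icc_subset_Icc_left hx.1.le)) (fun y hy => by
        have h2 := (h y ⟨hx.1.trans_le hy.1, hy.2⟩).add (Mr y ⟨hx.1.le.trans hy.1, hy.2⟩)
        exact h2.congr_deriv (neg_add_cancel _)) 1 ⟨hx.2, le_rfl⟩
    exact this.symm
  have h2 : EqOn (fun x => w x + M x) (fun _ => w 1 + M 1) (Icc 0 1) := by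
    refine EqOn.of_subset_closure (s := Ioc 0 1) (t := Icc 0 1) h1 hU continuousOn_const
      Ioc_subset_Icc_self ?_
    rw [closure_Ioc (by norm_num)]
  intro z hz
  have h3 : HasDerivWithinAt (fun x => (w 1 + M 1) - M x) (-(v z)) (Icc 0 1) z := by
    simpa using (Md z hz).const_sub (w 1 + M 1)
  exact h3.congr (fun x hx => by have := h2 hx; simp only at this; linarith)
    (by have := h2 hz; simp only at this; linarith)

theorem Dat.regular (D : Dat) {ε C : ℝ} (h0 : ε ≠ 0) {W V} (L : D.Lim ε C W V) :
    ∃ v : ℝ → ℝ → ℝ, CD D.J (Icc 0 1) ∞ (W 0) ∧ (∀ k, PT D.J (Icc 0 1) (W k) (W (k+1))) ∧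
    PZ D.J (Icc 0 1) (W 0) (fun t z => -(v t z)) ∧
    (∀ t ∈ D.J, ∀ z ∈ Icc (0:ℝ) 1, |v t z| ≤ C) ∧
    ∀ t ∈ D.J, ∀ z ∈ Ioo (0:ℝ) 1, HasDerivAt (fun x => x ^ D.b * D.Pf ε t x (v t x))
      (-(z ^ (D.b-1) * W 2 t z)) z := by
  have hb := D.hb
  have hT := D.hT
  have hab : (-1:ℝ) < D.T + 1 := by linarith
  obtain ⟨H, Hs, H1, H2⟩ := D.inv
  have hε2 : ε ^ 2 ≠ 0 := pow_ne_zero 2 h0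
  let ψ : ℝ × ℝ × ℝ → ℝ := fun q =>
    (ε ^ 2)⁻¹ * (H (q.1, ε * D.p q.1 q.2.1 + ε ^ 2 * q.2.2) - ε * D.p q.1 q.2.1)
  have hp : ContDiff ℝ ∞ (fun q : ℝ × ℝ × ℝ => D.p q.1 q.2.1) :=
    D.p_s.comp (contDiff_fst.prodMk (contDiff_fst.comp contDiff_snd))
  have hψ : ContDiff ℝ ∞ ψ := by
    refine contDiff_const.mul ((Hs.comp (contDiff_fst.prodMk ((contDiff_const.mul hp).add
      (contDiff_const.mul (contDiff_snd.comp contDiff_snd))))).sub (contDiff_const.mul hp))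
  let P : ℕ → ℝ → ℝ → ℝ := fun k t z => -(Aop D.b (W (k+2)) t z)
  have hPT : ∀ k, PT D.J (Icc 0 1) (P k) (P (k+1)) := fun k t ht z hz =>
    (Aop_PT (by linarith) (L.jc _) (L.jc _) (L.pt (k+2)) t ht z hz).neg
  let v : ℝ → ℝ → ℝ := fun t z => ψ (t, z, P 0 t z)
  have hPv : ∀ t z, D.Pf ε t z (v t z) = P 0 t z := by
    intro t z
    have e : ε * (D.p t z + ε * v t z) = H (t, ε * D.p t z + ε ^ 2 * P 0 t z) := by
      simp only [v, ψ]; field_simp; ring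
    unfold Dat.Pf Dat.Q
    rw [e]
    have := H2 t (ε * D.p t z + ε ^ 2 * P 0 t z)
    rw [← e] at this ⊢
    generalize D.g (ε * (D.p t z + ε * v t z)) = G at this ⊢
    field_simp
    linear_combination this
  have hVv : ∀ t ∈ D.J, ∀ z ∈ Ioo (0:ℝ) 1, V t z = v t z := by
    intro t ht z hz
    have := D.Pf_mono h0 t z (V t z) (v t z)
    rw [hPv, L.flux_eq ht hz, sub_self, abs_zero, mul_zero] at this
    exact sub_eq_zero.1 (abs_nonpos_iff.1 this)
  have hP0 : CD D.J (Icc 0 1) (0:ℕ) (P 0) :=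
    ContDiffOn.neg (Aop_CD hab 0 (by linarith) (contDiffOn_zero.2 (L.jc 2)))
  have hv0 : ContinuousOn (fun q : ℝ × ℝ => v q.1 q.2) (D.J ×ˢ Icc 0 1) := (hP0.comp3 hψ).cont
  have sl : ∀ {f : ℝ → ℝ → ℝ}, ContinuousOn (fun q : ℝ × ℝ => f q.1 q.2) (D.J ×ˢ Icc 0 1) →
      ∀ t ∈ D.J, ContinuousOn (f t) (Icc 0 1) := fun hf t ht =>
    hf.comp (Continuous.prodMk_right t).continuousOn (fun σ hσ => mk_mem_prod ht hσ)
  have hPZ : PZ D.J (Icc 0 1) (W 0) (fun t z => -(v t z)) := by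
    intro t ht
    refine prim_pz (sl (L.jc 0) t ht) (sl hv0 t ht) fun x hx => ?_
    obtain ⟨B, hB, hst⟩ := L.strain
    rw [← hVv t ht x hx]
    refine right_der hx.2 (der_sq (L := B / x ^ D.b) fun y hy => ?_)
    have := hst t ht x hx y ⟨hx.1.le.trans hy.1, hy.2⟩ hy.1
    rw [← abs_neg]
    calc _ = |W 0 t x - W 0 t y - (y - x) * V t x| := by congr 1; ring
      _ ≤ _ := this
      _ = _ := by ring
  have boot : ∀ m : ℕ, ∀ k, CD D.J (Icc 0 1) m (W k) := by
    intro m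
    induction m with
    | zero => intro k; exact contDiffOn_zero.2 (L.jc k)
    | succ m ih =>
      intro k
      have hPm : ∀ k, CD D.J (Icc 0 1) m (P k) := fun k =>
        ContDiffOn.neg (Aop_CD hab m (by linarith) (ih (k+2)))
      have t1 : TD D.J (Icc 0 1) m k (fun t z => (fun q => -(ψ q)) (t, z, P 0 t z)) :=
        (TD.of_seq k hPm hPT).comp3 hψ.neg
      obtain ⟨u, hu1, hu2⟩ := TD.chain (convex_Icc _ _) (convex_Icc 0 1) (uD hab) k L.pt hPZ t1
      have := CD.succ (convex_Icc _ _) (convex_Icc 0 1) (uD hab) (uD zero_lt_one) (L.pt k) hu2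
        (ih (k+1)) hu1
      rw [show ((m + 1 : ℕ) : WithTop ℕ∞) = (m : WithTop ℕ∞) + 1 by push_cast; rfl]
      exact this
  refine ⟨v, contDiffOn_infty.2 fun m => boot m 0, L.pt, hPZ, ?_, ?_⟩
  · intro t ht z hz
    have hcl : z ∈ closure (Ioo (0:ℝ) 1) := by rwa [closure_Ioo (by norm_num)]
    have hc := (sl (f := v) hv0 t ht).abs
    rw [← closure_Ioo (show (0:ℝ) ≠ 1 by norm_num)] at hc
    refine le_on_closure (f := fun z => |v t z|) (g := fun _ => C) (s := Ioo 0 1)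
      (fun x hx => ?_) hc continuousOn_const hcl
    rw [← hVv t ht x hx]
    exact L.V_le t ht x ⟨hx.1.le, hx.2⟩
  · intro t ht z hz
    have hc : ContinuousOn (fun s => s ^ (D.b-1) * W 2 t s) (Icc 0 1) :=
      (Real.continuous_rpow_const (by linarith)).continuousOn.mul (sl (L.jc 2) t ht)
    obtain ⟨M, _, _, _, Md, _, Me⟩ := prim hc
    refine (Md z hz).neg.congr_of_eventuallyEq ?_
    filter_upwards [Ioo_mem_nhds hz.1 hz.2] with x hx
    rw [hPv]
    show x ^ D.b * -(Aop D.b (W 2) t x) = -(M x)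
    rw [Me x ⟨hx.1.le, hx.2.le⟩, ← Aop_eq (by linarith) _ _ hx.1.le]
    ring

end EulerNM

open MeasureTheory Real Set
open scoped ContDiff

/-! # Part 11: Borel lemma and extension of smooth functions -/

namespace EulerNM
open Filter Topology

theorem bdd_iter {f : ℝ → ℝ} (hf : ContDiff ℝ ∞ f) (hc : HasCompactSupport f) (k : ℕ) :
    ∃ M, 0 ≤ M ∧ ∀ x, |iteratedDeriv k f x| ≤ M := by
  have h1 : Continuous (iteratedDeriv k f) := hf.continuous_iteratedDeriv k (by
    exact_mod_cast le_top)
  have h2 : HasCompactSupport (iteratedDeriv k f) := by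
    induction k with
    | zero => simpa using hc
    | succ k ih =>
      rw [iteratedDeriv_succ]
      exact (ih (hf.continuous_iteratedDeriv k (by exact_mod_cast le_top))).deriv
  obtain ⟨C, hC⟩ := h2.exists_bound_of_continuous h1
  exact ⟨C, (norm_nonneg _).trans (hC 0), fun x => hC x⟩

theorem bump_e (z0 : ℝ) (i : ℕ) {δ : ℝ} (hδ : 0 < δ) :
    ∃ e : ℝ → ℝ, ContDiff ℝ ∞ e ∧ HasCompactSupport e ∧
      (∀ m < i, ∀ z, |iteratedDeriv m e z| ≤ δ) ∧
      ∀ j, iteratedDeriv j e z0 = if j = i then 1 else 0 := by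
  let θ : ContDiffBump (0:ℝ) := ⟨1, 2, by norm_num, by norm_num⟩
  let ψ : ℝ → ℝ := fun z => ((i.factorial : ℝ)⁻¹ * z ^ i) * θ z
  have hψ : ContDiff ℝ ∞ ψ := (contDiff_const.mul (contDiff_id.pow i)).mul θ.contDiff
  have hψc : HasCompactSupport ψ := θ.hasCompactSupport.mul_left
  choose M hM0 hM using bdd_iter hψ hψc
  set B := ∑ m ∈ Finset.range i, M m with hB
  have hB0 : 0 ≤ B := Finset.sum_nonneg fun m _ => hM0 m
  obtain ⟨R, hR1, hR2⟩ : ∃ R : ℝ, 1 ≤ R ∧ B / δ ≤ R := ⟨max 1 (B / δ), le_max_left _ _, le_max_right _ _⟩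
  have hR0 : 0 < R := by linarith
  have hg : ContDiff ℝ ∞ (fun z => ψ (R * z)) := hψ.comp (contDiff_const.mul contDiff_id)
  have hg2 : ContDiff ℝ ∞ (fun z => ψ (R * (z - z0))) :=
    hψ.comp (contDiff_const.mul (contDiff_id.sub contDiff_const))
  have key : ∀ m z, iteratedDeriv m (fun z => (R ^ i)⁻¹ * ψ (R * (z - z0))) z
      = (R ^ i)⁻¹ * (R ^ m * iteratedDeriv m ψ (R * (z - z0))) := by
    intro m z
    rw [iteratedDeriv_const_mul _ (hg2.contDiffAt.of_le (by exact_mod_cast le_top))]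
    congr 1
    have := iteratedDeriv_comp_sub_const m (fun z => ψ (R * z)) z0
    rw [this]
    have h2 := iteratedDeriv_comp_const_mul (n := m) (hψ.of_le (by exact_mod_cast le_top)) R
    rw [h2]
  refine ⟨fun z => (R ^ i)⁻¹ * ψ (R * (z - z0)), contDiff_const.mul hg2, ?_, ?_, ?_⟩
  · apply HasCompactSupport.mul_left
    refine HasCompactSupport.intro (K := Metric.closedBall z0 2) (isCompact_closedBall _ _) ?_
    intro x hx
    have : θ (R * (x - z0)) = 0 := by
      apply θ.zero_of_le_dist
      simp only [Metric.mem_closedBall, not_le, Real.dist_eq] at hx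
      simp only [Real.dist_eq, sub_zero, abs_mul, abs_of_pos hR0]
      show (2:ℝ) ≤ _
      nlinarith [abs_nonneg (x - z0)]
    show _ * θ _ = 0
    rw [this, mul_zero]
  · intro m hm z
    rw [key, abs_mul, abs_mul, abs_of_nonneg (by positivity : 0 ≤ (R ^ i)⁻¹),
      abs_of_nonneg (by positivity : 0 ≤ R ^ m)]
    have h1 : |iteratedDeriv m ψ (R * (z - z0))| ≤ B :=
      (hM m _).trans (Finset.single_le_sum (fun m _ => hM0 m) (Finset.mem_range.2 hm))
    have h2 : R ^ (m + 1) ≤ R ^ i := pow_le_pow_right₀ hR1 hm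
    have h3 : B ≤ δ * R := by rw [div_le_iff₀ hδ] at hR2; linarith
    rw [inv_mul_le_iff₀ (by positivity)]
    calc R ^ m * |iteratedDeriv m ψ (R * (z - z0))| ≤ R ^ m * (δ * R) := by gcongr; linarith
      _ = R ^ (m + 1) * δ := by ring
      _ ≤ R ^ i * δ := by gcongr
  · intro j
    rw [key, sub_self, mul_zero]
    have h1 : ψ =ᶠ[𝓝 0] fun z => (i.factorial : ℝ)⁻¹ * z ^ i := by
      filter_upwards [Metric.closedBall_mem_nhds (0:ℝ) one_pos] with z hz
      have : θ z = 1 := θ.one_of_mem_closedBall hz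
      show _ * θ z = _
      rw [this, mul_one]
    rw [h1.iteratedDeriv_eq j, iteratedDeriv_const_mul _ ((contDiff_id.pow i).contDiffAt)]
    have h2 : iteratedDeriv j (fun z : ℝ => z ^ i) 0 = if j = i then (i.factorial : ℝ) else 0 := by
      rw [iteratedDeriv_fun_pow_zero]
      split_ifs <;> simp
    rw [h2]
    split_ifs with h
    · subst h
      have : (j.factorial : ℝ) ≠ 0 := by positivity
      field_simp
    · simp

theorem comp_lin_bound {L : ℝ × ℝ →L[ℝ] ℝ} (hL : ‖L‖ ≤ 1) {a : ℝ → ℝ} (ha : ContDiff ℝ ∞ a)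
    (k : ℕ) (x : ℝ × ℝ) :
    ‖iteratedFDeriv ℝ k (fun p => a (L p)) x‖ ≤ |iteratedDeriv k a (L x)| := by
  have h := L.iteratedFDeriv_comp_right ha x (i := k) (by exact_mod_cast le_top)
  have h1 : iteratedFDeriv ℝ k (fun p => a (L p)) x = _ := h
  rw [h1]
  refine (ContinuousMultilinearMap.norm_compContinuousLinearMap_le _ _).trans ?_
  rw [norm_iteratedFDeriv_eq_norm_iteratedDeriv, Real.norm_eq_abs]
  have : ∏ _i : Fin k, ‖L‖ ≤ 1 := by
    simpa using pow_le_one₀ (norm_nonneg L) hL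
  exact mul_le_of_le_one_right (abs_nonneg _) this

theorem tensor_bound {a b : ℝ → ℝ} (ha : ContDiff ℝ ∞ a) (hb : ContDiff ℝ ∞ b) {A δ : ℝ} (k : ℕ)
    (hA : ∀ l ≤ k, ∀ t, |iteratedDeriv l a t| ≤ A) (hδ : ∀ l ≤ k, ∀ t, |iteratedDeriv l b t| ≤ δ)
    (x : ℝ × ℝ) :
    ‖iteratedFDeriv ℝ k (fun p : ℝ × ℝ => a p.1 * b p.2) x‖ ≤ 2 ^ k * (A * δ) := by
  have hA0 : 0 ≤ A := (abs_nonneg _).trans (hA 0 (Nat.zero_le _) 0)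
  have h := norm_iteratedFDeriv_mul_le (𝕜 := ℝ) (f := fun p : ℝ × ℝ => a p.1)
    (g := fun p : ℝ × ℝ => b p.2) (ha.comp contDiff_fst) (hb.comp contDiff_snd) x (n := k)
    (by exact_mod_cast le_top)
  refine h.trans ?_
  have : ∑ i ∈ Finset.range (k + 1), (k.choose i : ℝ) * (A * δ) = 2 ^ k * (A * δ) := by
    rw [← Finset.sum_mul]
    congr 1
    exact_mod_cast Nat.sum_range_choose k
  rw [← this]
  refine Finset.sum_le_sum fun i hi => ?_
  have hik : i ≤ k := by have := Finset.mem_range.1 hi; omega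
  have h1 := (comp_lin_bound (L := ContinuousLinearMap.fst ℝ ℝ ℝ)
    (ContinuousLinearMap.norm_fst_le ℝ ℝ ℝ) ha i x).trans (hA i hik _)
  have h2 := (comp_lin_bound (L := ContinuousLinearMap.snd ℝ ℝ ℝ)
    (ContinuousLinearMap.norm_snd_le ℝ ℝ ℝ) hb (k - i) x).trans (hδ (k - i) (by omega) _)
  rw [mul_assoc]
  exact mul_le_mul_of_nonneg_left (mul_le_mul h1 h2 (norm_nonneg _) hA0) (by positivity)

theorem iter_iter (f : ℝ → ℝ) (m j : ℕ) :
    iteratedDeriv m (iteratedDeriv j f) = iteratedDeriv (m + j) f := by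
  simp only [iteratedDeriv_eq_iterate, Function.iterate_add_apply]

theorem iter_smooth {f : ℝ → ℝ} (hf : ContDiff ℝ ∞ f) (j : ℕ) :
    ContDiff ℝ ∞ (iteratedDeriv j f) := by
  induction j with
  | zero => simpa using hf
  | succ j ih =>
    rw [iteratedDeriv_succ]
    exact (contDiff_infty_iff_deriv.1 ih).2

/-- Borel lemma with parameter. -/
theorem borel (z0 : ℝ) (a : ℕ → ℝ → ℝ) (ha : ∀ i, ContDiff ℝ ∞ (a i))
    (hc : ∀ i, HasCompactSupport (a i)) :
    ∃ G : ℕ → ℝ → ℝ → ℝ, (∀ j, CD univ univ ∞ (G j)) ∧ (∀ j, PZ univ univ (G j) (G (j + 1))) ∧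
      ∀ j t, G j t z0 = a j t := by
  choose M hM0 hM using fun i k => bdd_iter (ha i) (hc i) k
  set A : ℕ → ℝ := fun i => 1 + ∑ k ∈ Finset.range i, M i k with hA
  have hA1 : ∀ i, 1 ≤ A i := fun i => by
    have : 0 ≤ ∑ k ∈ Finset.range i, M i k := Finset.sum_nonneg fun k _ => hM0 i k
    simp only [hA]; linarith
  have hAM : ∀ i k, k < i → M i k ≤ A i := fun i k hk => by
    have := Finset.single_le_sum (f := fun k => M i k) (fun k _ => hM0 i k) (Finset.mem_range.2 hk)
    simp only [hA]; linarith
  have hδ : ∀ i, 0 < (1/2:ℝ) ^ i / A i := fun i => by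
    have := hA1 i
    positivity
  choose e e_s e_c e_b e_0 using fun i => bump_e z0 i (hδ i)
  have hbig : ∀ j, ∀ᶠ i : ℕ in cofinite, j < i := by
    intro j
    rw [Nat.cofinite_eq_atTop]
    exact eventually_gt_atTop j
  have hAd : ∀ i, A i * ((1/2:ℝ) ^ i / A i) = (1/2) ^ i := fun i => by
    have := hA1 i
    field_simp
  have hterm : ∀ i j, j < i → ∀ t z, |a i t * iteratedDeriv j (e i) z| ≤ (1/2:ℝ) ^ i := by
    intro i j hji t z
    rw [abs_mul, ← hAd i]
    have h1 : |a i t| ≤ A i := by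
      have := (hM i 0 t).trans (hAM i 0 (by omega))
      simpa using this
    exact mul_le_mul h1 (e_b i j hji z) (abs_nonneg _) (by linarith [hA1 i])
  have hN : ∀ i j, ∃ B, (∀ t z, |a i t * iteratedDeriv j (e i) z| ≤ B) ∧ 0 ≤ B ∧
      (j < i → B ≤ (1/2:ℝ) ^ i) := by
    intro i j
    by_cases h : j < i
    · exact ⟨_, hterm i j h, by positivity, fun _ => le_rfl⟩
    · obtain ⟨B, hB0, hB⟩ := bdd_iter (e_s i) (e_c i) j
      refine ⟨M i 0 * B, fun t z => ?_, mul_nonneg (hM0 _ _) hB0, fun h' => absurd h' h⟩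
      rw [abs_mul]
      have h1 : |a i t| ≤ M i 0 := by simpa using hM i 0 t
      exact mul_le_mul h1 (hB z) (abs_nonneg _) (hM0 _ _)
  choose B hB hB0 hB2 using hN
  have hgeo : Summable fun i : ℕ => (1/2:ℝ) ^ i := summable_geometric_two
  have hBs : ∀ j, Summable fun i => B i j := by
    intro j
    refine Summable.of_norm_bounded_eventually hgeo ?_
    filter_upwards [hbig j] with i hi
    rw [Real.norm_of_nonneg (hB0 i j)]
    exact hB2 i j hi
  refine ⟨fun j t z => ∑' i, a i t * iteratedDeriv j (e i) z, ?_, ?_, ?_⟩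
  · intro j
    refine ContDiff.contDiffOn ?_
    refine contDiff_tsum_of_eventually (𝕜 := ℝ) (N := ⊤)
      (f := fun i (q : ℝ × ℝ) => a i q.1 * iteratedDeriv j (e i) q.2)
      (v := fun k i => 2 ^ k * (1/2:ℝ) ^ i) ?_ ?_ ?_
    · intro i
      exact ((ha i).comp contDiff_fst).mul ((iter_smooth (e_s i) j).comp contDiff_snd)
    · intro k _
      exact hgeo.mul_left _
    · intro k _
      filter_upwards [hbig (k + j)] with i hi x
      have := tensor_bound (ha i) (iter_smooth (e_s i) j) (A := A i) (δ := (1/2:ℝ) ^ i / A i) k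
        (fun l hl t => (hM i l t).trans (hAM i l (by omega)))
        (fun l hl t => by rw [iter_iter]; exact e_b i _ (by omega) t) x
      rwa [hAd] at this
  · intro j t _ z _
    refine HasDerivAt.hasDerivWithinAt ?_
    refine hasDerivAt_tsum (u := fun i => B i (j + 1)) (y₀ := z0) (hBs (j + 1))
      (g := fun i z => a i t * iteratedDeriv j (e i) z)
      (g' := fun i z => a i t * iteratedDeriv (j + 1) (e i) z) ?_ ?_ ?_ z
    · intro i x
      refine HasDerivAt.const_mul _ ?_
      rw [iteratedDeriv_succ]
      exact ((iter_smooth (e_s i) j).differentiable (by simp)).differentiableAt.hasDerivAt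
    · intro i x
      exact hB i (j + 1) t x
    · exact Summable.of_norm_bounded (hBs j) fun i => hB i j t z0
  · intro j t
    simp only [e_0]
    rw [tsum_eq_single j]
    · simp
    · intro i hi
      rw [if_neg (Ne.symm hi), mul_zero]

end EulerNM

open MeasureTheory Real Set
open scoped ContDiff

/-! # Part 12: gluing and extension -/

namespace EulerNM
open Filter Topology

theorem pieces {S : Set ℝ} {z0 z : ℝ} (h : z < z0) : S ∩ Iic z0 ∈ 𝓝[S] z :=
  inter_mem self_mem_nhdsWithin (mem_nhdsWithin_of_mem_nhds (Iic_mem_nhds h))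

theorem pieces2 {S : Set ℝ} {z0 z : ℝ} (h : z0 < z) : S ∩ Ici z0 ∈ 𝓝[S] z :=
  inter_mem self_mem_nhdsWithin (mem_nhdsWithin_of_mem_nhds (Ici_mem_nhds h))

theorem glue_cont {S : Set ℝ} {z0 : ℝ} {f g : ℝ → ℝ → ℝ}
    (hf : ContinuousOn (fun q : ℝ × ℝ => f q.1 q.2) (univ ×ˢ (S ∩ Iic z0)))
    (hg : ContinuousOn (fun q : ℝ × ℝ => g q.1 q.2) (univ ×ˢ (S ∩ Ici z0)))
    (hfg : ∀ t, f t z0 = g t z0) :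
    ContinuousOn (fun q : ℝ × ℝ => if q.2 ≤ z0 then f q.1 q.2 else g q.1 q.2) (univ ×ˢ S) := by
  rw [continuousOn_iff_continuous_domRestrict] at *
  rw [← continuousOn_univ]
  have e : (univ : Set (univ ×ˢ S : Set (ℝ × ℝ))) = {q | q.1.2 ≤ z0} ∪ {q | z0 ≤ q.1.2} := by
    ext q; simpa using le_total q.1.2 z0
  have c2 : Continuous fun q : (univ ×ˢ S : Set (ℝ × ℝ)) => q.1.2 :=
    continuous_snd.comp continuous_subtype_val
  rw [e]
  refine ContinuousOn.union_of_isClosed ?_ ?_ (isClosed_le c2 continuous_const)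
    (isClosed_le continuous_const c2)
  · rw [← continuousOn_iff_continuous_domRestrict] at hf
    have : ContinuousOn (fun q : (univ ×ˢ S : Set (ℝ × ℝ)) => f q.1.1 q.1.2) {q | q.1.2 ≤ z0} :=
      hf.comp (f := Subtype.val) continuous_subtype_val.continuousOn
        (fun q hq => ⟨mem_univ _, q.2.2, hq⟩)
    refine this.congr fun q hq => ?_
    exact if_pos hq
  · rw [← continuousOn_iff_continuous_domRestrict] at hg
    have : ContinuousOn (fun q : (univ ×ˢ S : Set (ℝ × ℝ)) => g q.1.1 q.1.2) {q | z0 ≤ q.1.2} :=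
      hg.comp (f := Subtype.val) continuous_subtype_val.continuousOn
        (fun q hq => ⟨mem_univ _, q.2.2, hq⟩)
    refine this.congr fun q hq => ?_
    by_cases h : q.1.2 ≤ z0
    · have h' : q.1.2 = z0 := le_antisymm h hq
      show (if q.1.2 ≤ z0 then f q.1.1 q.1.2 else g q.1.1 q.1.2) = g q.1.1 q.1.2
      rw [if_pos h, h', hfg]
    · exact if_neg h

theorem glue_pz {S : Set ℝ} {z0 : ℝ} {f g f' g' : ℝ → ℝ → ℝ}
    (hf : PZ univ (S ∩ Iic z0) f f') (hg : PZ univ (S ∩ Ici z0) g g')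
    (hfg : ∀ t, f t z0 = g t z0) (hfg' : ∀ t, f' t z0 = g' t z0) :
    PZ univ S (fun t z => if z ≤ z0 then f t z else g t z)
      (fun t z => if z ≤ z0 then f' t z else g' t z) := by
  intro t _ z hz
  have eL : ∀ x ∈ S ∩ Iic z0, (fun z => if z ≤ z0 then f t z else g t z) x = f t x :=
    fun x hx => if_pos hx.2
  have eR : ∀ x ∈ S ∩ Ici z0, (fun z => if z ≤ z0 then f t z else g t z) x = g t x := by
    intro x hx
    by_cases h : x ≤ z0
    · have h' : x = z0 := le_antisymm h hx.2
      show (if x ≤ z0 then f t x else g t x) = _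
      rw [if_pos h, h', hfg]
    · exact if_neg h
  rcases lt_trichotomy z z0 with h | h | h
  · show HasDerivWithinAt _ (if z ≤ z0 then f' t z else g' t z) S z
    rw [if_pos h.le]
    have hm : z ∈ S ∩ Iic z0 := ⟨hz, h.le⟩
    exact ((hf t trivial z hm).congr eL (eL z hm)).mono_of_mem_nhdsWithin (pieces h)
  · subst h
    show HasDerivWithinAt _ (if z ≤ z then f' t z else g' t z) S z
    rw [if_pos le_rfl]
    have hm : z ∈ S ∩ Iic z := ⟨hz, by simp⟩
    have hm2 : z ∈ S ∩ Ici z := ⟨hz, by simp⟩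
    have h1 := (hf t trivial z hm).congr eL (eL z hm)
    have h2 := (hg t trivial z hm2).congr eR (eR z hm2)
    rw [← hfg'] at h2
    have := h1.union h2
    rwa [← inter_union_distrib_left, Iic_union_Ici, inter_univ] at this
  · show HasDerivWithinAt _ (if z ≤ z0 then f' t z else g' t z) S z
    rw [if_neg (not_le.2 h)]
    have hm : z ∈ S ∩ Ici z0 := ⟨hz, h.le⟩
    exact ((hg t trivial z hm).congr eR (eR z hm)).mono_of_mem_nhdsWithin (pieces2 h)

theorem glue {S : Set ℝ} {z0 : ℝ} (hS : Convex ℝ S) (uS : UniqueDiffOn ℝ S)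
    (u1 : UniqueDiffOn ℝ (S ∩ Iic z0)) (u2 : UniqueDiffOn ℝ (S ∩ Ici z0)) (hz : z0 ∈ S) (n : ℕ) :
    ∀ F G : ℕ → ℝ → ℝ → ℝ, (∀ j, CD univ (S ∩ Iic z0) ∞ (F j)) →
      (∀ j, PZ univ (S ∩ Iic z0) (F j) (F (j + 1))) →
      (∀ j, CD univ (S ∩ Ici z0) ∞ (G j)) →
      (∀ j, PZ univ (S ∩ Ici z0) (G j) (G (j + 1))) →
      (∀ j t, F j t z0 = G j t z0) →
      CD univ S n (fun t z => if z ≤ z0 then F 0 t z else G 0 t z) := by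
  have c1 : Convex ℝ (S ∩ Iic z0) := hS.inter (convex_Iic z0)
  have c2 : Convex ℝ (S ∩ Ici z0) := hS.inter (convex_Ici z0)
  induction n with
  | zero =>
    intro F G hF _ hG _ hFG
    exact contDiffOn_zero.2 (glue_cont (hF 0).cont (hG 0).cont (hFG 0))
  | succ n ih =>
    intro F G hF hFz hG hGz hFG
    choose Ft Fz pF _ cF _ using fun j =>
      CD.partials uniqueDiffOn_univ u1 (m := ∞) (n := ∞) (by rfl) (hF j)
    choose Gt Gz pG _ cG _ using fun j =>
      CD.partials uniqueDiffOn_univ u2 (m := ∞) (n := ∞) (by rfl) (hG j)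
    have zF : ∀ j, PZ univ (S ∩ Iic z0) (Ft j) (Ft (j + 1)) := fun j =>
      comm_tz convex_univ c1 uniqueDiffOn_univ (pF j) (hFz j) (pF (j + 1)) (cF (j + 1)).cont
    have zG : ∀ j, PZ univ (S ∩ Ici z0) (Gt j) (Gt (j + 1)) := fun j =>
      comm_tz convex_univ c2 uniqueDiffOn_univ (pG j) (hGz j) (pG (j + 1)) (cG (j + 1)).cont
    have eq : ∀ j t, Ft j t z0 = Gt j t z0 := by
      intro j t
      have h1 := pF j t trivial z0 ⟨hz, by simp⟩
      have h2 := pG j t trivial z0 ⟨hz, by simp⟩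
      have e : (fun s => F j s z0) = fun s => G j s z0 := funext fun s => hFG j s
      rw [e] at h1
      rw [hasDerivWithinAt_univ] at h1 h2
      exact h1.unique h2
    have k1 := ih Ft Gt cF zF cG zG eq
    have k2 := ih (fun j => F (j + 1)) (fun j => G (j + 1)) (fun j => hF _) (fun j => hFz _)
      (fun j => hG _) (fun j => hGz _) (fun j => hFG _)
    refine CD.succ convex_univ hS uniqueDiffOn_univ uS ?_
      (glue_pz (hFz 0) (hGz 0) (hFG 0) (hFG 1)) k1 k2
    intro t _ z hz'
    show HasDerivWithinAt (fun s => if z ≤ z0 then F 0 s z else G 0 s z)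
      (if z ≤ z0 then Ft 0 t z else Gt 0 t z) univ t
    by_cases h : z ≤ z0
    · simp only [if_pos h]
      exact pF 0 t trivial z ⟨hz', h⟩
    · simp only [if_neg h]
      exact pG 0 t trivial z ⟨hz', (not_le.1 h).le⟩

theorem glue_top {S : Set ℝ} {z0 : ℝ} (hS : Convex ℝ S) (uS : UniqueDiffOn ℝ S)
    (u1 : UniqueDiffOn ℝ (S ∩ Iic z0)) (u2 : UniqueDiffOn ℝ (S ∩ Ici z0)) (hz : z0 ∈ S)
    (F G : ℕ → ℝ → ℝ → ℝ) (hF : ∀ j, CD univ (S ∩ Iic z0) ∞ (F j))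
    (hFz : ∀ j, PZ univ (S ∩ Iic z0) (F j) (F (j + 1)))
    (hG : ∀ j, CD univ (S ∩ Ici z0) ∞ (G j))
    (hGz : ∀ j, PZ univ (S ∩ Ici z0) (G j) (G (j + 1)))
    (hFG : ∀ j t, F j t z0 = G j t z0) :
    CD univ S ∞ (fun t z => if z ≤ z0 then F 0 t z else G 0 t z) :=
  contDiffOn_infty.2 fun n => glue hS uS u1 u2 hz n F G hF hFz hG hGz hFG

theorem CD.mul_t {B : Set ℝ} {η : ℝ → ℝ} (hη : ContDiff ℝ ∞ η) {f : ℝ → ℝ → ℝ}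
    (h : CD univ B ∞ f) : CD univ B ∞ (fun t z => η t * f t z) :=
  ((hη.comp contDiff_fst).contDiffOn).mul h

/-- The full sequence of normal derivatives, multiplied by a cutoff. -/
theorem fam {B : Set ℝ} (uB : UniqueDiffOn ℝ B) {η : ℝ → ℝ} (hη : ContDiff ℝ ∞ η)
    (hc : HasCompactSupport η) {f : ℝ → ℝ → ℝ} (h : CD univ B ∞ f) {z0 : ℝ} (hz : z0 ∈ B) :
    ∃ F : ℕ → ℝ → ℝ → ℝ, (∀ t z, F 0 t z = η t * f t z) ∧ (∀ j, CD univ B ∞ (F j)) ∧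
      (∀ j, PZ univ B (F j) (F (j + 1))) ∧ (∀ j, ContDiff ℝ ∞ (fun t => F j t z0)) ∧
      ∀ j, HasCompactSupport (fun t => F j t z0) := by
  have step : ∀ f : {f : ℝ → ℝ → ℝ // CD univ B ∞ f},
      ∃ g : {f : ℝ → ℝ → ℝ // CD univ B ∞ f}, PZ univ B f.1 g.1 := by
    rintro ⟨f, hf⟩
    obtain ⟨_, fz, _, p, _, c⟩ := CD.partials uniqueDiffOn_univ uB (m := ∞) (n := ∞) (by rfl) hf
    exact ⟨⟨fz, c⟩, p⟩
  choose nx hnx using step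
  let H : ℕ → {f : ℝ → ℝ → ℝ // CD univ B ∞ f} := fun j => nx^[j] ⟨f, h⟩
  have hH : ∀ j, PZ univ B (H j).1 (H (j + 1)).1 := by
    intro j
    have : H (j + 1) = nx (H j) := Function.iterate_succ_apply' nx j _
    rw [this]
    exact hnx _
  refine ⟨fun j t z => η t * (H j).1 t z, fun t z => rfl, fun j => CD.mul_t hη (H j).2, ?_, ?_, ?_⟩
  · intro j t _ z hz
    exact (hH j t trivial z hz).const_mul (η t)
  · intro j
    have h1 : ContDiffOn ℝ ∞ (fun t => (H j).1 t z0) univ :=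
      ContDiffOn.comp (g := fun q : ℝ × ℝ => (H j).1 q.1 q.2) (f := fun t : ℝ => (t, z0)) (H j).2
        (contDiff_id.prodMk contDiff_const).contDiffOn (fun t _ => ⟨trivial, hz⟩)
    exact hη.mul (contDiffOn_univ.1 h1)
  · intro j
    exact hc.mul_right

theorem ext_left {S : Set ℝ} {z0 : ℝ} (hS : Convex ℝ S) (uS : UniqueDiffOn ℝ S)
    (u1 : UniqueDiffOn ℝ (S ∩ Iic z0)) (u2 : UniqueDiffOn ℝ (S ∩ Ici z0)) (hz : z0 ∈ S)
    {η : ℝ → ℝ} (hη : ContDiff ℝ ∞ η) (hc : HasCompactSupport η) {f : ℝ → ℝ → ℝ}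
    (h : CD univ (S ∩ Ici z0) ∞ f) :
    ∃ g, CD univ S ∞ g ∧ ∀ t, ∀ z ∈ S ∩ Ici z0, g t z = η t * f t z := by
  obtain ⟨F, F0, Fc, Fz, Fs, Fk⟩ := fam u2 hη hc h (z0 := z0) ⟨hz, by simp⟩
  obtain ⟨G, Gc, Gz, G0⟩ := borel z0 (fun j t => F j t z0) Fs Fk
  refine ⟨_, glue_top hS uS u1 u2 hz G F (fun j => (Gc j).mono (prod_mono_right (subset_univ _)))
    (fun j t ht z hz => (Gz j t ht z trivial).mono (subset_univ _)) Fc Fz G0, ?_⟩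
  intro t z hz
  by_cases h : z ≤ z0
  · have h' : z = z0 := le_antisymm h hz.2
    show (if z ≤ z0 then G 0 t z else F 0 t z) = _
    rw [if_pos h, h', G0, F0]
  · show (if z ≤ z0 then G 0 t z else F 0 t z) = _
    rw [if_neg h, F0]

theorem ext_right {S : Set ℝ} {z0 : ℝ} (hS : Convex ℝ S) (uS : UniqueDiffOn ℝ S)
    (u1 : UniqueDiffOn ℝ (S ∩ Iic z0)) (u2 : UniqueDiffOn ℝ (S ∩ Ici z0)) (hz : z0 ∈ S)
    {η : ℝ → ℝ} (hη : ContDiff ℝ ∞ η) (hc : HasCompactSupport η) {f : ℝ → ℝ → ℝ}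
    (h : CD univ (S ∩ Iic z0) ∞ f) :
    ∃ g, CD univ S ∞ g ∧ ∀ t, ∀ z ∈ S ∩ Iic z0, g t z = η t * f t z := by
  obtain ⟨F, F0, Fc, Fz, Fs, Fk⟩ := fam u1 hη hc h (z0 := z0) ⟨hz, by simp⟩
  obtain ⟨G, Gc, Gz, G0⟩ := borel z0 (fun j t => F j t z0) Fs Fk
  refine ⟨_, glue_top hS uS u1 u2 hz F G Fc Fz
    (fun j => (Gc j).mono (prod_mono_right (subset_univ _)))
    (fun j t ht z hz => (Gz j t ht z trivial).mono (subset_univ _)) (fun j t => (G0 j t).symm), ?_⟩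
  intro t z hz
  show (if z ≤ z0 then F 0 t z else G 0 t z) = _
  have hz2 : z ≤ z0 := hz.2
  rw [if_pos hz2, F0]

theorem extension {T : ℝ} (hT : 0 < T) {f : ℝ → ℝ → ℝ}
    (h : CD (Icc (-1) (T + 1)) (Icc 0 1) ∞ f) :
    ∃ g : ℝ → ℝ → ℝ, ContDiff ℝ ∞ (fun q : ℝ × ℝ => g q.1 q.2) ∧
      ∀ t ∈ Icc (-(1/2)) (T + 1/2), ∀ z ∈ Icc (0:ℝ) 1, g t z = f t z := by
  let η : ContDiffBump (T/2) := ⟨T/2 + 1/2, T/2 + 3/4, by linarith, by linarith⟩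
  have η1 : ∀ t ∈ Icc (-(1/2)) (T + 1/2), η t = 1 := by
    intro t ht
    apply η.one_of_mem_closedBall
    rw [Metric.mem_closedBall, Real.dist_eq, abs_le]
    exact ⟨by show -(T/2+1/2) ≤ _; linarith [ht.1], by show _ ≤ T/2+1/2; linarith [ht.2]⟩
  have c0 : CD univ (Icc 0 1) ∞ (fun t z => η t * f t z) := by
    rintro ⟨t, z⟩ ⟨_, hz⟩
    by_cases ht : t ∈ Ioo (-1) (T + 1)
    · have h1 : ContDiffWithinAt ℝ ∞ (fun q : ℝ × ℝ => f q.1 q.2) (univ ×ˢ Icc 0 1) (t, z) := by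
        refine (h (t, z) ⟨Ioo_subset_Icc_self ht, hz⟩).mono_of_mem_nhdsWithin ?_
        rw [nhdsWithin_prod_eq, nhdsWithin_univ]
        exact prod_mem_prod (Icc_mem_nhds ht.1 ht.2) self_mem_nhdsWithin
      exact (η.contDiff.comp contDiff_fst).contDiffWithinAt.mul h1
    · have h2 : ∀ᶠ q : ℝ × ℝ in 𝓝 (t, z), η q.1 * f q.1 q.2 = 0 := by
        have h3 : T/2 + 3/4 < dist t (T/2) := by
          rw [Real.dist_eq, lt_abs]
          by_contra hcon
          push Not at hcon
          exact ht ⟨by linarith, by linarith⟩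
        have h4 : ∀ᶠ s in 𝓝 t, T/2 + 3/4 < dist s (T/2) :=
          (continuous_id.dist continuous_const).continuousAt.eventually (lt_mem_nhds h3)
        filter_upwards [(continuous_fst.continuousAt (x := (t, z))).eventually h4] with q hq
        rw [η.zero_of_le_dist hq.le, zero_mul]
      refine ContDiffAt.contDiffWithinAt ?_
      exact (contDiffAt_const (c := (0:ℝ))).congr_of_eventuallyEq h2
  have e1 : (Iic (1:ℝ)) ∩ Ici 0 = Icc 0 1 := by rw [inter_comm]; rfl
  have e2 : (univ : Set ℝ) ∩ Iic 1 = Iic 1 := univ_inter _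
  have e3 : (univ : Set ℝ) ∩ Ici 1 = Ici 1 := univ_inter _
  have e4 : (Iic (1:ℝ)) ∩ Iic 0 = Iic 0 := by
    rw [inter_eq_right]; exact Iic_subset_Iic.2 zero_le_one
  rw [← e1] at c0
  obtain ⟨g1, cg1, hg1⟩ := ext_left (z0 := 0) (convex_Iic (1:ℝ)) (uniqueDiffOn_Iic 1)
    (by rw [e4]; exact uniqueDiffOn_Iic 0) (by rw [e1]; exact uniqueDiffOn_Icc one_pos)
    (by simp) η.contDiff η.hasCompactSupport c0
  rw [← e2] at cg1
  obtain ⟨g2, cg2, hg2⟩ := ext_right (z0 := 1) (convex_univ (𝕜 := ℝ) (E := ℝ)) uniqueDiffOn_univ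
    (by rw [e2]; exact uniqueDiffOn_Iic 1) (by rw [e3]; exact uniqueDiffOn_Ici 1)
    trivial η.contDiff η.hasCompactSupport cg1
  refine ⟨g2, ?_, ?_⟩
  · have : ContDiffOn ℝ ∞ (fun q : ℝ × ℝ => g2 q.1 q.2) (univ ×ˢ univ) := cg2
    rw [univ_prod_univ] at this
    exact contDiffOn_univ.1 this
  · intro t ht z hz
    rw [hg2 t z (by rw [e2]; exact hz.2), hg1 t z (by rw [e1]; exact hz), η1 t ht]
    ring

end EulerNM

open MeasureTheory Real Set
open scoped ContDiff

/-! # Part 13: the special function and the truncated nonlinearity -/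

namespace EulerNM
open Filter Topology

/-- The entire function `Φ` with parameter `β`. -/
noncomputable def Ph (β : ℝ) (X : ℝ) : ℝ :=
  ∑' k : ℕ, (-1 : ℝ) ^ k * X ^ k / ((k.factorial : ℝ) * Real.Gamma (β + k))

theorem Gamma_mono_nat {β : ℝ} (hβ : 1 ≤ β) (k : ℕ) : Real.Gamma β ≤ Real.Gamma (β + k) := by
  induction k with
  | zero => simp
  | succ k ih =>
    have h : β + ((k + 1 : ℕ) : ℝ) = (β + k) + 1 := by push_cast; ring
    have hk : (0:ℝ) ≤ k := Nat.cast_nonneg k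
    rw [h, Real.Gamma_add_one (by linarith)]
    have := Real.Gamma_pos_of_pos (show 0 < β + k by linarith)
    nlinarith

theorem Ph_term_le {β : ℝ} (hβ : 1 ≤ β) (X : ℝ) (k : ℕ) :
    |(-1 : ℝ) ^ k * X ^ k / ((k.factorial : ℝ) * Real.Gamma (β + k))|
      ≤ |X| ^ k / k.factorial * (Real.Gamma β)⁻¹ := by
  have h0 := Real.Gamma_pos_of_pos (show 0 < β by linarith)
  have h1 := Gamma_mono_nat hβ k
  have h2 : (0:ℝ) < k.factorial := by positivity
  rw [abs_div, abs_mul, abs_pow, abs_neg, abs_one, one_pow, one_mul, abs_pow, abs_mul,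
    abs_of_pos h2, abs_of_pos (h0.trans_le h1), div_mul_eq_div_div, ← div_eq_mul_inv]
  gcongr

theorem Ph_summable {β : ℝ} (hβ : 1 ≤ β) (X : ℝ) :
    Summable fun k : ℕ => (-1 : ℝ) ^ k * X ^ k / ((k.factorial : ℝ) * Real.Gamma (β + k)) :=
  Summable.of_norm_bounded ((Real.summable_pow_div_factorial |X|).mul_right _)
    (fun k => Ph_term_le hβ X k)

theorem Ph_deriv {β : ℝ} (hβ : 1 ≤ β) (X : ℝ) : HasDerivAt (Ph β) (-(Ph (β + 1) X)) X := by
  set R := |X| + 1 with hR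
  have hR0 : 0 < R := by positivity
  let g : ℕ → ℝ → ℝ := fun k X => (-1 : ℝ) ^ k * X ^ k / ((k.factorial : ℝ) * Real.Gamma (β + k))
  let g' : ℕ → ℝ → ℝ := fun k X =>
    (-1 : ℝ) ^ k * (k * X ^ (k - 1)) / ((k.factorial : ℝ) * Real.Gamma (β + k))
  have gs : ∀ k X, g' (k + 1) X
      = -((-1 : ℝ) ^ k * X ^ k / ((k.factorial : ℝ) * Real.Gamma (β + 1 + k))) := by
    intro k X
    have e : β + ((k + 1 : ℕ) : ℝ) = β + 1 + k := by push_cast; ring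
    have hk : (0:ℝ) ≤ k := Nat.cast_nonneg k
    have h0 := Real.Gamma_pos_of_pos (show 0 < β + 1 + k by linarith)
    have h2 : (0:ℝ) < k.factorial := by positivity
    simp only [g']
    rw [e, Nat.factorial_succ]
    push_cast
    have h3 : (k:ℝ) + 1 ≠ 0 := by positivity
    field_simp
    ring
  let u : ℕ → ℝ := fun k =>
    match k with
    | 0 => 0
    | k + 1 => R ^ k / k.factorial * (Real.Gamma (β + 1))⁻¹
  have hu : Summable u := by
    rw [← summable_nat_add_iff 1]
    exact (Real.summable_pow_div_factorial R).mul_right _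
  have h := hasDerivAt_tsum_of_isPreconnected (𝕜 := ℝ) (t := Metric.ball (0:ℝ) R) (g := g)
    (g' := g') (u := u) (y₀ := 0) hu Metric.isOpen_ball (convex_ball (0:ℝ) R).isPreconnected ?_ ?_
    (Metric.mem_ball_self hR0) (Ph_summable hβ 0)
    (y := X) (by simp [hR])
  · have e : ∑' k, g' k X = -(Ph (β + 1) X) := by
      have hs : Summable fun k => g' k X := by
        rw [← summable_nat_add_iff 1]
        simp only [gs]
        exact (Ph_summable (by linarith) X).neg
      rw [hs.tsum_eq_zero_add]
      simp only [gs, tsum_neg]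
      simp [g', Ph]
    rw [e] at h
    exact h
  · intro k y _
    exact (((hasDerivAt_pow k y).const_mul _).div_const _)
  · intro k y hy
    have hy' : |y| ≤ R := by simpa [Real.dist_eq] using (Metric.mem_ball.1 hy).le
    cases k with
    | zero => simp [g', u]
    | succ k =>
      rw [gs, norm_neg]
      refine (Ph_term_le (by linarith) y k).trans ?_
      have := Real.Gamma_pos_of_pos (show 0 < β + 1 by linarith)
      simp only [u]
      gcongr

theorem Ph_smooth {β : ℝ} (hβ : 1 ≤ β) : ContDiff ℝ ∞ (Ph β) := by
  rw [contDiff_infty]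
  intro n
  induction n generalizing β with
  | zero =>
    exact contDiff_zero.2 (continuous_iff_continuousAt.2 fun x => (Ph_deriv hβ x).continuousAt)
  | succ n ih =>
    push_cast
    rw [contDiff_succ_iff_deriv]
    refine ⟨fun x => (Ph_deriv hβ x).differentiableAt, by simp, ?_⟩
    have : deriv (Ph β) = fun x => -(Ph (β + 1) x) := funext fun x => (Ph_deriv hβ x).deriv
    rw [this]
    exact (ih (by linarith)).neg

theorem Ph_ode {β : ℝ} (hβ : 1 ≤ β) (X : ℝ) :
    X * Ph (β + 1 + 1) X - β * Ph (β + 1) X + Ph β X = 0 := by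
  have s0 := Ph_summable hβ X
  have s1 := Ph_summable (β := β + 1) (by linarith) X
  have s2 := Ph_summable (β := β + 1 + 1) (by linarith) X
  let d : ℕ → ℝ := fun k => (-1 : ℝ) ^ k * X ^ k / ((k.factorial : ℝ) * Real.Gamma (β + k))
    - β * ((-1 : ℝ) ^ k * X ^ k / ((k.factorial : ℝ) * Real.Gamma (β + 1 + k)))
  have hd : Summable d := s0.sub (s1.mul_left β)
  have e1 : Ph β X - β * Ph (β + 1) X = ∑' k, d k := by
    unfold Ph
    rw [← tsum_mul_left, ← (s0.tsum_sub (s1.mul_left β))]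
  have hdk : ∀ k : ℕ, d k = (-1 : ℝ) ^ k * X ^ k * k / ((k.factorial : ℝ) * Real.Gamma (β + 1 + k)) := by
    intro k
    have hk : (0:ℝ) ≤ k := Nat.cast_nonneg k
    have e : β + 1 + (k:ℝ) = (β + k) + 1 := by ring
    have h0 := Real.Gamma_pos_of_pos (show 0 < β + k by linarith)
    have h2 : (0:ℝ) < k.factorial := by positivity
    have h3 : β + k ≠ 0 := by positivity
    simp only [d]
    rw [e, Real.Gamma_add_one h3]
    field_simp
    ring
  have e2 : ∑' k, d k = -(X * Ph (β + 1 + 1) X) := by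
    rw [hd.tsum_eq_zero_add, hdk 0]
    unfold Ph
    rw [← tsum_mul_left, ← tsum_neg]
    simp only [Nat.cast_zero, mul_zero, zero_div, zero_add]
    refine tsum_congr fun k => ?_
    rw [hdk]
    have e : β + 1 + ((k + 1 : ℕ) : ℝ) = β + 1 + 1 + k := by push_cast; ring
    have hk : (0:ℝ) ≤ k := Nat.cast_nonneg k
    have h0 := Real.Gamma_pos_of_pos (show 0 < β + 1 + 1 + k by linarith)
    have h2 : (0:ℝ) < k.factorial := by positivity
    rw [e, Nat.factorial_succ]
    push_cast
    have h3 : (k:ℝ) + 1 ≠ 0 := by positivity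
    field_simp
    ring
  linarith

theorem trunc {g : ℝ → ℝ} (hg : ContDiffOn ℝ ∞ g (Ioo (-1) 1)) (g0 : g 0 = 0)
    (g0d : deriv g 0 = 0) :
    ∃ r, 0 < r ∧ r < 1 ∧ ∃ h : ℝ → ℝ, ContDiff ℝ ∞ h ∧ HasCompactSupport h ∧
      (∀ x, |deriv h x| ≤ 1/2) ∧ h 0 = 0 ∧ deriv h 0 = 0 ∧ ∀ x, |x| ≤ r → h x = g x := by
  let θ : ContDiffBump (0:ℝ) := ⟨1, 2, by norm_num, by norm_num⟩
  obtain ⟨M, hM0, hM⟩ := bdd_iter θ.contDiff θ.hasCompactSupport 1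
  simp only [iteratedDeriv_one] at hM
  have hdg : ContinuousOn (deriv g) (Ioo (-1) 1) :=
    hg.continuousOn_deriv_of_isOpen isOpen_Ioo (by simp)
  have hdiff : ∀ x ∈ Ioo (-1:ℝ) 1, HasDerivAt g (deriv g x) x := fun x hx =>
    ((hg.differentiableOn (by simp)).differentiableAt (isOpen_Ioo.mem_nhds hx)).hasDerivAt
  set δ : ℝ := 1 / (2 * (2 * M + 1)) with hδ
  have hδ0 : 0 < δ := by positivity
  have hcd := hdg.continuousAt (isOpen_Ioo.mem_nhds (by norm_num : (0:ℝ) ∈ Ioo (-1) 1))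
  obtain ⟨ρ, hρ, H⟩ := Metric.continuousAt_iff.1 hcd δ hδ0
  set r := min (ρ / 4) (1 / 4) with hr
  have hr0 : 0 < r := by positivity
  have hr1 : r ≤ 1/4 := min_le_right _ _
  have hr2 : r ≤ ρ/4 := min_le_left _ _
  have hin : ∀ x, |x| ≤ 2 * r → x ∈ Ioo (-1:ℝ) 1 := fun x hx => by
    have := abs_le.1 hx
    exact ⟨by linarith [this.1], by linarith [this.2]⟩
  have hd' : ∀ x, |x| ≤ 2 * r → |deriv g x| ≤ δ := fun x hx => by
    have := H (x := x) (by rw [Real.dist_eq, sub_zero]; linarith)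
    rw [g0d, Real.dist_eq, sub_zero] at this
    exact this.le
  have hgb : ∀ x, |x| ≤ 2 * r → |g x| ≤ δ * |x| := fun x hx => by
    have h1 : x ∈ Icc (-(2*r)) (2*r) := abs_le.1 hx
    have := (convex_Icc (-(2*r)) (2*r)).norm_image_sub_le_of_norm_hasDerivWithin_le (f := g)
      (f' := deriv g) (C := δ) (x := 0) (y := x)
      (fun y hy => (hdiff y (hin y (abs_le.2 hy))).hasDerivWithinAt)
      (fun y hy => hd' y (abs_le.2 hy)) ⟨by linarith, by linarith⟩ h1
    simpa [g0] using this
  let h : ℝ → ℝ := fun x => θ (x / r) * g x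
  have hz : ∀ x, 2 * r ≤ |x| → θ (x / r) = 0 := fun x hx => by
    apply θ.zero_of_le_dist
    rw [Real.dist_eq, sub_zero, abs_div, abs_of_pos hr0]
    show (2:ℝ) ≤ _
    rw [le_div_iff₀ hr0]; exact hx
  have hone : ∀ x, |x| ≤ r → θ (x / r) = 1 := fun x hx => by
    apply θ.one_of_mem_closedBall
    rw [Metric.mem_closedBall, Real.dist_eq, sub_zero, abs_div, abs_of_pos hr0]
    show _ ≤ (1:ℝ)
    rw [div_le_iff₀ hr0]; linarith
  have hout : ∀ x, 2 * r < |x| → h =ᶠ[𝓝 x] fun _ => 0 := fun x hx => by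
    filter_upwards [(continuous_abs.continuousAt (x := x)).eventually (lt_mem_nhds hx)] with y hy
    show θ (y / r) * g y = 0
    rw [hz y hy.le, zero_mul]
  have hθs : ContDiff ℝ ∞ fun x => θ (x / r) := θ.contDiff.comp (contDiff_id.div_const r)
  have hs : ContDiff ℝ ∞ h := by
    rw [contDiff_iff_contDiffAt]
    intro x
    by_cases hx : |x| ≤ 2 * r
    · exact hθs.contDiffAt.mul (hg.contDiffAt (isOpen_Ioo.mem_nhds (hin x hx)))
    · exact contDiffAt_const.congr_of_eventuallyEq (hout x (not_le.1 hx))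
  have hder : ∀ x, |x| ≤ 2 * r →
      deriv h x = deriv θ (x / r) * (1 / r) * g x + θ (x / r) * deriv g x := by
    intro x hx
    have h1 : HasDerivAt θ (deriv θ (x / r)) (x / r) :=
      (θ.contDiff (n := 1)).differentiable (by simp) |>.differentiableAt.hasDerivAt
    have h2 : HasDerivAt (fun x => θ (x / r)) (deriv θ (x / r) * (1 / r)) x :=
      HasDerivAt.comp (h₂ := θ) (h := fun x => x / r) x h1 ((hasDerivAt_id x).div_const r)
    exact (h2.mul (hdiff x (hin x hx))).deriv
  refine ⟨r, hr0, by linarith, h, hs, ?_, ?_, ?_, ?_, ?_⟩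
  · refine HasCompactSupport.intro (K := Metric.closedBall 0 (2 * r)) (isCompact_closedBall _ _) ?_
    intro x hx
    rw [Metric.mem_closedBall, Real.dist_eq, sub_zero, not_le] at hx
    exact (hout x hx).eq_of_nhds
  · intro x
    by_cases hx : |x| ≤ 2 * r
    · rw [hder x hx]
      have b1 := hM (x / r)
      have b2 := hgb x hx
      have b3 := hd' x hx
      have b4 : |θ (x / r)| ≤ 1 := by rw [abs_of_nonneg θ.nonneg]; exact θ.le_one
      calc _ ≤ |deriv θ (x / r) * (1 / r) * g x| + |θ (x / r) * deriv g x| := abs_add_le _ _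
        _ = |deriv θ (x / r)| * (1 / r) * |g x| + |θ (x / r)| * |deriv g x| := by
            rw [abs_mul, abs_mul, abs_mul, abs_of_pos (by positivity : 0 < 1 / r)]
        _ ≤ M * (1 / r) * (δ * (2 * r)) + 1 * δ := by
            gcongr
            exact b2.trans (by gcongr)
        _ = δ * (2 * M + 1) := by field_simp
        _ = 1/2 := by rw [hδ]; field_simp
        _ ≤ 1/2 := le_rfl
    · rw [(hout x (not_le.1 hx)).deriv_eq]
      simp
  · show _ * g 0 = 0
    rw [g0, mul_zero]
  · rw [hder 0 (by simpa using hr0.le), g0, g0d]; simp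
  · intro x hx
    show θ (x / r) * g x = _
    rw [hone x hx, one_mul]

end EulerNM

open MeasureTheory Real Set
open scoped ContDiff

/-! # Part 14: the final assembly -/

namespace EulerNM
open Filter Topology

theorem Gfun_zero (N : ℝ) : Gfun N 0 = 0 := by simp [Gfun]

theorem Gfun_hasDeriv {N : ℝ} (hN : 4 ≤ N) {v : ℝ} (hv : -1 < v) :
    HasDerivAt (Gfun N) ((1 + v) ^ (-(N / (N - 2)) - 1)) v := by
  have h0 : N / (N - 2) ≠ 0 := by
    have : 0 < N - 2 := by linarith
    positivity
  have h1 : HasDerivAt (fun v : ℝ => 1 + v) 1 v := (hasDerivAt_id v).const_add 1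
  have h2 := (((h1.rpow_const (p := -(N / (N - 2))) (Or.inl (by linarith))).const_sub 1).const_mul
    (1 / (N / (N - 2))))
  refine h2.congr_deriv ?_
  generalize N / (N - 2) = γ at *
  field_simp

theorem Gfun_smooth (N : ℝ) : ContDiffOn ℝ ∞ (fun x => Gfun N x - x) (Ioo (-1) 1) := by
  refine ContDiffOn.sub ?_ contDiffOn_id
  refine contDiffOn_const.mul (contDiffOn_const.sub ?_)
  intro x hx
  exact ((contDiff_const.add contDiff_id).contDiffWithinAt (s := Ioo (-1) 1)).rpow_const_of_ne
    (by have := hx.1; simp only [id]; linarith)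

/-- Pointwise conversion of the flux equation to the required form. -/
theorem core {N : ℝ} (hN : 4 ≤ N) {ε z : ℝ} (hε : ε ≠ 0) (hz : 0 < z) {v p X : ℝ → ℝ}
    {X' p' W lp : ℝ} (hX : X =ᶠ[𝓝 z] fun x => ε * (p x + ε * v x))
    (hX' : HasDerivAt X X' z) (hp : HasDerivAt p p' z) (hX1 : -1 < X z)
    (hfl : HasDerivAt (fun x => x ^ (N / 2) * (v x + (ε ^ 2)⁻¹ * (Gfun N (X x) - X x)))
      (-(z ^ (N / 2 - 1) * W)) z)
    (hpe : z * p' + N / 2 * p z = lp) :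
    -(ε * lp) + ε ^ 2 * W - (z * (-X') + (N / 2) * (-(X z)))
      = (deriv (Gfun N) (X z) - 1) * (z * (-X') + (N / 2) * (-(X z)))
        + (N / 2) * (X z * deriv (Gfun N) (X z) - Gfun N (X z)) := by
  have hG : HasDerivAt (Gfun N) (deriv (Gfun N) (X z)) (X z) :=
    (Gfun_hasDeriv hN hX1).differentiableAt.hasDerivAt
  set G' := deriv (Gfun N) (X z)
  have e : (fun x => x ^ (N / 2) * (v x + (ε ^ 2)⁻¹ * (Gfun N (X x) - X x)))
      =ᶠ[𝓝 z] fun x => x ^ (N / 2) * ((ε ^ 2)⁻¹ * (Gfun N (X x) - ε * p x)) := by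
    filter_upwards [hX] with x hx
    congr 1
    rw [show v x = (ε ^ 2)⁻¹ * (X x - ε * p x) by rw [hx]; field_simp; ring]
    ring
  have h1 := hfl.congr_of_eventuallyEq e.symm
  have h2 : HasDerivAt (fun x => x ^ (N / 2) * ((ε ^ 2)⁻¹ * (Gfun N (X x) - ε * p x)))
      ((1 * (N / 2) * z ^ (N / 2 - 1)) * ((ε ^ 2)⁻¹ * (Gfun N (X z) - ε * p z))
        + z ^ (N / 2) * ((ε ^ 2)⁻¹ * (G' * X' - ε * p'))) z :=
    ((hasDerivAt_id z).rpow_const (Or.inl hz.ne')).mul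
      (((hG.comp z hX').sub (hp.const_mul ε)).const_mul _)
  have h3 := h1.unique h2
  have hzp : 0 < z ^ (N / 2 - 1) := Real.rpow_pos_of_pos hz _
  have hzz : z ^ (N / 2) = z ^ (N / 2 - 1) * z := by
    rw [Real.rpow_sub_one hz.ne']; field_simp
  rw [hzz] at h3
  have h4 : -(ε ^ 2 * W) = (N / 2) * (Gfun N (X z) - ε * p z) + z * (G' * X' - ε * p') := by
    have h5 : z ^ (N / 2 - 1) * (-(ε ^ 2 * W))
        = z ^ (N / 2 - 1) * ((N / 2) * (Gfun N (X z) - ε * p z) + z * (G' * X' - ε * p')) := by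
      have : ε ^ 2 * (-(z ^ (N / 2 - 1) * W)) = ε ^ 2 * ((1 * (N / 2) * z ^ (N / 2 - 1)) *
        ((ε ^ 2)⁻¹ * (Gfun N (X z) - ε * p z))
        + z ^ (N / 2 - 1) * z * ((ε ^ 2)⁻¹ * (G' * X' - ε * p'))) := by rw [h3]
      field_simp at this ⊢
      linarith
    exact mul_left_cancel₀ hzp.ne' h5
  rw [← hpe]
  linear_combination -h4

end EulerNM

open MeasureTheory Real Set
open scoped ContDiff

namespace EulerNM
open Filter Topology

theorem final_aux {N : ℝ} (hN : 4 ≤ N) {lam T : ℝ} (hT : 0 < T) {s s1 φ φ1 φ2 : ℝ → ℝ}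
    (s_d : ∀ t, HasDerivAt s (s1 t) t) (s1_d : ∀ t, HasDerivAt s1 (-(lam * s t)) t)
    (φ_d : ∀ z, HasDerivAt φ (-(φ1 z)) z) (dphi1 : ∀ z, HasDerivAt φ1 (-(φ2 z)) z)
    (φ_ode : ∀ z, z * (-(φ2 z)) + N / 2 * φ1 z = lam * φ z)
    (s_s : ContDiff ℝ ∞ s) (φ_s : ContDiff ℝ ∞ φ) (hphi1 : φ 1 = 0)
    (s_le : ∀ t, |s t| ≤ 1) {P : ℝ} (hP : ∀ z ∈ Icc (0:ℝ) 1, ‖φ1 z‖ ≤ P) (hP0 : 0 ≤ P)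
    {r : ℝ} (hr0 : 0 < r) (hr1 : r < 1) (D : Dat) (Db : D.b = N / 2) (DT : D.T = T)
    (Dchi : ∀ t, 0 ≤ t → D.chi t = 1) (Dp : ∀ t z, D.p t z = s t * φ1 z)
    (hgr : ∀ x, |x| ≤ r → D.g x = Gfun N x - x) :
      ∃ ε₁ > (0:ℝ), ∃ C > (0:ℝ), ∀ ε : ℝ, |ε| ≤ ε₁ →
        ∃ y : ℝ → ℝ → ℝ,
          ContDiff ℝ (⊤ : ℕ∞) (fun p : ℝ × ℝ => y p.1 p.2) ∧
          (∀ t ∈ Icc (0:ℝ) T, y t 1 = 0) ∧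
          (∀ t ∈ Icc (0:ℝ) T, ∀ z ∈ Icc (0:ℝ) 1, |deriv (y t) z| < 1) ∧
          (∀ t ∈ Icc (0:ℝ) T, ∀ z ∈ Ioo (0:ℝ) 1,
            dt (dt y) t z - Del N (y t) z
              = GI N (-(deriv (y t) z)) * Del N (y t) z + GII N (-(deriv (y t) z))) ∧
          (∀ t ∈ Icc (0:ℝ) T, ∀ z ∈ Icc (0:ℝ) 1,
            |y t z - ε * (s t * φ z)|
              ≤ C * ε ^ 2) := by
  obtain ⟨ε0, hε0, hε01, C, hC, hL⟩ := D.limit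
  refine ⟨min ε0 (r / (2 * (P + C + 1))), by positivity, C + 1, by linarith, ?_⟩
  intro ε hε
  by_cases e0 : ε = 0
  · subst e0
    refine ⟨fun _ _ => 0, contDiff_const, fun _ _ => rfl, ?_, ?_, ?_⟩
    · intro t _ z _; simp
    · intro t _ z _
      simp [dt, Del, GII, Gfun_zero]
    · intro t _ z _; simp
  obtain ⟨W, V, L⟩ := hL ε e0 (hε.trans (min_le_left _ _))
  obtain ⟨v, cW, ptW, pzW, vle, hfl⟩ := D.regular e0 L
  have hJe : D.J = Icc (-1) (T + 1) := by rw [← DT]; rfl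
  obtain ⟨w, w_s, w_eq⟩ := extension hT (f := W 0) (hJe ▸ cW)
  have hsmall : |ε| * (P + C) < r := by
    have h1 := hε.trans (min_le_right _ _)
    have h2 : |ε| * (2 * (P + C + 1)) ≤ r := by rwa [le_div_iff₀ (by positivity)] at h1
    have h3 : 0 < |ε| := abs_pos.2 e0
    nlinarith
  have hJ : ∀ t ∈ Icc (-(1/2)) (T + 1/2), t ∈ D.J := fun t ht =>
    by rw [hJe]; exact ⟨by linarith [ht.1], by linarith [ht.2]⟩
  have hT2 : ∀ t ∈ Icc 0 T, t ∈ Ioo (-(1/2)) (T + 1/2) := fun t ht =>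
    ⟨by linarith [ht.1], by linarith [ht.2]⟩
  let X : ℝ → ℝ → ℝ := fun t z => ε * (s t * φ1 z + ε * v t z)
  have X_le : ∀ t ∈ D.J, ∀ z ∈ Icc (0:ℝ) 1, |X t z| < r := by
    intro t ht z hz
    refine lt_of_le_of_lt ?_ hsmall
    show |ε * (s t * φ1 z + ε * v t z)| ≤ _
    rw [abs_mul]
    refine mul_le_mul_of_nonneg_left ((abs_add_le _ _).trans (add_le_add ?_ ?_)) (abs_nonneg _)
    · rw [abs_mul]
      have := hP z hz
      rw [Real.norm_eq_abs] at this
      exact (mul_le_mul (s_le t) this (abs_nonneg _) zero_le_one).trans_eq (one_mul _)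
    · rw [abs_mul]
      have h1 : |ε| ≤ 1 := (hε.trans (min_le_left _ _)).trans hε01
      exact (mul_le_mul h1 (vle t ht z hz) (abs_nonneg _) zero_le_one).trans_eq (one_mul _)
  let y : ℝ → ℝ → ℝ := fun t z => ε * (s t * φ z) + ε ^ 2 * w t z
  have y_s : ContDiff ℝ ∞ (fun q : ℝ × ℝ => y q.1 q.2) :=
    (contDiff_const.mul ((s_s.comp contDiff_fst).mul (φ_s.comp contDiff_snd))).add
      (contDiff_const.mul w_s)
  have yt_s : ∀ t, ContDiff ℝ ∞ (y t) := fun t =>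
    y_s.comp (contDiff_const.prodMk contDiff_id)
  have y_z : ∀ t ∈ Icc (-(1/2)) (T + 1/2), ∀ z ∈ Icc (0:ℝ) 1, deriv (y t) z = -(X t z) := by
    intro t ht z hz
    have h1 : HasDerivWithinAt (y t) (deriv (y t) z) (Icc 0 1) z :=
      ((yt_s t).differentiable (by simp)).differentiableAt.hasDerivAt.hasDerivWithinAt
    have h2 : HasDerivWithinAt (w t) (-(v t z)) (Icc 0 1) z :=
      (pzW t (hJ t ht) z hz).congr (fun x hx => w_eq t ht x hx) (w_eq t ht z hz)
    have h3 : HasDerivWithinAt (y t) (ε * (s t * (-(φ1 z))) + ε ^ 2 * (-(v t z))) (Icc 0 1) z :=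
      (((φ_d z).hasDerivWithinAt.const_mul (s t)).const_mul ε).add (h2.const_mul (ε ^ 2))
    have h4 := (uniqueDiffOn_Icc (zero_lt_one (α := ℝ)) z hz).eq_deriv _ h1 h3
    rw [h4]
    show _ = -(ε * (s t * φ1 z + ε * v t z))
    ring
  have y_t : ∀ t ∈ Ioo (-(1/2)) (T + 1/2), ∀ z ∈ Icc (0:ℝ) 1,
      dt y t z = ε * (s1 t * φ z) + ε ^ 2 * W 1 t z := by
    intro t ht z hz
    have hn : Icc (-(1/2)) (T + 1/2) ∈ 𝓝 t := Icc_mem_nhds ht.1 ht.2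
    have h2 : HasDerivAt (fun τ => W 0 τ z) (W 1 t z) t :=
      (ptW 0 t (hJ t (Ioo_subset_Icc_self ht)) z hz).hasDerivAt (mem_of_superset hn hJ)
    have h3 : HasDerivAt (fun τ => w τ z) (W 1 t z) t := by
      refine h2.congr_of_eventuallyEq ?_
      filter_upwards [hn] with τ hτ using w_eq τ hτ z hz
    exact ((((s_d t).mul_const (φ z)).const_mul ε).add (h3.const_mul (ε ^ 2))).deriv
  have y_tt : ∀ t ∈ Ioo (-(1/2)) (T + 1/2), ∀ z ∈ Icc (0:ℝ) 1,
      dt (dt y) t z = -(ε * (s t * (lam * φ z))) + ε ^ 2 * W 2 t z := by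
    intro t ht z hz
    have hn : Icc (-(1/2)) (T + 1/2) ∈ 𝓝 t := Icc_mem_nhds ht.1 ht.2
    have h2 : HasDerivAt (fun τ => W 1 τ z) (W 2 t z) t :=
      (ptW 1 t (hJ t (Ioo_subset_Icc_self ht)) z hz).hasDerivAt (mem_of_superset hn hJ)
    have h3 := ((((s1_d t).mul_const (φ z)).const_mul ε).add (h2.const_mul (ε ^ 2)))
    have e : (fun τ => dt y τ z) =ᶠ[𝓝 t] fun τ => ε * (s1 τ * φ z) + ε ^ 2 * W 1 τ z := by
      filter_upwards [Ioo_mem_nhds ht.1 ht.2] with τ hτ using y_t τ hτ z hz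
    show deriv (fun τ => dt y τ z) t = _
    rw [e.deriv_eq]
    refine h3.deriv.trans ?_
    ring
  refine ⟨y, y_s, ?_, ?_, ?_, ?_⟩
  · intro t ht
    have ht' := Ioo_subset_Icc_self (hT2 t ht)
    have h1 : φ 1 = 0 := hphi1
    have h2 : w t 1 = 0 := by
      rw [w_eq t ht' 1 (by simp)]
      exact L.bdry 0 t (hJ t ht')
    show ε * (s t * φ 1) + ε ^ 2 * w t 1 = 0
    rw [h1, h2]; ring
  · intro t ht z hz
    have ht' := Ioo_subset_Icc_self (hT2 t ht)
    rw [y_z t ht' z hz, abs_neg]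
    exact (X_le t (hJ t ht') z hz).trans hr1
  · intro t ht z hz
    have ht' := Ioo_subset_Icc_self (hT2 t ht)
    have hz' := Ioo_subset_Icc_self hz
    have hzn : Ioo (0:ℝ) 1 ∈ 𝓝 z := Ioo_mem_nhds hz.1 hz.2
    have hchi : D.chi t = 1 := Dchi t ht.1
    have ez : deriv (y t) =ᶠ[𝓝 z] fun x => -(X t x) := by
      filter_upwards [hzn] with x hx using y_z t ht' x (Ioo_subset_Icc_self hx)
    have hdd : HasDerivAt (deriv (y t)) (deriv (deriv (y t)) z) z :=
      ((contDiff_infty_iff_deriv.1 (yt_s t)).2.differentiable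
        (by simp)).differentiableAt.hasDerivAt
    have hX' : HasDerivAt (X t) (-(deriv (deriv (y t)) z)) z := by
      refine hdd.neg.congr_of_eventuallyEq ?_
      filter_upwards [ez] with x hx
      show X t x = -(deriv (y t) x)
      rw [hx, neg_neg]
    have hF : HasDerivAt (fun x => x ^ (N / 2) * (v t x + (ε ^ 2)⁻¹ * (Gfun N (X t x) - X t x)))
        (-(z ^ (N / 2 - 1) * W 2 t z)) z := by
      have hfl' := hfl t (hJ t ht') z hz
      rw [Db] at hfl'
      refine hfl'.congr_of_eventuallyEq ?_
      filter_upwards [hzn] with x hx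
      have hx' := Ioo_subset_Icc_self hx
      have hPf : D.Pf ε t x (v t x) = v t x + D.chi t * ((ε ^ 2)⁻¹ * D.g (X t x)) := by
        unfold Dat.Pf Dat.Q
        rw [Dp]
      rw [hPf, hchi, one_mul, hgr _ (X_le t (hJ t ht') x hx').le]
    have hXl := X_le t (hJ t ht') z hz'
    have hpe : z * (s t * (-(φ2 z))) + N / 2 * (s t * φ1 z) = s t * (lam * φ z) := by
      linear_combination (s t) * φ_ode z
    have key := core hN (p := fun x => s t * φ1 x) (v := v t) (X := X t) e0 hz.1
      (Eventually.of_forall fun x => rfl) hX' ((dphi1 z).const_mul (s t))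
      (by have := (abs_lt.1 hXl).1; linarith) hF hpe
    rw [y_tt t (hT2 t ht) z hz']
    unfold Del GI GII
    rw [y_z t ht' z hz', neg_neg]
    rw [neg_neg] at key
    exact key
  · intro t ht z hz
    have ht' := Ioo_subset_Icc_self (hT2 t ht)
    have e : y t z - ε * (s t * φ z) = ε ^ 2 * W 0 t z := by
      rw [← w_eq t ht' z hz]
      show ε * (s t * φ z) + ε ^ 2 * w t z - ε * (s t * φ z) = _
      ring
    rw [e, abs_mul, abs_of_nonneg (sq_nonneg ε), mul_comm]
    have := L.W_le t (hJ t ht') z hz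
    exact mul_le_mul_of_nonneg_right (by linarith) (sq_nonneg ε)

theorem final (N : ℝ) (hN : 4 ≤ N) (lam θ₀ : ℝ) (hlam : 0 < lam)
    (hroot : Phi N lam = 0) (T : ℝ) (hT : 0 < T) :
      ∃ ε₁ > (0:ℝ), ∃ C > (0:ℝ), ∀ ε : ℝ, |ε| ≤ ε₁ →
        ∃ y : ℝ → ℝ → ℝ,
          ContDiff ℝ (⊤ : ℕ∞) (fun p : ℝ × ℝ => y p.1 p.2) ∧
          (∀ t ∈ Icc (0:ℝ) T, y t 1 = 0) ∧
          (∀ t ∈ Icc (0:ℝ) T, ∀ z ∈ Icc (0:ℝ) 1, |deriv (y t) z| < 1) ∧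
          (∀ t ∈ Icc (0:ℝ) T, ∀ z ∈ Ioo (0:ℝ) 1,
            dt (dt y) t z - Del N (y t) z
              = GI N (-(deriv (y t) z)) * Del N (y t) z + GII N (-(deriv (y t) z))) ∧
          (∀ t ∈ Icc (0:ℝ) T, ∀ z ∈ Icc (0:ℝ) 1,
            |y t z - ε * (Real.sin (Real.sqrt lam * t + θ₀) * Phi N (lam * z))|
              ≤ C * ε ^ 2) := by
  have hβ : 1 ≤ N / 2 := by linarith
  -- the profile
  have hPhi : ∀ X, Phi N X = Ph (N / 2) X := fun X => rfl
  let s : ℝ → ℝ := fun t => Real.sin (Real.sqrt lam * t + θ₀)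
  let s1 : ℝ → ℝ := fun t => Real.sqrt lam * Real.cos (Real.sqrt lam * t + θ₀)
  let φ : ℝ → ℝ := fun z => Ph (N / 2) (lam * z)
  let φ1 : ℝ → ℝ := fun z => lam * Ph (N / 2 + 1) (lam * z)
  let φ2 : ℝ → ℝ := fun z => lam ^ 2 * Ph (N / 2 + 1 + 1) (lam * z)
  have hsq : Real.sqrt lam * Real.sqrt lam = lam := Real.mul_self_sqrt hlam.le
  have hlin : ∀ t, HasDerivAt (fun t => Real.sqrt lam * t + θ₀) (Real.sqrt lam) t := fun t => by
    simpa using ((hasDerivAt_id t).const_mul (Real.sqrt lam)).add_const θ₀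
  have s_d : ∀ t, HasDerivAt s (s1 t) t := fun t => by
    refine (hlin t).sin.congr_deriv ?_
    show _ = Real.sqrt lam * Real.cos (Real.sqrt lam * t + θ₀)
    ring
  have s1_d : ∀ t, HasDerivAt s1 (-(lam * s t)) t := fun t => by
    refine ((hlin t).cos.const_mul (Real.sqrt lam)).congr_deriv ?_
    show _ = -(lam * Real.sin (Real.sqrt lam * t + θ₀))
    linear_combination (-Real.sin (Real.sqrt lam * t + θ₀)) * hsq
  have hlz : ∀ z, HasDerivAt (fun z => lam * z) lam z := fun z => by
    simpa using (hasDerivAt_id z).const_mul lam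
  have φ_d : ∀ z, HasDerivAt φ (-(φ1 z)) z := fun z => by
    refine ((Ph_deriv hβ (lam * z)).comp z (hlz z)).congr_deriv ?_
    show _ = -(lam * Ph (N / 2 + 1) (lam * z))
    ring
  have dphi1 : ∀ z, HasDerivAt φ1 (-(φ2 z)) z := fun z => by
    refine (((Ph_deriv (by linarith) (lam * z)).comp z (hlz z)).const_mul lam).congr_deriv ?_
    show _ = -(lam ^ 2 * Ph (N / 2 + 1 + 1) (lam * z))
    ring
  have φ_ode : ∀ z, z * (-(φ2 z)) + N / 2 * φ1 z = lam * φ z := fun z => by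
    have := Ph_ode hβ (lam * z)
    show z * (-(lam ^ 2 * Ph (N / 2 + 1 + 1) (lam * z))) + N / 2 * (lam * Ph (N / 2 + 1) (lam * z))
      = lam * Ph (N / 2) (lam * z)
    linear_combination (-lam) * this
  have s_s : ContDiff ℝ ∞ s := Real.contDiff_sin.comp
    ((contDiff_const.mul contDiff_id).add contDiff_const)
  have φ_s : ContDiff ℝ ∞ φ := (Ph_smooth hβ).comp (contDiff_const.mul contDiff_id)
  have sphi1 : ContDiff ℝ ∞ φ1 :=
    contDiff_const.mul ((Ph_smooth (by linarith)).comp (contDiff_const.mul contDiff_id))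
  have s_le : ∀ t, |s t| ≤ 1 := fun t => Real.abs_sin_le_one _
  obtain ⟨P, hP⟩ := isCompact_Icc.exists_bound_of_continuousOn
    (s := Icc (0:ℝ) 1) sphi1.continuous.continuousOn
  have hP0 : 0 ≤ P := (norm_nonneg _).trans (hP 0 (by simp))
  -- the nonlinearity
  have g0d : deriv (fun x => Gfun N x - x) 0 = 0 := by
    have := ((Gfun_hasDeriv hN (v := 0) (by norm_num)).sub (hasDerivAt_id 0)).deriv
    simp only [add_zero, Real.one_rpow, sub_self] at this
    exact this
  obtain ⟨r, hr0, hr1, g, g_s, g_c, g_d, gz, gzd, hgr⟩ :=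
    trunc (Gfun_smooth N) (by simp [Gfun_zero]) g0d
  let D : Dat :=
    { b := N / 2, hb := by linarith, T := T, hT := hT
      chi := fun t => Real.smoothTransition (2 * t + 1)
      chi_s := Real.smoothTransition.contDiff.comp
        ((contDiff_const.mul contDiff_id).add contDiff_const)
      chi0 := fun t => Real.smoothTransition.nonneg _
      chi1 := fun t => Real.smoothTransition.le_one _
      chi_z := fun t ht => Real.smoothTransition.zero_of_nonpos (by linarith)
      p := fun t z => s t * φ1 z
      p_s := (s_s.comp contDiff_fst).mul (sphi1.comp contDiff_snd)
      g := g, g_s := g_s, g_c := g_c, g_d := g_d, g0 := gz, g0d := gzd }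
  have hphi1 : φ 1 = 0 := by
    show Ph (N / 2) (lam * 1) = 0
    rw [mul_one]; exact hroot
  exact final_aux hN hT s_d s1_d φ_d dphi1 φ_ode s_s φ_s hphi1 s_le hP hP0 hr0 hr1 D rfl rfl
    (fun t ht => Real.smoothTransition.one_of_one_le (by linarith)) (fun t z => rfl) hgr

end EulerNM

theorem stmt0 (N : ℝ) (hN : 4 ≤ N) (lam θ₀ : ℝ) (hlam : 0 < lam)
    (hroot : Phi N lam = 0) :
    ∀ T : ℝ, 0 < T →
      ∃ ε₁ > (0:ℝ), ∃ C > (0:ℝ), ∀ ε : ℝ, |ε| ≤ ε₁ →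
        ∃ y : ℝ → ℝ → ℝ,
          ContDiff ℝ (⊤ : ℕ∞) (fun p : ℝ × ℝ => y p.1 p.2) ∧
          (∀ t ∈ Icc (0:ℝ) T, y t 1 = 0) ∧
          (∀ t ∈ Icc (0:ℝ) T, ∀ z ∈ Icc (0:ℝ) 1, |deriv (y t) z| < 1) ∧
          (∀ t ∈ Icc (0:ℝ) T, ∀ z ∈ Ioo (0:ℝ) 1,
            dt (dt y) t z - Del N (y t) z
              = GI N (-(deriv (y t) z)) * Del N (y t) z + GII N (-(deriv (y t) z))) ∧
          (∀ t ∈ Icc (0:ℝ) T, ∀ z ∈ Icc (0:ℝ) 1,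
            |y t z - ε * (Real.sin (Real.sqrt lam * t + θ₀) * Phi N (lam * z))|
              ≤ C * ε ^ 2) := by
  exact fun T hT => EulerNM.final N hN lam θ₀ hlam hroot T hT
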